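/- arXiv:1906.06817 — 2 statements merged into one kernel-verified Lean document; each statement's English description precedes it below -/
import Mathlib

section
/- Fix r ≥ 2, and let J_r be the double determinantal ideal generated by the s-minors of the horizontal concatenation and the t-minors of the vertical concatenation of r matrices of size m × n of distinct indeterminates, with s ≤ t. Then height(J_r) = (m−s+1)(n−s+1) + (r−1)·n·(m−s+1) + (n−t+1)·Σ_{q=2}^{r} [(s−1) − max{0, t−(s−1)(q−1)−1}]. -/
/-! Statement 10: the height of the double determinantal ideal J_r (r ≥ 2,
s ≤ t) is (m−s+1)(n−s+1) + (r−1)n(m−s+1) + (n−t+1)·Σ_{q=2}^r [(s−1) −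
max{0, t−(s−1)(q−1)−1}] (natural-number subtraction is truncated, so it
implements the max{0,·}). Height is the infimum of the heights of primes
containing the ideal. -/

open MvPolynomial

noncomputable section

/-- A term order on monomials (exponent vectors) in variables indexed by `σ`. -/
structure TermOrder (σ : Type*) where
  lt : (σ →₀ ℕ) → (σ →₀ ℕ) → Prop
  trans : ∀ {a b c}, lt a b → lt b c → lt a c
  irrefl : ∀ a, ¬ lt a a
  total : ∀ a b, a ≠ b → lt a b ∨ lt b a
  zero_lt : ∀ a, a ≠ 0 → lt 0 a
  add_right : ∀ a b c, lt a b → lt (a + c) (b + c)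

/-- `m` is the leading monomial of `f` with respect to the term order `tord`. -/
def IsLeadMono {σ K : Type*} [Field K] (tord : TermOrder σ) (f : MvPolynomial σ K)
    (m : σ →₀ ℕ) : Prop :=
  m ∈ f.support ∧ ∀ m' ∈ f.support, m' ≠ m → tord.lt m' m

/-- The initial ideal of `I` with respect to the term order `tord`. -/
def initialIdeal {σ K : Type*} [Field K] (tord : TermOrder σ) (I : Ideal (MvPolynomial σ K)) :
    Ideal (MvPolynomial σ K) :=
  Ideal.span {g | ∃ f ∈ I, ∃ m, IsLeadMono tord f m ∧ g = monomial m (1 : K)}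

/-- `G` is a Gröbner basis of `I` with respect to `tord`. -/
def IsGroebnerBasis {σ K : Type*} [Field K] (tord : TermOrder σ)
    (I : Ideal (MvPolynomial σ K)) (G : Set (MvPolynomial σ K)) : Prop :=
  G ⊆ (I : Set (MvPolynomial σ K)) ∧ Ideal.span G = I ∧
    initialIdeal tord I = Ideal.span {g | ∃ f ∈ G, ∃ m, IsLeadMono tord f m ∧ g = monomial m (1 : K)}

/-- The set of `t × t` minors of a matrix. -/
def minorsSet {A : Type*} [CommRing A] (t a b : ℕ) (M : Matrix (Fin a) (Fin b) A) : Set A :=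
  {d | ∃ (rs : Fin t → Fin a) (cs : Fin t → Fin b),
    StrictMono rs ∧ StrictMono cs ∧ d = (M.submatrix rs cs).det}

/-- The variable in row `i`, column `k` of the horizontal concatenation
`H = (X_1 ⋯ X_r)` of `r` generic `m × n` matrices. -/
def varH (r m n : ℕ) (hn : 0 < n) (i : Fin m) (k : Fin (r * n)) :
    Fin r × Fin m × Fin n :=
  (⟨k.val / n, by
      have := k.isLt
      exact (Nat.div_lt_iff_lt_mul hn).mpr this⟩, i, ⟨k.val % n, Nat.mod_lt _ hn⟩)

/-- The variable in row `k`, column `j` of the vertical concatenation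
`V` of `r` generic `m × n` matrices. -/
def varV (r m n : ℕ) (hm : 0 < m) (k : Fin (r * m)) (j : Fin n) :
    Fin r × Fin m × Fin n :=
  (⟨k.val / m, by
      have := k.isLt
      exact (Nat.div_lt_iff_lt_mul hm).mpr this⟩, ⟨k.val % m, Nat.mod_lt _ hm⟩, j)

/-- The horizontal concatenation `H` as a matrix of polynomials. -/
def Hmat (K : Type*) [Field K] (r m n : ℕ) (hn : 0 < n) :
    Matrix (Fin m) (Fin (r * n)) (MvPolynomial (Fin r × Fin m × Fin n) K) :=
  Matrix.of fun i k => X (varH r m n hn i k)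

/-- The vertical concatenation `V` as a matrix of polynomials. -/
def Vmat (K : Type*) [Field K] (r m n : ℕ) (hm : 0 < m) :
    Matrix (Fin (r * m)) (Fin n) (MvPolynomial (Fin r × Fin m × Fin n) K) :=
  Matrix.of fun k j => X (varV r m n hm k j)

/-- `tord` is a diagonal term order for the matrix of variables `v`: the leading
monomial of the determinant of every square submatrix (with strictly increasing
rows and columns) is the product of its main diagonal entries. -/
def IsDiagonalFor (K : Type*) [Field K] {σ : Type*} (tord : TermOrder σ) {a b : ℕ}
    (v : Fin a → Fin b → σ) : Prop :=
  ∀ (t : ℕ) (rs : Fin t → Fin a) (cs : Fin t → Fin b), StrictMono rs → StrictMono cs →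
    0 < t →
    IsLeadMono tord ((Matrix.of fun i j => (X (v (rs i) (cs j)) : MvPolynomial σ K)).det)
      (∑ i : Fin t, Finsupp.single (v (rs i) (cs i)) 1)

/-- A term order is diagonal for the double determinantal configuration if it is
diagonal for both the horizontal and the vertical concatenation. -/
def IsDiagonalTermOrder (K : Type*) [Field K] (r m n : ℕ) (hm : 0 < m) (hn : 0 < n)
    (tord : TermOrder (Fin r × Fin m × Fin n)) : Prop :=
  IsDiagonalFor K tord (fun i k => varH r m n hn i k) ∧
    IsDiagonalFor K tord (fun k j => varV r m n hm k j)

/-- The double determinantal ideal `J = I_s(H) + I_t(V)`. -/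
def doubleDetIdeal (K : Type*) [Field K] (r m n s t : ℕ) (hm : 0 < m) (hn : 0 < n) :
    Ideal (MvPolynomial (Fin r × Fin m × Fin n) K) :=
  Ideal.span (minorsSet s m (r * n) (Hmat K r m n hn) ∪ minorsSet t (r * m) n (Vmat K r m n hm))

/-- The height of an ideal: the infimum of the heights of the prime ideals containing it. -/
noncomputable def idealHeight {R : Type*} [CommRing R] (I : Ideal R) : ℕ∞ :=
  ⨅ p : {p : PrimeSpectrum R // I ≤ p.asIdeal}, Order.height p.val

section Part1
open scoped Polynomial

attribute [local instance] Polynomial.algebra Polynomial.isLocalization in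
lemma ddh_height_le_one {A : Type*} [CommRing A] [IsDomain A]
    (Q : Ideal A[X]) [Q.IsPrime] (h : Q.comap Polynomial.C = ⊥) : Q.height ≤ 1 := by
  let F := FractionRing A
  have disj : Disjoint ((nonZeroDivisors A).map Polynomial.C : Set A[X]) Q := by
    refine Set.disjoint_left.mpr ?_
    rintro _ ⟨b, hb, rfl⟩ hbQ
    have : b ∈ Q.comap Polynomial.C := hbQ
    rw [h, Ideal.mem_bot] at this
    exact nonZeroDivisors.ne_zero hb this
  have := IsLocalization.height_map_of_disjoint (S := F[X]) ((nonZeroDivisors A).map Polynomial.C) Q disj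
  rw [← this]
  have hp : (Q.map (algebraMap A[X] F[X])).IsPrime :=
    IsLocalization.isPrime_of_isPrime_disjoint ((nonZeroDivisors A).map Polynomial.C) _ Q inferInstance disj
  have h2 := Ideal.height_le_ringKrullDim_of_ne_top hp.ne_top
  rw [Polynomial.ringKrullDim_of_isNoetherianRing, ringKrullDim_eq_zero_of_field, zero_add] at h2
  exact_mod_cast h2

lemma ddh_step {K : Type*} {R : Type*} [Field K] [CommRing R] [IsNoetherianRing R] [Algebra K R]
    (P : Ideal R[X]) [P.IsPrime] :
    (P.height = (P.under R).height ∧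
      Algebra.trdeg K (R[X] ⧸ P) = Algebra.trdeg K (R ⧸ P.under R) + 1) ∨
    (P.height = (P.under R).height + 1 ∧
      Algebra.trdeg K (R[X] ⧸ P) = Algebra.trdeg K (R ⧸ P.under R)) := by
  have hadd := trdeg_add_eq K (R ⧸ P.under R) (A := R[X] ⧸ P)
  let p := P.under R
  change (P.height = p.height ∧ _ = Algebra.trdeg K (R ⧸ p) + 1) ∨
    (P.height = p.height + 1 ∧ _ = Algebra.trdeg K (R ⧸ p))
  change Algebra.trdeg K (R ⧸ p) + Algebra.trdeg (R ⧸ p) (R[X] ⧸ P) = _ at hadd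
  have hpp : p.IsPrime := inferInstanceAs (P.under R).IsPrime
  have hover : P.LiesOver p := inferInstanceAs (P.LiesOver (P.under R))
  have hht := Ideal.height_eq_height_add_of_liesOver_of_hasGoingDown p P
  let ψ : (R ⧸ p)[X] →ₐ[R ⧸ p] (R[X] ⧸ P) := Polynomial.aeval (Ideal.Quotient.mk P Polynomial.X)
  have hcomp : ∀ f : R[X], ψ (f.map (Ideal.Quotient.mk p)) = Ideal.Quotient.mk P f := by
    intro f
    induction f using Polynomial.induction_on' with
    | add f g hf hg => simp only [Polynomial.map_add, map_add, hf, hg]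
    | monomial k a =>
      rw [← Polynomial.C_mul_X_pow_eq_monomial]
      simp only [Polynomial.map_mul, Polynomial.map_pow, Polynomial.map_C, Polynomial.map_X, map_mul, map_pow, ψ, Polynomial.aeval_X,
        Polynomial.aeval_C]
      rfl
  have hsurj : Function.Surjective ψ := by
    intro y
    obtain ⟨f, rfl⟩ := Ideal.Quotient.mk_surjective y
    exact ⟨_, hcomp f⟩
  let Q : Ideal (R ⧸ p)[X] := RingHom.ker ψ
  have hQp : Q.IsPrime := RingHom.ker_isPrime _
  have hQbot : Q.comap Polynomial.C = ⊥ := by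
    rw [eq_bot_iff]
    intro x hx
    have : ψ (Polynomial.C x) = 0 := hx
    rw [Polynomial.aeval_C] at this
    exact (FaithfulSMul.algebraMap_injective (R ⧸ P.under R) (R[X] ⧸ P)) (this.trans (map_zero _).symm)
  have hheq : (P.map (Ideal.Quotient.mk <| p.map (algebraMap R R[X]))).height = Q.height := by
    let e : (R[X] ⧸ (p.map (algebraMap R R[X]))) ≃+* (R ⧸ p)[X] :=
      (Ideal.polynomialQuotientEquivQuotientPolynomial p).symm
    rw [← e.height_comap Q]
    congr 1
    apply Ideal.comap_injective_of_surjective (Ideal.Quotient.mk _) Ideal.Quotient.mk_surjective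
    rw [Ideal.comap_map_of_surjective _ Ideal.Quotient.mk_surjective, ← RingHom.ker_eq_comap_bot,
      Ideal.mk_ker, sup_eq_left.mpr (Ideal.map_le_iff_le_comap.mpr le_rfl)]
    ext f
    rw [Ideal.mem_comap, Ideal.mem_comap]
    have : e (Ideal.Quotient.mk _ f) = f.map (Ideal.Quotient.mk p) :=
      Ideal.polynomialQuotientEquivQuotientPolynomial_symm_mk p f
    rw [this]
    change _ ↔ ψ _ = 0
    rw [hcomp, Ideal.Quotient.eq_zero_iff_mem]
  rw [hheq] at hht
  by_cases hQ : Q = ⊥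
  · left
    rw [hQ, Ideal.height_bot, add_zero] at hht
    refine ⟨hht, ?_⟩
    have hinj : Function.Injective ψ := (RingHom.injective_iff_ker_eq_bot _).mpr hQ
    have h1 := (AlgEquiv.ofBijective ψ ⟨hinj, hsurj⟩).lift_trdeg_eq
    rw [Polynomial.trdeg_of_isDomain] at h1
    simp only [Cardinal.lift_id] at h1
    rw [← hadd, ← h1]
  · right
    have h1 : Q.height = 1 := by
      refine le_antisymm (ddh_height_le_one Q hQbot) ?_
      rw [Order.one_le_iff_ne_zero, Ne, Ideal.height_eq_zero_iff_eq_bot]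
      exact hQ
    refine ⟨by rw [hht, h1], ?_⟩
    have halg : Algebra.IsAlgebraic (R ⧸ p) (R[X] ⧸ P) := by
      obtain ⟨g, hg, hg0⟩ := Submodule.exists_mem_ne_zero_of_ne_bot hQ
      have hx : IsAlgebraic (R ⧸ p) (Ideal.Quotient.mk P Polynomial.X) := ⟨g, hg0, hg⟩
      refine ⟨fun y => ?_⟩
      obtain ⟨f, rfl⟩ := hsurj y
      have hm : ψ f ∈ Subalgebra.algebraicClosure (R ⧸ p) (R[X] ⧸ P) := by
        have : Ideal.Quotient.mk P Polynomial.X ∈ Subalgebra.algebraicClosure (R ⧸ p) (R[X] ⧸ P) := hx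
        exact Algebra.adjoin_le (Set.singleton_subset_iff.mpr this) (Polynomial.aeval_mem_adjoin_singleton _ _)
      exact hm
    rw [← hadd, trdeg_eq_zero (R := R ⧸ p), add_zero]

lemma ddh_main_fin {K : Type*} [Field K] (n : ℕ) : ∀ (P : Ideal (MvPolynomial (Fin n) K))
    [P.IsPrime], ∃ d : ℕ, Algebra.trdeg K (MvPolynomial (Fin n) K ⧸ P) = d ∧
      P.height + d = n := by
  induction n with
  | zero =>
    intro P hP
    refine ⟨0, ?_, ?_⟩
    · have h1 := trdeg_le_of_surjective (R := K) (Ideal.Quotient.mkₐ K P)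
        (Ideal.Quotient.mkₐ_surjective K P)
      rw [MvPolynomial.trdeg_of_isDomain] at h1
      simpa using h1
    · have h2 := Ideal.height_le_ringKrullDim_of_ne_top hP.ne_top
      simp at h2
      simp [h2]
  | succ n ih =>
    intro P hP
    let e := MvPolynomial.finSuccEquiv K n
    let P' : Ideal (MvPolynomial (Fin n) K)[X] := P.comap e.symm.toRingEquiv
    have hP' : P'.IsPrime := Ideal.comap_isPrime _ _
    have hh : P'.height = P.height := RingEquiv.height_comap e.symm.toRingEquiv P
    have ht : Algebra.trdeg K (MvPolynomial (Fin (n+1)) K ⧸ P) =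
        Algebra.trdeg K ((MvPolynomial (Fin n) K)[X] ⧸ P') := by
      apply AlgEquiv.trdeg_eq
      refine Ideal.quotientEquivAlg P P' e ?_
      exact Ideal.comap_symm e.toRingEquiv
    obtain ⟨d, hd, hd'⟩ := ih (P'.under _)
    rcases ddh_step (K := K) P' with ⟨h1, h2⟩ | ⟨h1, h2⟩
    · refine ⟨d + 1, ?_, ?_⟩
      · rw [ht, h2, hd]; push_cast; rfl
      · rw [← hh, h1]; push_cast; rw [← hd', add_assoc]
    · refine ⟨d, ?_, ?_⟩
      · rw [ht, h2, hd]
      · rw [← hh, h1]; push_cast; rw [← hd', add_right_comm]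

lemma ddh_main {K : Type*} [Field K] {ι : Type} [Fintype ι] (P : Ideal (MvPolynomial ι K))
    [P.IsPrime] : ∃ d : ℕ, Algebra.trdeg K (MvPolynomial ι K ⧸ P) = d ∧
      P.height + d = Fintype.card ι := by
  let e := MvPolynomial.renameEquiv K (Fintype.equivFin ι)
  let P' : Ideal (MvPolynomial (Fin (Fintype.card ι)) K) := P.comap e.symm.toRingEquiv
  have hP' : P'.IsPrime := Ideal.comap_isPrime _ _
  have hh : P'.height = P.height := RingEquiv.height_comap e.symm.toRingEquiv P
  have ht : Algebra.trdeg K (MvPolynomial ι K ⧸ P) =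
      Algebra.trdeg K (MvPolynomial (Fin (Fintype.card ι)) K ⧸ P') := by
    apply AlgEquiv.trdeg_eq
    refine Ideal.quotientEquivAlg P P' e ?_
    exact Ideal.comap_symm e.toRingEquiv
  rw [ht, ← hh]
  exact ddh_main_fin _ P'
end Part1
section Part2

lemma ddh_exists_rows {L : Type*} [Field L] {p : ℕ} {β : Type*} [Fintype β]
    (M : Matrix (Fin p) β L) (s : ℕ) (hs : s ≤ M.rank) :
    ∃ rs : Fin s → Fin p, StrictMono rs ∧ LinearIndependent L (fun i => M (rs i)) := by
  classical
  obtain ⟨b, hb, hspan, hli⟩ := exists_linearIndependent L (Set.range M.row)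
  rw [Matrix.rank_eq_finrank_span_row, ← hspan] at hs
  have hbfin : b.Finite := (Set.finite_range _).subset hb
  have := hbfin.fintype
  rw [finrank_span_set_eq_card hli] at hs
  choose g hg using fun x : b => hb x.2
  have hginj : Function.Injective g := by
    intro x y hxy
    apply Subtype.ext
    rw [← hg x, ← hg y, hxy]
  let T : Finset (Fin p) := Finset.univ.image g
  have hT : s ≤ T.card := by
    rw [Finset.card_image_of_injective _ hginj]
    simpa using hs
  obtain ⟨U, hUT, hUc⟩ := Finset.exists_subset_card_eq hT
  refine ⟨U.orderEmbOfFin hUc, (U.orderEmbOfFin hUc).strictMono, ?_⟩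
  have hmem : ∀ i, ∃ x : b, g x = U.orderEmbOfFin hUc i := by
    intro i
    have := hUT (U.orderEmbOfFin_mem hUc i)
    simpa [T] using this
  choose f hf using hmem
  have hfinj : Function.Injective f := by
    intro i j hij
    apply (U.orderEmbOfFin hUc).injective
    rw [← hf i, ← hf j, hij]
  have := hli.comp f hfinj
  have e : (fun i => M (U.orderEmbOfFin hUc i)) = Subtype.val ∘ f := by
    funext i
    rw [← hf i]
    exact hg (f i)
  rw [e]
  exact this

lemma ddh_exists_minor {L : Type*} [Field L] {p q : ℕ}
    (M : Matrix (Fin p) (Fin q) L) (s : ℕ) (hs : s ≤ M.rank) :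
    ∃ (rs : Fin s → Fin p) (cs : Fin s → Fin q), StrictMono rs ∧ StrictMono cs ∧
      (M.submatrix rs cs).det ≠ 0 := by
  obtain ⟨rs, hrs, hli⟩ := ddh_exists_rows M s hs
  have h1 : (M.submatrix rs id).rank = s := by
    have := LinearIndependent.rank_matrix (M := M.submatrix rs id) hli
    simpa using this
  obtain ⟨cs, hcs, hli2⟩ := ddh_exists_rows (M.submatrix rs id).transpose s
    (by rw [Matrix.rank_transpose, h1])
  refine ⟨rs, cs, hrs, hcs, ?_⟩
  have h2 : IsUnit (M.submatrix rs cs).transpose :=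
    Matrix.linearIndependent_rows_iff_isUnit.mp hli2
  rw [Matrix.isUnit_iff_isUnit_det, Matrix.det_transpose] at h2
  exact h2.ne_zero

lemma ddh_decomp {L : Type*} [Field L] {p : ℕ} {β : Type*} [Fintype β]
    (M : Matrix (Fin p) β L) :
    ∃ (rs : Fin M.rank → Fin p) (P : Fin p → Fin M.rank → L), StrictMono rs ∧
      (∀ i, P (rs i) = Pi.single i 1) ∧ ∀ i j, M i j = ∑ k, P i k * M (rs k) j := by
  classical
  obtain ⟨rs, hrs, hli⟩ := ddh_exists_rows M M.rank le_rfl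
  have hspan : Submodule.span L (Set.range fun i => M (rs i)) = Submodule.span L (Set.range M.row) := by
    apply Submodule.eq_of_le_of_finrank_eq
    · apply Submodule.span_mono
      rintro _ ⟨i, rfl⟩
      exact ⟨rs i, rfl⟩
    · rw [← Matrix.rank_eq_finrank_span_row, finrank_span_eq_card hli, Fintype.card_fin]
  have hex : ∀ i, ∃ c : Fin M.rank → L, ∑ k, c k • M (rs k) = M i := by
    intro i
    have : M i ∈ Submodule.span L (Set.range fun i => M (rs i)) := by
      rw [hspan]; exact Submodule.subset_span ⟨i, rfl⟩
    exact (Submodule.mem_span_range_iff_exists_fun L).mp this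
  choose P hP using hex
  refine ⟨rs, P, hrs, ?_, ?_⟩
  · intro i
    have h1 : ∑ k, (P (rs i) k - (Pi.single i 1 : Fin M.rank → L) k) • M (rs k) = 0 := by
      simp only [sub_smul, Finset.sum_sub_distrib, hP]
      simp [Pi.single_apply]
    funext k
    exact sub_eq_zero.mp (Fintype.linearIndependent_iff.mp hli _ h1 k)
  · intro i j
    rw [← hP i]
    simp [Finset.sum_apply]

lemma ddh_det_zero {L : Type*} [Field L] {s : ℕ} {γ : Type*} [Fintype γ]
    (h : Fintype.card γ < s) (A : Matrix (Fin s) γ L) (B : Matrix γ (Fin s) L) :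
    (A * B).det = 0 := by
  by_contra hne
  have h1 : (A * B).rank = s := by
    have := Matrix.rank_of_isUnit (A * B) ((Matrix.isUnit_iff_isUnit_det _).mpr (isUnit_iff_ne_zero.mpr hne))
    simpa using this
  have h2 := Matrix.rank_mul_le_left A B
  have h3 := Matrix.rank_le_card_width A
  omega

lemma ddh_sum (a b : ℕ) (hab : a ≤ b) (r : ℕ) (hr : 1 ≤ r) :
    ∑ q ∈ Finset.Icc 2 r, (a - ((b + 1) - a * (q - 1) - 1)) = r * a - b := by
  induction r, hr using Nat.le_induction with
  | base => simp; omega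
  | succ r hr ih =>
    rw [Finset.sum_Icc_succ_top (by omega), ih, Nat.add_sub_cancel, Nat.succ_mul, mul_comm a r]
    omega

/-- dimension bookkeeping -/
lemma ddh_mono (r m n a b a' b' : ℕ) (ham : a ≤ m) (hbn : b ≤ n) (ha : a' ≤ a) (hb : b' ≤ b)
    (h1 : a' ≤ r * b') (h2 : b' ≤ r * a') :
    (m - a') * a' + b' * (n - b') + r * a' * b' ≤ (m - a) * a + b * (n - b) + r * a * b := by
  obtain ⟨x, rfl⟩ := Nat.exists_eq_add_of_le ha
  obtain ⟨y, rfl⟩ := Nat.exists_eq_add_of_le hb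
  obtain ⟨u, rfl⟩ := Nat.exists_eq_add_of_le ham
  obtain ⟨v, rfl⟩ := Nat.exists_eq_add_of_le hbn
  have e1 : a' + x + u - a' = x + u := by omega
  have e2 : b' + y + v - b' = y + v := by omega
  have e3 : a' + x + u - (a' + x) = u := by omega
  have e4 : b' + y + v - (b' + y) = v := by omega
  rw [e1, e2, e3, e4]
  nlinarith [Nat.mul_le_mul_left x h1, Nat.mul_le_mul_left y h2, Nat.zero_le (r*x*y), Nat.zero_le (u*x),
    Nat.zero_le (v*y)]

lemma ddh_codim (r m n a b : ℕ) (hr : 1 ≤ r) (ham : a ≤ m) (hbn : b ≤ n) (hab : a ≤ b) :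
    (m - a) * (n - a) + (r - 1) * n * (m - a) + (n - b) * (r * a - b) +
      ((m - a) * a + (min b (r * a)) * (n - (min b (r * a))) + r * a * (min b (r * a))) =
      r * m * n := by
  obtain ⟨r, rfl⟩ := Nat.exists_eq_add_of_le' hr
  obtain ⟨u, rfl⟩ := Nat.exists_eq_add_of_le ham
  rw [Nat.add_sub_cancel, Nat.add_sub_cancel_left]
  rcases le_total b ((r + 1) * a) with h | h
  · rw [min_eq_left h]
    zify [h, hbn, hab.trans hbn]
    ring
  · rw [min_eq_right h, Nat.sub_eq_zero_of_le h]
    zify [h.trans hbn, hab.trans hbn]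
    ring

lemma ddh_rank_le {L : Type*} [Field L] {α β γ : Type*} [Fintype α] [Fintype β] [Fintype γ]
    (M : Matrix α β L) (A : Matrix α γ L) (B : Matrix γ β L) (h : ∀ i j, M i j = ∑ c, A i c * B c j) :
    M.rank ≤ Fintype.card γ := by
  have : M = A * B := by
    ext i j; rw [h, Matrix.mul_apply]
  rw [this]
  exact (Matrix.rank_mul_le_left A B).trans (Matrix.rank_le_card_width A)

lemma ddh_lower (K : Type*) {L : Type*} [Field K] [Field L] [Algebra K L] (r m n a b : ℕ)
    (ham : a ≤ m) (hbn : b ≤ n) 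
    (x : Fin r → Fin m → Fin n → L)
    (hH : ∀ (rs : Fin (a + 1) → Fin m) (cs : Fin (a + 1) → Fin (r * n)), StrictMono rs →
      StrictMono cs → (Matrix.of fun i k => x (cs k).divNat (rs i) (cs k).modNat).det = 0)
    (hV : ∀ (rs : Fin (b + 1) → Fin (r * m)) (cs : Fin (b + 1) → Fin n), StrictMono rs →
      StrictMono cs → (Matrix.of fun k j => x (rs k).divNat (rs k).modNat (cs j)).det = 0) :
    ∃ (σ : Type) (_ : Fintype σ) (f : σ → L),
      Fintype.card σ ≤ (m - a) * a + (min b (r * a)) * (n - (min b (r * a))) +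
        r * a * (min b (r * a)) ∧
      ∀ q i j, x q i j ∈ Algebra.adjoin K (Set.range f) := by
  classical
  let H : Matrix (Fin m) (Fin (r * n)) L := Matrix.of fun i k => x k.divNat i k.modNat
  let V : Matrix (Fin n) (Fin (r * m)) L := Matrix.of fun j k => x k.divNat k.modNat j
  have hHa : H.rank ≤ a := by
    by_contra hlt
    obtain ⟨rs, cs, h1, h2, h3⟩ := ddh_exists_minor H (a + 1) (by omega)
    exact h3 (hH rs cs h1 h2)
  have hVb : V.rank ≤ b := by
    by_contra hlt
    obtain ⟨rs, cs, h1, h2, h3⟩ := ddh_exists_minor V (b + 1) (by omega)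
    rw [← Matrix.det_transpose] at h3
    exact h3 (hV cs rs h2 h1)
  obtain ⟨rs, P, hrs, hP1, hP2⟩ := ddh_decomp H
  obtain ⟨cs, Q, hcs, hQ1, hQ2⟩ := ddh_decomp V
  have hxP : ∀ q i j, x q i j = ∑ k, P i k * x q (rs k) j := by
    intro q i j
    have := hP2 i (finProdFinEquiv (q, j))
    have e : (finProdFinEquiv (q, j)).divNat = q ∧ (finProdFinEquiv (q, j)).modNat = j := by
      have := finProdFinEquiv.symm_apply_apply (q, j)
      exact Prod.mk.inj this
    simpa [H, e.1, e.2] using this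
  have hxQ : ∀ q i j, x q i j = ∑ l, Q j l * x q i (cs l) := by
    intro q i j
    have := hQ2 j (finProdFinEquiv (q, i))
    have e : (finProdFinEquiv (q, i)).divNat = q ∧ (finProdFinEquiv (q, i)).modNat = i := by
      have := finProdFinEquiv.symm_apply_apply (q, i)
      exact Prod.mk.inj this
    simpa [V, e.1, e.2] using this
  have h1 : H.rank ≤ r * V.rank := by
    have := ddh_rank_le H (γ := Fin r × Fin V.rank) (fun i c => x c.1 i (cs c.2))
      (fun c k => if c.1 = k.divNat then Q k.modNat c.2 else 0) (by
        intro i k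
        simp only [Fintype.sum_prod_type, mul_ite, mul_zero]
        rw [Finset.sum_comm]
        simp only [Finset.sum_ite_eq', Finset.sum_ite_eq, Finset.mem_univ, if_true]
        simp only [H, Matrix.of_apply]
        rw [hxQ]
        exact Finset.sum_congr rfl fun _ _ => mul_comm _ _)
    simpa using this
  have h2 : V.rank ≤ r * H.rank := by
    have := ddh_rank_le V (γ := Fin r × Fin H.rank) (fun j c => x c.1 (rs c.2) j)
      (fun c k => if c.1 = k.divNat then P k.modNat c.2 else 0) (by
        intro i k
        simp only [Fintype.sum_prod_type, mul_ite, mul_zero]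
        rw [Finset.sum_comm]
        simp only [Finset.sum_ite_eq', Finset.sum_ite_eq, Finset.mem_univ, if_true]
        simp only [V, Matrix.of_apply]
        rw [hxP]
        exact Finset.sum_congr rfl fun _ _ => mul_comm _ _)
    simpa using this
  have hb' : V.rank ≤ min b (r * a) :=
    le_min hVb (h2.trans (Nat.mul_le_mul_left r hHa))
  have key := ddh_mono r m n a (min b (r * a)) H.rank V.rank ham ((min_le_left _ _).trans hbn) hHa hb' h1 h2
  let f : (Fin r × Fin H.rank × Fin V.rank) ⊕
      ({i : Fin m // i ∉ Set.range rs} × Fin H.rank) ⊕ (Fin V.rank × {j : Fin n // j ∉ Set.range cs}) → L :=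
    Sum.elim (fun z => x z.1 (rs z.2.1) (cs z.2.2)) (Sum.elim (fun z => P z.1 z.2) (fun z => Q z.2 z.1))
  refine ⟨_, inferInstance, f, ?_, ?_⟩
  · refine le_trans (le_of_eq ?_) key
    have c1 : Fintype.card {i : Fin m // i ∉ Set.range rs} = m - H.rank := by
      have := Fintype.card_subtype_compl (fun i => i ∈ Set.range rs)
      rw [this, Fintype.card_fin, Set.card_range_of_injective hrs.injective, Fintype.card_fin]
    have c2 : Fintype.card {i : Fin n // i ∉ Set.range cs} = n - V.rank := by
      have := Fintype.card_subtype_compl (fun i => i ∈ Set.range cs)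
      rw [this, Fintype.card_fin, Set.card_range_of_injective hcs.injective, Fintype.card_fin]
    simp only [Fintype.card_sum, Fintype.card_prod, c1, c2, Fintype.card_fin]
    ring
  · have hPm : ∀ i k, P i k ∈ Algebra.adjoin K (Set.range f) := by
      intro i k
      by_cases hi : i ∈ Set.range rs
      · obtain ⟨i', rfl⟩ := hi
        rw [hP1, Pi.single_apply]
        split_ifs
        · exact one_mem _
        · exact zero_mem _
      · exact Algebra.subset_adjoin ⟨Sum.inr (Sum.inl (⟨i, hi⟩, k)), rfl⟩
    have hQm : ∀ i k, Q i k ∈ Algebra.adjoin K (Set.range f) := by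
      intro i k
      by_cases hi : i ∈ Set.range cs
      · obtain ⟨i', rfl⟩ := hi
        rw [hQ1, Pi.single_apply]
        split_ifs
        · exact one_mem _
        · exact zero_mem _
      · exact Algebra.subset_adjoin ⟨Sum.inr (Sum.inr (k, ⟨i, hi⟩)), rfl⟩
    intro q i j
    rw [hxP]
    refine sum_mem fun k _ => mul_mem (hPm i k) ?_
    rw [hxQ]
    refine sum_mem fun l _ => mul_mem (hQm j l) ?_
    exact Algebra.subset_adjoin ⟨Sum.inl (q, k, l), rfl⟩
end Part2
section Part3

lemma ddh_mem_of_vecMul {L : Type*} [Field L] (E : Subfield L) {c : ℕ}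
    (M : Matrix (Fin c) (Fin c) L) (hM : ∀ i j, M i j ∈ E) (hdet : M.det ≠ 0) (v : Fin c → L)
    (hv : ∀ j, ∑ k, v k * M k j ∈ E) : ∀ k, v k ∈ E := by
  let M' : Matrix (Fin c) (Fin c) E := fun i j => ⟨M i j, hM i j⟩
  have hMM : M'.map E.subtype = M := by ext i j; rfl
  have hdet' : IsUnit M'.det := by
    rw [isUnit_iff_ne_zero]
    intro h0
    apply hdet
    rw [← hMM, ← RingHom.mapMatrix_apply, ← RingHom.map_det, h0, map_zero]
  have hinv : M * (M'⁻¹.map E.subtype) = 1 := by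
    conv_lhs => rw [← hMM]
    rw [← Matrix.map_mul, Matrix.mul_nonsing_inv _ hdet']
    ext i j
    simp [Matrix.one_apply, apply_ite]
  intro k
  have h1 : v = Matrix.vecMul (Matrix.vecMul v M) (M'⁻¹.map E.subtype) := by
    rw [Matrix.vecMul_vecMul, hinv, Matrix.vecMul_one]
  rw [h1]
  simp only [Matrix.vecMul, dotProduct]
  refine sum_mem fun j _ => mul_mem (hv j) ?_
  exact (M'⁻¹ j k).2

lemma ddh_det_ne_zero {K σ τ : Type*} [Field K] {c : ℕ} (g : Fin c → τ → σ)
    (hg : Function.Injective (fun z : Fin c × τ => g z.1 z.2))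
    (e : Fin c ↪ τ) :
    (Matrix.of fun i j => algebraMap (MvPolynomial σ K) (FractionRing (MvPolynomial σ K))
      (MvPolynomial.X (g i (e j)))).det ≠ 0 := by
  classical
  let M : Matrix (Fin c) (Fin c) (MvPolynomial σ K) := Matrix.of fun i j => MvPolynomial.X (g i (e j))
  have hM : M.det ≠ 0 := by
    intro h0
    let ev : MvPolynomial σ K →+* K :=
      (MvPolynomial.aeval (R := K) (fun z => if ∃ i, z = g i (e i) then (1 : K) else 0)).toRingHom
    have h1 : (ev.mapMatrix M) = 1 := by
      ext i j
      simp only [RingHom.mapMatrix_apply, Matrix.map_apply, M, Matrix.of_apply, ev]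
      rw [Matrix.one_apply]
      simp only [AlgHom.toRingHom_eq_coe, RingHom.coe_coe, MvPolynomial.aeval_X]
      refine if_congr ?_ rfl rfl
      constructor
      · rintro ⟨k, hk⟩
        have := hg (a₁ := (i, e j)) (a₂ := (k, e k)) hk
        have h2 := Prod.mk.inj this
        rw [h2.1]; exact (e.injective h2.2).symm
      · rintro rfl; exact ⟨i, rfl⟩
    have h2 := RingHom.map_det ev M
    rw [h1, h0, Matrix.det_one, map_zero] at h2
    exact zero_ne_one h2
  have h3 := RingHom.map_det (algebraMap (MvPolynomial σ K) (FractionRing (MvPolynomial σ K))) M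
  intro h4
  apply hM
  apply IsFractionRing.injective (MvPolynomial σ K) (FractionRing (MvPolynomial σ K))
  rw [h3, map_zero]
  exact h4

lemma ddh_swap {L : Type*} [Field L] {a b : ℕ} (P : Fin a → L) (Z : Fin a → Fin b → L) (Q : Fin b → L) :
    ∑ k, P k * ∑ l, Z k l * Q l = ∑ l, (∑ k, P k * Z k l) * Q l := by
  simp only [Finset.mul_sum, Finset.sum_mul]
  rw [Finset.sum_comm]
  simp only [mul_assoc]

lemma ddh_gen {L : Type*} [Field L] (E : Subfield L) {r m n a b c d : ℕ}
    (e₁ : Fin m ≃ Fin a ⊕ Fin c) (e₂ : Fin n ≃ Fin b ⊕ Fin d)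
    (Z : Fin r → Fin a → Fin b → L) (A : Fin c → Fin a → L) (B : Fin b → Fin d → L)
    (P : Fin m → Fin a → L) (Q : Fin b → Fin n → L)
    (hP : ∀ i k, P i k = Sum.elim (fun i' => if i' = k then 1 else 0) (fun u => A u k) (e₁ i))
    (hQ : ∀ l j, Q l j = Sum.elim (fun j' => if l = j' then 1 else 0) (fun v => B l v) (e₂ j))
    (hx : ∀ q i j, ∑ k, P i k * ∑ l, Z q k l * Q l j ∈ E)
    (ι : Fin a → Fin r × Fin b) (ι' : Fin b → Fin r × Fin a)
    (hι : (Matrix.of fun k k' => Z (ι k').1 k (ι k').2).det ≠ 0)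
    (hι' : (Matrix.of fun l l' => Z (ι' l').1 (ι' l').2 l).det ≠ 0) :
    (∀ q k l, Z q k l ∈ E) ∧ (∀ u k, A u k ∈ E) ∧ (∀ l v, B l v ∈ E) := by
  classical
  have hP1 : ∀ k k', P (e₁.symm (Sum.inl k)) k' = if k = k' then 1 else 0 := by
    intro k k'; simp [hP]
  have hP2 : ∀ u k', P (e₁.symm (Sum.inr u)) k' = A u k' := by
    intro k k'; simp [hP]
  have hQ1 : ∀ k k', Q k (e₂.symm (Sum.inl k')) = if k = k' then 1 else 0 := by
    intro k k'; simp [hQ]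
  have hQ2 : ∀ l v, Q l (e₂.symm (Sum.inr v)) = B l v := by
    intro k k'; simp [hQ]
  have hZ : ∀ q k l, Z q k l ∈ E := by
    intro q k l
    have := hx q (e₁.symm (Sum.inl k)) (e₂.symm (Sum.inl l))
    simpa [hP1, hQ1] using this
  refine ⟨hZ, ?_, ?_⟩
  · intro u
    refine ddh_mem_of_vecMul E _ (fun _ _ => hZ _ _ _) hι _ ?_
    intro j
    have := hx (ι j).1 (e₁.symm (Sum.inr u)) (e₂.symm (Sum.inl (ι j).2))
    simpa [hP2, hQ1] using this
  · intro l v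
    refine ddh_mem_of_vecMul E _ (fun _ _ => hZ _ _ _) hι' (fun l => B l v) ?_ l
    intro j
    have := hx (ι' j).1 (e₁.symm (Sum.inl (ι' j).2)) (e₂.symm (Sum.inr v))
    simp only [hP1, hQ2, ite_mul, one_mul, zero_mul,
          Finset.sum_ite_eq, Finset.mem_univ, if_true] at this
    convert this using 2
    exact mul_comm _ _

lemma ddh_gen_top {K σ : Type*} [Field K] (E : Subfield (FractionRing (MvPolynomial σ K)))
    (hK : ∀ c : K, algebraMap K _ c ∈ E)
    (hy : ∀ z, algebraMap (MvPolynomial σ K) (FractionRing (MvPolynomial σ K)) (MvPolynomial.X z) ∈ E) :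
    E = ⊤ := by
  have hpoly : ∀ f : MvPolynomial σ K, algebraMap _ (FractionRing (MvPolynomial σ K)) f ∈ E := by
    intro f
    induction f using MvPolynomial.induction_on with
    | C c => exact hK c
    | add f g hf hg => rw [map_add]; exact add_mem hf hg
    | mul_X f z hf => rw [map_mul]; exact mul_mem hf (hy z)
  rw [eq_top_iff]
  intro w _
  obtain ⟨f, g, _, rfl⟩ := IsFractionRing.div_surjective (A := MvPolynomial σ K) w
  exact div_mem (hpoly f) (hpoly g)

lemma ddh_upper_core {K σ : Type*} [Field K] {r m n a b c d : ℕ}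
    (s1 : Fin r → Fin a → Fin b → σ) (s2 : Fin c → Fin a → σ) (s3 : Fin b → Fin d → σ)
    (hs1 : ∀ q k l q' k' l', s1 q k l = s1 q' k' l' → q = q' ∧ k = k' ∧ l = l')
    (hs : ∀ z, (∃ q k l, z = s1 q k l) ∨ (∃ u k, z = s2 u k) ∨ ∃ l v, z = s3 l v)
    (e₁ : Fin m ≃ Fin a ⊕ Fin c) (e₂ : Fin n ≃ Fin b ⊕ Fin d)
    (hab : a ≤ r * b) (hba : b ≤ r * a) :
    ∃ (x : Fin r → Fin m → Fin n → FractionRing (MvPolynomial σ K)),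
      (∃ (P : Fin m → Fin a → FractionRing (MvPolynomial σ K))
        (Y : Fin r → Fin a → Fin n → FractionRing (MvPolynomial σ K)),
          ∀ q i j, x q i j = ∑ k : Fin a, P i k * Y q k j) ∧
      (∃ (W : Fin r → Fin m → Fin b → FractionRing (MvPolynomial σ K))
        (Q : Fin b → Fin n → FractionRing (MvPolynomial σ K)),
          ∀ q i j, x q i j = ∑ l : Fin b, W q i l * Q l j) ∧
      ∀ E : Subfield (FractionRing (MvPolynomial σ K)),
        (∀ c : K, algebraMap K _ c ∈ E) → (∀ q i j, x q i j ∈ E) → E = ⊤ := by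
  classical
  obtain ⟨ι⟩ : Nonempty (Fin a ↪ Fin r × Fin b) := by
    apply Function.Embedding.nonempty_of_card_le; simpa using hab
  obtain ⟨ι'⟩ : Nonempty (Fin b ↪ Fin r × Fin a) := by
    apply Function.Embedding.nonempty_of_card_le; simpa using hba
  let y : σ → FractionRing (MvPolynomial σ K) := fun z =>
    algebraMap (MvPolynomial σ K) (FractionRing (MvPolynomial σ K)) (MvPolynomial.X z)
  let P : Fin m → Fin a → FractionRing (MvPolynomial σ K) := fun i k =>
    Sum.elim (fun i' => if i' = k then 1 else 0) (fun u => y (s2 u k)) (e₁ i)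
  let Q : Fin b → Fin n → FractionRing (MvPolynomial σ K) := fun l j =>
    Sum.elim (fun j' => if l = j' then 1 else 0) (fun v => y (s3 l v)) (e₂ j)
  let Z : Fin r → Fin a → Fin b → FractionRing (MvPolynomial σ K) := fun q k l => y (s1 q k l)
  have hd1 : (Matrix.of fun k k' => Z (ι k').1 k (ι k').2).det ≠ 0 :=
    ddh_det_ne_zero (K := K) (fun k (w : Fin r × Fin b) => s1 w.1 k w.2) (by
      rintro ⟨k, w1, w2⟩ ⟨k', w1', w2'⟩ h
      obtain ⟨h1, h2, h3⟩ := hs1 _ _ _ _ _ _ h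
      simp only [Prod.mk.injEq]; exact ⟨h2, h1, h3⟩) ι
  have hd2 : (Matrix.of fun l l' => Z (ι' l').1 (ι' l').2 l).det ≠ 0 :=
    ddh_det_ne_zero (K := K) (fun l (w : Fin r × Fin a) => s1 w.1 w.2 l) (by
      rintro ⟨k, w1, w2⟩ ⟨k', w1', w2'⟩ h
      obtain ⟨h1, h2, h3⟩ := hs1 _ _ _ _ _ _ h
      simp only [Prod.mk.injEq]; exact ⟨h3, h1, h2⟩) ι'
  refine ⟨fun q i j => ∑ k, P i k * ∑ l, Z q k l * Q l j,
    ⟨P, fun q k j => ∑ l, Z q k l * Q l j, fun _ _ _ => rfl⟩,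
    ⟨fun q i l => ∑ k, P i k * Z q k l, Q, fun q i j => ddh_swap _ _ _⟩, ?_⟩
  intro E hK hx
  obtain ⟨h1, h2, h3⟩ := ddh_gen E e₁ e₂ Z (fun u k => y (s2 u k))
    (fun l v => y (s3 l v)) P Q (fun _ _ => rfl) (fun _ _ => rfl) hx ι ι' hd1 hd2
  refine ddh_gen_top E hK ?_
  intro z
  rcases hs z with ⟨q, k, l, rfl⟩ | ⟨u, k, rfl⟩ | ⟨l, v, rfl⟩
  · exact h1 q k l
  · exact h2 u k
  · exact h3 l v

lemma ddh_upper {K : Type*} [Field K] (r m n a b : ℕ)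
    (ham : a ≤ m) (hbn : b ≤ n) (hab : a ≤ r * b) (hba : b ≤ r * a) :
    ∃ (σ : Type) (_ : Fintype σ)
      (x : Fin r → Fin m → Fin n → FractionRing (MvPolynomial σ K)),
      Fintype.card σ = (m - a) * a + b * (n - b) + r * a * b ∧
      (∃ (P : Fin m → Fin a → FractionRing (MvPolynomial σ K))
        (Y : Fin r → Fin a → Fin n → FractionRing (MvPolynomial σ K)), ∀ q i j, x q i j = ∑ k : Fin a, P i k * Y q k j) ∧
      (∃ (W : Fin r → Fin m → Fin b → FractionRing (MvPolynomial σ K))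
        (Q : Fin b → Fin n → FractionRing (MvPolynomial σ K)), ∀ q i j, x q i j = ∑ l : Fin b, W q i l * Q l j) ∧
      ∀ E : Subfield (FractionRing (MvPolynomial σ K)),
        (∀ c : K, algebraMap K _ c ∈ E) → (∀ q i j, x q i j ∈ E) → E = ⊤ := by
  refine ⟨(Fin r × Fin a × Fin b) ⊕ (Fin (m - a) × Fin a) ⊕ (Fin b × Fin (n - b)), inferInstance, ?_⟩
  obtain ⟨x, hx⟩ := ddh_upper_core (K := K)
    (σ := (Fin r × Fin a × Fin b) ⊕ (Fin (m - a) × Fin a) ⊕ (Fin b × Fin (n - b)))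
    (fun q k l => Sum.inl (q, k, l)) (fun u k => Sum.inr (Sum.inl (u, k)))
    (fun l v => Sum.inr (Sum.inr (l, v)))
    (by intro q k l q' k' l' h; simpa using h)
    (by
      rintro (⟨q, k, l⟩ | ⟨u, k⟩ | ⟨l, v⟩)
      · exact Or.inl ⟨q, k, l, rfl⟩
      · exact Or.inr (Or.inl ⟨u, k, rfl⟩)
      · exact Or.inr (Or.inr ⟨l, v, rfl⟩))
    ((finCongr (by omega)).trans finSumFinEquiv.symm : Fin m ≃ Fin a ⊕ Fin (m - a))
    ((finCongr (by omega)).trans finSumFinEquiv.symm : Fin n ≃ Fin b ⊕ Fin (n - b)) hab hba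
  refine ⟨x, ?_, hx⟩
  simp only [Fintype.card_sum, Fintype.card_prod, Fintype.card_fin]
  ring
end Part3
section Part4

lemma ddh_trdeg_le {K : Type*} [Field K] {ι σ : Type} [Fintype σ]
    (P : Ideal (MvPolynomial ι K)) [P.IsPrime]
    (f : σ → FractionRing (MvPolynomial ι K ⧸ P))
    (h : ∀ v, algebraMap (MvPolynomial ι K ⧸ P) (FractionRing (MvPolynomial ι K ⧸ P))
      (Ideal.Quotient.mk P (MvPolynomial.X v)) ∈ Algebra.adjoin K (Set.range f)) :
    Algebra.trdeg K (MvPolynomial ι K ⧸ P) ≤ (Fintype.card σ : Cardinal) := by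
  let g : (MvPolynomial ι K ⧸ P) →ₐ[K] FractionRing (MvPolynomial ι K ⧸ P) :=
    IsScalarTower.toAlgHom K _ _
  have hmem : ∀ y, g y ∈ (MvPolynomial.aeval (R := K) f).range := by
    intro y
    obtain ⟨p, rfl⟩ := Ideal.Quotient.mk_surjective y
    rw [← Algebra.adjoin_range_eq_range_aeval]
    induction p using MvPolynomial.induction_on with
    | C c =>
      have : g (Ideal.Quotient.mk P (MvPolynomial.C c)) = algebraMap K _ c := g.commutes c
      rw [this]; exact Subalgebra.algebraMap_mem _ _
    | add p q hp hq => rw [map_add, map_add]; exact add_mem hp hq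
    | mul_X p v hp => rw [map_mul, map_mul]; exact mul_mem hp (h v)
  have h1 := trdeg_le_of_injective (g.codRestrict _ hmem) (by
    intro y z hyz
    exact IsFractionRing.injective (MvPolynomial ι K ⧸ P) (FractionRing (MvPolynomial ι K ⧸ P))
      (congrArg Subtype.val hyz))
  have h2 := trdeg_le_of_surjective (MvPolynomial.aeval (R := K) f).rangeRestrict
    (AlgHom.rangeRestrict_surjective _)
  rw [MvPolynomial.trdeg_of_isDomain] at h2
  simpa using h1.trans h2

lemma ddh_trdeg_ge {K : Type*} [Field K] {ι σ : Type} [Fintype σ]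
    (x : ι → FractionRing (MvPolynomial σ K))
    (hE : ∀ E : Subfield (FractionRing (MvPolynomial σ K)),
        (∀ c : K, algebraMap K _ c ∈ E) → (∀ v, x v ∈ E) → E = ⊤) :
    (Fintype.card σ : Cardinal) ≤
      Algebra.trdeg K (MvPolynomial ι K ⧸ RingHom.ker (MvPolynomial.aeval (R := K) x)) := by
  let φ := MvPolynomial.aeval (R := K) x
  let S := φ.range
  have h1 : Algebra.trdeg K (MvPolynomial ι K ⧸ RingHom.ker φ) = Algebra.trdeg K S :=
    (Ideal.quotientKerEquivRange φ).trdeg_eq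
  have halg : ∀ y : FractionRing (MvPolynomial σ K), IsAlgebraic S y := by
    let E : Subfield (FractionRing (MvPolynomial σ K)) :=
      { (Subalgebra.algebraicClosure S (FractionRing (MvPolynomial σ K))).toSubring with
        inv_mem' := fun y hy => IsAlgebraic.inv hy }
    have := hE E (fun c => isAlgebraic_algebraMap (R := S) (algebraMap K S c))
      (fun v => isAlgebraic_algebraMap (R := S) (⟨x v, MvPolynomial.X v, MvPolynomial.aeval_X _ _⟩ : S))
    intro y
    have hy : y ∈ E := this ▸ Subfield.mem_top y
    exact hy
  have : Algebra.IsAlgebraic S (FractionRing (MvPolynomial σ K)) := ⟨halg⟩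
  have h2 := trdeg_add_eq K S (A := FractionRing (MvPolynomial σ K))
  rw [trdeg_eq_zero (R := S), add_zero] at h2
  have h3 := trdeg_le_of_injective
    (IsScalarTower.toAlgHom K (MvPolynomial σ K) (FractionRing (MvPolynomial σ K)))
    (IsFractionRing.injective (MvPolynomial σ K) (FractionRing (MvPolynomial σ K)))
  rw [MvPolynomial.trdeg_of_isDomain] at h3
  change _ ≤ Algebra.trdeg K (MvPolynomial ι K ⧸ RingHom.ker φ)
  rw [h1, h2]
  simpa using h3

end Part4

lemma ddh_height_ge (K : Type*) [Field K] (r m n a b : ℕ) (hm : 0 < m) (hn : 0 < n)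
    (ham : a ≤ m) (hbn : b ≤ n) (P : Ideal (MvPolynomial (Fin r × Fin m × Fin n) K)) [P.IsPrime]
    (hJ : doubleDetIdeal K r m n (a + 1) (b + 1) hm hn ≤ P) (c : ℕ)
    (hc : c + ((m - a) * a + (min b (r * a)) * (n - (min b (r * a))) + r * a * (min b (r * a)))
      = r * m * n) : (c : ℕ∞) ≤ P.height := by
  let Φ : MvPolynomial (Fin r × Fin m × Fin n) K →+*
      FractionRing (MvPolynomial (Fin r × Fin m × Fin n) K ⧸ P) :=
    (algebraMap (MvPolynomial (Fin r × Fin m × Fin n) K ⧸ P)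
      (FractionRing (MvPolynomial (Fin r × Fin m × Fin n) K ⧸ P))).comp (Ideal.Quotient.mk P)
  have hΦ : ∀ p ∈ P, Φ p = 0 := by
    intro p hp
    have : Ideal.Quotient.mk P p = 0 := Ideal.Quotient.eq_zero_iff_mem.mpr hp
    simp only [Φ, RingHom.comp_apply, this, map_zero]
  obtain ⟨σ, hσ, f, hcard, hf⟩ := ddh_lower K r m n a b ham hbn
    (fun q i j => Φ (MvPolynomial.X (q, i, j)))
    (by
      intro rs cs hrs hcs
      have h1 : ((Hmat K r m n hn).submatrix rs cs).det ∈ P :=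
        hJ (Ideal.subset_span (Or.inl ⟨rs, cs, hrs, hcs, rfl⟩))
      have h2 := hΦ _ h1
      rw [RingHom.map_det] at h2
      exact h2)
    (by
      intro rs cs hrs hcs
      have h1 : ((Vmat K r m n hm).submatrix rs cs).det ∈ P :=
        hJ (Ideal.subset_span (Or.inr ⟨rs, cs, hrs, hcs, rfl⟩))
      have h2 := hΦ _ h1
      rw [RingHom.map_det] at h2
      exact h2)
  obtain ⟨d, hd, hht⟩ := ddh_main P
  have h3 := ddh_trdeg_le P f (fun v => hf v.1 v.2.1 v.2.2)
  rw [hd] at h3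
  have h4 : d ≤ Fintype.card σ := by exact_mod_cast h3
  simp only [Fintype.card_prod, Fintype.card_fin] at hht
  have hfin : P.height ≠ ⊤ := by
    intro h; rw [h, top_add] at hht; exact ENat.coe_ne_top _ hht.symm
  obtain ⟨h, hh⟩ := ENat.ne_top_iff_exists.mp hfin
  rw [← hh] at hht ⊢
  have h5 : h + d = r * (m * n) := by exact_mod_cast hht
  rw [← mul_assoc] at h5
  have : c ≤ h := by omega
  exact_mod_cast this

lemma ddh_exists_prime (K : Type*) [Field K] (r m n a b : ℕ) (hr : 1 ≤ r) (hm : 0 < m) (hn : 0 < n)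
    (ham : a ≤ m) (hbn : b ≤ n) (hab : a ≤ b) (c : ℕ)
    (hc : c + ((m - a) * a + (min b (r * a)) * (n - (min b (r * a))) + r * a * (min b (r * a)))
      = r * m * n) : ∃ P : Ideal (MvPolynomial (Fin r × Fin m × Fin n) K), ∃ _ : P.IsPrime,
        doubleDetIdeal K r m n (a + 1) (b + 1) hm hn ≤ P ∧ P.height ≤ c := by
  have hra : a ≤ r * a := Nat.le_mul_of_pos_left a hr
  have hmin : a ≤ min b (r * a) := le_min hab hra
  obtain ⟨σ, hσ, x, hcard, ⟨P1, Y, hPY⟩, ⟨W, Q, hWQ⟩, hE⟩ :=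
    ddh_upper (K := K) r m n a (min b (r * a)) ham ((min_le_left _ _).trans hbn)
      (hmin.trans (Nat.le_mul_of_pos_left _ hr)) (min_le_right _ _)
  let x' : Fin r × Fin m × Fin n → FractionRing (MvPolynomial σ K) := fun v => x v.1 v.2.1 v.2.2
  have hPp : (RingHom.ker (MvPolynomial.aeval (R := K) x')).IsPrime := RingHom.ker_isPrime _
  refine ⟨RingHom.ker (MvPolynomial.aeval (R := K) x'), hPp, ?_, ?_⟩
  · refine Ideal.span_le.mpr ?_
    rintro _ (⟨rs, cs, -, -, rfl⟩ | ⟨rs, cs, -, -, rfl⟩)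
    · rw [SetLike.mem_coe, RingHom.mem_ker, AlgHom.map_det]
      have : (MvPolynomial.aeval (R := K) x').mapMatrix ((Hmat K r m n hn).submatrix rs cs) =
          (Matrix.of fun i k => P1 (rs i) k : Matrix (Fin (a + 1)) (Fin a) _) *
          (Matrix.of fun k j => Y (cs j).divNat k (cs j).modNat) := by
        ext i j
        simp only [AlgHom.mapMatrix_apply, Matrix.map_apply, Matrix.submatrix_apply, Hmat,
          Matrix.of_apply, MvPolynomial.aeval_X, Matrix.mul_apply]
        exact hPY _ _ _
      rw [this]
      exact ddh_det_zero (by simp) _ _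
    · rw [SetLike.mem_coe, RingHom.mem_ker, AlgHom.map_det]
      have : (MvPolynomial.aeval (R := K) x').mapMatrix ((Vmat K r m n hm).submatrix rs cs) =
          (Matrix.of fun k l => W (rs k).divNat (rs k).modNat l :
            Matrix (Fin (b + 1)) (Fin (min b (r * a))) _) *
          (Matrix.of fun l j => Q l (cs j)) := by
        ext i j
        simp only [AlgHom.mapMatrix_apply, Matrix.map_apply, Matrix.submatrix_apply, Vmat,
          Matrix.of_apply, MvPolynomial.aeval_X, Matrix.mul_apply]
        exact hWQ _ _ _
      rw [this]
      exact ddh_det_zero (by simp only [Fintype.card_fin]; omega) _ _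
  · obtain ⟨d, hd, hht⟩ := ddh_main (RingHom.ker (MvPolynomial.aeval (R := K) x'))
    have h3 := ddh_trdeg_ge x' (fun E hK hx => hE E hK (fun q i j => hx (q, i, j)))
    rw [hd] at h3
    have h4 : Fintype.card σ ≤ d := by exact_mod_cast h3
    simp only [Fintype.card_prod, Fintype.card_fin] at hht
    generalize (RingHom.ker (MvPolynomial.aeval (R := K) x')).height = H at hht ⊢
    have hfin : H ≠ ⊤ := by
      intro h; rw [h, top_add] at hht; exact ENat.coe_ne_top _ hht.symm
    obtain ⟨h, rfl⟩ := ENat.ne_top_iff_exists.mp hfin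
    have h5 : h + d = r * (m * n) := by exact_mod_cast hht
    rw [← mul_assoc] at h5
    have : h ≤ c := by omega
    exact_mod_cast this

theorem double_determinantal_height (K : Type*) [Field K] (r m n s t : ℕ)
    (hr : 2 ≤ r) (hm : 0 < m) (hn : 0 < n) (hs : 1 ≤ s) (hsm : s ≤ m)
    (hst : s ≤ t) (htn : t ≤ n) :
    idealHeight (doubleDetIdeal K r m n s t hm hn) =
      (((m - s + 1) * (n - s + 1) + (r - 1) * n * (m - s + 1) +
        (n - t + 1) * ∑ q ∈ Finset.Icc 2 r, ((s - 1) - (t - (s - 1) * (q - 1) - 1)) : ℕ) : ℕ∞) := by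
  obtain ⟨a, rfl⟩ : ∃ a, s = a + 1 := ⟨s - 1, by omega⟩
  obtain ⟨b, rfl⟩ : ∃ b, t = b + 1 := ⟨t - 1, by omega⟩
  have hab : a ≤ b := by omega
  have e1 : m - (a + 1) + 1 = m - a := by omega
  have e2 : n - (a + 1) + 1 = n - a := by omega
  have e3 : n - (b + 1) + 1 = n - b := by omega
  have e4 : a + 1 - 1 = a := by omega
  rw [e1, e2, e3, e4, ddh_sum a b hab r (by omega)]
  have hc := ddh_codim r m n a b (by omega) (by omega) (by omega) hab
  generalize (m - a) * (n - a) + (r - 1) * n * (m - a) + (n - b) * (r * a - b) = c at hc ⊢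
  unfold idealHeight
  apply le_antisymm
  · obtain ⟨P, hP, hJ, hh⟩ := ddh_exists_prime K r m n a b (by omega) hm hn (by omega) (by omega) hab c hc
    refine (iInf_le _ ⟨⟨P, hP⟩, hJ⟩).trans ?_
    rw [← PrimeSpectrum.height_eq_orderHeight]
    exact hh
  · refine le_iInf ?_
    rintro ⟨⟨P, hP⟩, hJ⟩
    rw [← PrimeSpectrum.height_eq_orderHeight]
    exact ddh_height_ge K r m n a b hm hn (by omega) (by omega) P hJ c hc

end
end

section
/- Double determinantal varieties are normal and irreducible: with J the double determinantal ideal in R = K[x^q_{ij}] over a perfect field K, the ring R/J is a normal domain. -/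
/-! Statement 11: over a perfect field, the double determinantal variety is
normal and irreducible: R/J is a normal domain (an integrally closed domain). -/

open MvPolynomial

noncomputable section

namespace DD

/-- H-order on points -/
def gtH {α : Type*} (q i j : α → ℕ) (pH : α → Prop) (y v : α) : Prop :=
  pH y ∧ pH v ∧ i y < i v ∧ (q v < q y ∨ q v = q y ∧ j v < j y)
/-- V-order on points -/
def gtV {α : Type*} (q i j : α → ℕ) (pV : α → Prop) (y v : α) : Prop :=
  pV y ∧ pV v ∧ j v < j y ∧ (q y < q v ∨ q y = q v ∧ i y < i v)

/-- chains ending at v, with k+1 elements -/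
def Ch {α : Type*} (R : α → α → Prop) (P : Finset α) : ℕ → α → Prop
  | 0, v => v ∈ P
  | (k+1), v => v ∈ P ∧ ∃ y, R y v ∧ Ch R P k y

lemma Ch.mem {α : Type*} {R : α → α → Prop} {P : Finset α} {k : ℕ} {v : α}
    (h : Ch R P k v) : v ∈ P := by
  cases k with
  | zero => exact h
  | succ k => exact h.1

lemma Ch.pred {α : Type*} {R : α → α → Prop} {P : Finset α} {k : ℕ} :
    ∀ {v : α}, Ch R P (k+1) v → Ch R P k v := by
  induction k with
  | zero => intro v h; exact h.1
  | succ k ih =>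
    rintro v ⟨hv, y, hy, hc⟩
    exact ⟨hv, y, hy, ih hc⟩

lemma Ch.mono {α : Type*} {R : α → α → Prop} {P : Finset α} {k l : ℕ} {v : α}
    (hkl : k ≤ l) (h : Ch R P l v) : Ch R P k v := by
  induction l, hkl using Nat.le_induction with
  | base => exact h
  | succ l _ ih => exact ih h.pred

lemma exists_height {α : Type*} (R : α → α → Prop) (P : Finset α) (s : ℕ)
    (hs : ∀ v, ¬ Ch R P s v) :
    ∃ a : α → ℕ, (∀ v ∈ P, a v < s) ∧ (∀ y ∈ P, ∀ v ∈ P, R y v → a y < a v) ∧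
      (∀ v ∈ P, ∀ k, a v = k + 1 → ∃ y ∈ P, R y v ∧ a y = k) := by
  classical
  have hlt : ∀ k v, Ch R P k v → k < s := by
    intro k v h
    by_contra hk
    exact hs v (h.mono (by omega))
  set a : α → ℕ := fun v => Nat.findGreatest (fun k => Ch R P k v) s with ha
  have h1 : ∀ v ∈ P, Ch R P (a v) v := by
    intro v hv
    exact Nat.findGreatest_spec (P := fun k => Ch R P k v) (m := 0) (Nat.zero_le _) hv
  have h2 : ∀ k v, Ch R P k v → k ≤ a v := by
    intro k v h
    exact Nat.le_findGreatest (hlt k v h).le h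
  have h3 : ∀ y ∈ P, ∀ v ∈ P, R y v → a y < a v := by
    intro y hy v hv hR
    exact h2 (a y + 1) v ⟨hv, y, hR, h1 y hy⟩
  refine ⟨a, fun v hv => hlt _ _ (h1 v hv), h3, ?_⟩
  intro v hv k hk
  have := h1 v hv
  rw [hk] at this
  obtain ⟨_, y, hR, hc⟩ := this
  have e1 := h2 _ _ hc
  have e2 := h3 y hc.mem v hv hR
  exact ⟨y, hc.mem, hR, by omega⟩

/-- the combinatorial data -/
structure Pts (α : Type*) where
  P : Finset α
  q : α → ℕ
  i : α → ℕ
  j : α → ℕ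
  pH : α → Prop
  pV : α → Prop
  r : ℕ
  m : ℕ
  a : α → ℕ
  b : α → ℕ
  hpX : ∀ v, q v < r → pH v ∧ pV v
  hpq : ∀ v, q v ≤ r
  him : ∀ v, pH v → i v < m
  ha1 : ∀ y ∈ P, ∀ v ∈ P, gtH q i j pH y v → a y < a v
  ha2 : ∀ v ∈ P, ∀ k, a v = k + 1 → ∃ y ∈ P, gtH q i j pH y v ∧ a y = k
  hb1 : ∀ y ∈ P, ∀ v ∈ P, gtV q i j pV y v → b y < b v
  hb2 : ∀ v ∈ P, ∀ k, b v = k + 1 → ∃ y ∈ P, gtV q i j pV y v ∧ b y = k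

namespace Pts
variable {α : Type*} (D : Pts α)

lemma lem1 (N : ℕ) : ∀ v ∈ D.P, ∀ z ∈ D.P, D.a v = N → D.q v < D.r → D.q z = D.q v → D.i v ≤ D.i z →
    D.j v ≤ D.j z → D.a z < D.a v → D.b v ≤ D.b z → False := by
  induction N with
  | zero => intros; omega
  | succ N ih =>
    intro v hv z hz hN hq hqz hi hj haz hbz
    obtain ⟨v1, hv1, hg, hav1⟩ := D.ha2 v hv N hN
    obtain ⟨h1, h2, h3, h4⟩ := hg
    have pv := D.hpX v hq
    have pz := D.hpX z (by omega)
    have hc1 : ¬ gtH D.q D.i D.j D.pH v1 z := fun h => by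
      have := D.ha1 v1 hv1 z hz h
      omega
    have hc1' : ¬ (D.q z < D.q v1 ∨ D.q z = D.q v1 ∧ D.j z < D.j v1) := fun h =>
      hc1 ⟨h1, pz.1, by omega, h⟩
    have hqv1 : D.q v1 = D.q v := by omega
    have pv1 := D.hpX v1 (by omega)
    have hbv1 := D.hb1 v1 hv1 v hv ⟨pv1.2, pv.2, by omega, by omega⟩
    obtain ⟨z1, hz1, hgz, hbz1⟩ := D.hb2 z hz (D.b z - 1) (by omega)
    obtain ⟨g1, g2, g3, g4⟩ := hgz
    have hc2 : ¬ (D.q z1 < D.q v1 ∨ D.q z1 = D.q v1 ∧ D.i z1 < D.i v1) := fun h => by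
      have := D.hb1 z1 hz1 v1 hv1 ⟨g1, pv1.2, by omega, h⟩
      omega
    have hqz1 : D.q z1 = D.q v := by omega
    have pz1 := D.hpX z1 (by omega)
    have haz1 := D.ha1 z1 hz1 z hz ⟨pz1.1, pz.1, by omega, by omega⟩
    exact ih v1 hv1 z1 hz1 hav1 (by omega) (by omega) (by omega) (by omega) (by omega) (by omega)

lemma lem1' {v z : α} (hv : v ∈ D.P) (hz : z ∈ D.P) (hq : D.q v < D.r) (hqz : D.q z = D.q v)
    (hi : D.i v ≤ D.i z) (hj : D.j v ≤ D.j z) (hb : D.b v ≤ D.b z) : D.a v ≤ D.a z := by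
  by_contra h
  exact D.lem1 _ v hv z hz rfl hq hqz hi hj (by omega) hb

lemma lem2 {v z : α} (hv : v ∈ D.P) (hz : z ∈ D.P) (hq : D.q v < D.r) (hqz : D.q z = D.q v)
    (hi : D.i v ≤ D.i z) (hj : D.j v ≤ D.j z) (ha : D.a z ≤ D.a v) : D.b z ≤ D.b v := by
  by_contra h
  have pv := D.hpX v hq
  have pz := D.hpX z (by omega)
  obtain ⟨z1, hz1, hgz, hbz1⟩ := D.hb2 z hz (D.b z - 1) (by omega)
  obtain ⟨g1, g2, g3, g4⟩ := hgz
  have hc2 : ¬ (D.q z1 < D.q v ∨ D.q z1 = D.q v ∧ D.i z1 < D.i v) := fun h => by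
    have := D.hb1 z1 hz1 v hv ⟨g1, pv.2, by omega, h⟩
    omega
  have hqz1 : D.q z1 = D.q v := by omega
  have pz1 := D.hpX z1 (by omega)
  have haz1 := D.ha1 z1 hz1 z hz ⟨pz1.1, pz.1, by omega, by omega⟩
  exact D.lem1 _ v hv z1 hz1 rfl hq hqz1 (by omega) (by omega) (by omega) (by omega)

lemma climbH (k : ℕ) {v : α} (hv : v ∈ D.P) (h : k ≤ D.a v) :
    ∃ y ∈ D.P, D.a y = k ∧ (y = v ∨ gtH D.q D.i D.j D.pH y v) := by
  obtain ⟨d, hd⟩ := Nat.exists_eq_add_of_le h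
  clear h
  induction d generalizing k v with
  | zero => exact ⟨v, hv, by omega, Or.inl rfl⟩
  | succ d ih =>
    obtain ⟨y, hy, ⟨h1, h2, h3, h4⟩, hay⟩ := D.ha2 v hv (k + d) (by omega)
    obtain ⟨z, hz, haz, hzy⟩ := ih k hy (by omega)
    refine ⟨z, hz, haz, Or.inr ?_⟩
    rcases hzy with rfl | ⟨g1, g2, g3, g4⟩
    · exact ⟨h1, h2, h3, h4⟩
    · exact ⟨g1, h2, by omega, by omega⟩

lemma climbV (k : ℕ) {v : α} (hv : v ∈ D.P) (h : k ≤ D.b v) :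
    ∃ y ∈ D.P, D.b y = k ∧ (y = v ∨ gtV D.q D.i D.j D.pV y v) := by
  obtain ⟨d, hd⟩ := Nat.exists_eq_add_of_le h
  clear h
  induction d generalizing k v with
  | zero => exact ⟨v, hv, by omega, Or.inl rfl⟩
  | succ d ih =>
    obtain ⟨y, hy, ⟨h1, h2, h3, h4⟩, hay⟩ := D.hb2 v hv (k + d) (by omega)
    obtain ⟨z, hz, haz, hzy⟩ := ih k hy (by omega)
    refine ⟨z, hz, haz, Or.inr ?_⟩
    rcases hzy with rfl | ⟨g1, g2, g3, g4⟩
    · exact ⟨h1, h2, h3, h4⟩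
    · exact ⟨g1, h2, by omega, by omega⟩
end Pts
end DD

namespace DD

lemma min_of_incr {Γ : Type*} [LinearOrder Γ] (g : ℕ → Γ) (p m : ℕ)
    (h1 : ∀ k, k < p → g (k+1) ≤ g k) (h2 : ∀ k, p ≤ k → k + 1 < m → g k ≤ g (k+1)) :
    ∀ i, i < m → g p ≤ g i := by
  have A : ∀ d, d ≤ p → g p ≤ g (p - d) := by
    intro d
    induction d with
    | zero => intro _; exact le_refl _
    | succ d ih =>
      intro hd
      refine (ih (by omega)).trans ?_
      have := h1 (p - (d+1)) (by omega)
      rwa [show p - (d+1) + 1 = p - d by omega] at this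
  have B : ∀ d, p + d < m → g p ≤ g (p + d) := by
    intro d
    induction d with
    | zero => intro _; exact le_refl _
    | succ d ih =>
      intro hd
      exact (ih (by omega)).trans (h2 (p + d) (by omega) (by omega))
  intro i hi
  rcases le_total i p with h | h
  · have := A (p - i) (by omega)
    rwa [show p - (p - i) = i by omega] at this
  · have := B (i - p) (by omega)
    rwa [show p + (i - p) = i by omega] at this

lemma exists_lex_max {α : Type*} (S : Finset α) (hS : S.Nonempty) (f g : α → ℕ) :
    ∃ y ∈ S, ∀ z ∈ S, f z < f y ∨ f z = f y ∧ g z ≤ g y := by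
  obtain ⟨y, hy, h⟩ := S.exists_max_image (fun z => toLex (f z, g z)) hS
  exact ⟨y, hy, fun z hz => by simpa [Prod.Lex.toLex_le_toLex] using h z hz⟩

lemma exists_lex_min {α : Type*} (S : Finset α) (hS : S.Nonempty) (f g : α → ℕ) :
    ∃ y ∈ S, ∀ z ∈ S, f y < f z ∨ f y = f z ∧ g y ≤ g z := by
  obtain ⟨y, hy, h⟩ := S.exists_min_image (fun z => toLex (f z, g z)) hS
  exact ⟨y, hy, fun z hz => by simpa [Prod.Lex.toLex_le_toLex] using h z hz⟩

section grp
variable {Γ : Type*} [AddCommGroup Γ] [LinearOrder Γ] [IsOrderedAddMonoid Γ]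
lemma grp1 {x y u v : Γ} (h : x - y ≤ u - v) : x - u ≤ y - v := by
  rw [sub_le_sub_iff] at h ⊢
  rwa [add_comm y u]
lemma grp0 {x y u v : Γ} (h : u - v ≤ x - y) : y - v ≤ x - u := by
  rw [sub_le_sub_iff] at h ⊢
  rwa [add_comm y u]
lemma grp2 {A A' B C E W W' : Γ} (e1 : A - B ≤ C - E) (e2 : W' - W ≤ A - A') :
    A' - B - W ≤ C - E - W' := by
  have := add_le_add_right (add_le_add e1 e2) (A' - A - W')
  calc _ = A' - A - W' + (A - B + (W' - W)) := by abel
    _ ≤ _ := this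
    _ = _ := by abel
lemma grp3 {A A' B C E W W' : Γ} (e1 : A - B ≤ C - E) (e2 : A' - A ≤ W' - W) :
    A' - B - W' ≤ C - E - W := by
  have := add_le_add_right (add_le_add e1 e2) (- W')
  calc _ = - W' + (A - B + (A' - A)) := by abel
    _ ≤ _ := this
    _ = _ := by abel
end grp

def MongeH {Γ : Type*} [AddCommGroup Γ] [LinearOrder Γ] (ω : ℕ → ℕ → ℕ → Γ) : Prop :=
  ∀ i q j q' j', (q < q' ∨ q = q' ∧ j ≤ j') →
    ω q' (i+1) j' - ω q' i j' ≤ ω q (i+1) j - ω q i j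
def MongeV {Γ : Type*} [AddCommGroup Γ] [LinearOrder Γ] (ω : ℕ → ℕ → ℕ → Γ) : Prop :=
  ∀ j q i q' i', (q < q' ∨ q = q' ∧ i ≤ i') →
    ω q' i' (j+1) - ω q' i' j ≤ ω q i (j+1) - ω q i j

namespace Pts
variable {α : Type*} (D : Pts α) {Γ : Type*} [AddCommGroup Γ] [LinearOrder Γ]

lemma exU (ω : ℕ → ℕ → ℕ → Γ) (hω : MongeH ω) (a : ℕ) : ∃ U : ℕ → Γ,
    (∀ i q j, (∃ y ∈ D.P, D.pH y ∧ D.a y = a ∧ D.i y ≤ i ∧ (q < D.q y ∨ q = D.q y ∧ j ≤ D.j y)) →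
      U (i+1) - U i ≤ ω q (i+1) j - ω q i j) ∧
    (∀ i q j, (∀ y ∈ D.P, D.pH y → D.a y = a → D.i y ≤ i → (D.q y < q ∨ D.q y = q ∧ D.j y ≤ j)) →
      ω q (i+1) j - ω q i j ≤ U (i+1) - U i) := by
  classical
  have key : ∀ i, ∃ σ : Γ,
    (∀ q j, (∃ y ∈ D.P, D.pH y ∧ D.a y = a ∧ D.i y ≤ i ∧ (q < D.q y ∨ q = D.q y ∧ j ≤ D.j y)) →
      σ ≤ ω q (i+1) j - ω q i j) ∧
    (∀ q j, (∀ y ∈ D.P, D.pH y → D.a y = a → D.i y ≤ i → (D.q y < q ∨ D.q y = q ∧ D.j y ≤ j)) →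
      ω q (i+1) j - ω q i j ≤ σ) := by
    intro i
    set S := D.P.filter (fun y => D.pH y ∧ D.a y = a ∧ D.i y ≤ i) with hS
    rcases S.eq_empty_or_nonempty with h | h
    · refine ⟨ω 0 (i+1) 0 - ω 0 i 0, ?_, ?_⟩
      · rintro q j ⟨y, hy, h1, h2, h3, h4⟩
        have : y ∈ S := by simp [hS, hy, h1, h2, h3]
        simp [h] at this
      · intro q j _
        exact hω i 0 0 q j (by omega)
    · obtain ⟨y, hy, hmax⟩ := exists_lex_max S h D.q D.j
      simp only [hS, Finset.mem_filter] at hy hmax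
      refine ⟨ω (D.q y) (i+1) (D.j y) - ω (D.q y) i (D.j y), ?_, ?_⟩
      · rintro q j ⟨z, hz, h1, h2, h3, h4⟩
        have := hmax z ⟨hz, h1, h2, h3⟩
        exact hω i _ _ _ _ (by omega)
      · intro q j hh
        exact hω i _ _ _ _ (hh y hy.1 hy.2.1 hy.2.2.1 hy.2.2.2)
  choose σ h1 h2 using key
  refine ⟨fun i => ∑ k ∈ Finset.range i, σ k, ?_, ?_⟩
  · intro i q j h
    simpa [Finset.sum_range_succ] using h1 i q j h
  · intro i q j h
    simpa [Finset.sum_range_succ] using h2 i q j h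

lemma exW (ω : ℕ → ℕ → ℕ → Γ) (hω : MongeV ω) (b : ℕ) : ∃ W : ℕ → Γ,
    (∀ j q i, q ≤ D.r → (∀ z ∈ D.P, D.pV z → D.b z = b → j < D.j z → (q < D.q z ∨ q = D.q z ∧ i ≤ D.i z)) →
      W (j+1) - W j ≤ ω q i (j+1) - ω q i j) ∧
    (∀ j q i, (∃ z ∈ D.P, D.pV z ∧ D.b z = b ∧ j < D.j z ∧ (D.q z < q ∨ D.q z = q ∧ D.i z ≤ i)) →
      ω q i (j+1) - ω q i j ≤ W (j+1) - W j) := by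
  classical
  have key : ∀ j, ∃ σ : Γ,
    (∀ q i, q ≤ D.r → (∀ z ∈ D.P, D.pV z → D.b z = b → j < D.j z → (q < D.q z ∨ q = D.q z ∧ i ≤ D.i z)) →
      σ ≤ ω q i (j+1) - ω q i j) ∧
    (∀ q i, (∃ z ∈ D.P, D.pV z ∧ D.b z = b ∧ j < D.j z ∧ (D.q z < q ∨ D.q z = q ∧ D.i z ≤ i)) →
      ω q i (j+1) - ω q i j ≤ σ) := by
    intro j
    set S := D.P.filter (fun y => D.pV y ∧ D.b y = b ∧ j < D.j y) with hS
    rcases S.eq_empty_or_nonempty with h | h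
    · refine ⟨ω (D.r+1) 0 (j+1) - ω (D.r+1) 0 j, ?_, ?_⟩
      · intro q i hq _
        exact hω j _ _ _ _ (by omega)
      · rintro q i ⟨y, hy, h1, h2, h3, h4⟩
        have : y ∈ S := by simp [hS, hy, h1, h2, h3]
        simp [h] at this
    · obtain ⟨y, hy, hmin⟩ := exists_lex_min S h D.q D.i
      simp only [hS, Finset.mem_filter] at hy hmin
      refine ⟨ω (D.q y) (D.i y) (j+1) - ω (D.q y) (D.i y) j, ?_, ?_⟩
      · intro q i _ hh
        exact hω j _ _ _ _ (hh y hy.1 hy.2.1 hy.2.2.1 hy.2.2.2)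
      · rintro q i ⟨z, hz, h1, h2, h3, h4⟩
        have := hmin z ⟨hz, h1, h2, h3⟩
        exact hω j _ _ _ _ (by omega)
  choose σ h1 h2 using key
  refine ⟨fun i => ∑ k ∈ Finset.range i, σ k, ?_, ?_⟩
  · intro j q i hq h
    simpa [Finset.sum_range_succ] using h1 j q i hq h
  · intro j q i h
    simpa [Finset.sum_range_succ] using h2 j q i h

theorem trop [IsOrderedAddMonoid Γ] (ωH ωV : ℕ → ℕ → ℕ → Γ) (hH : MongeH ωH) (hV : MongeV ωV)
    (hHV : ∀ q i j, q < D.r → ωH q i j = ωV q i j) :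
    ∃ U W : ℕ → ℕ → Γ,
     (∀ v ∈ D.P, D.q v < D.r → ∀ i j, i < D.m →
        ωH (D.q v) (D.i v) (D.j v) - U (D.a v) (D.i v) - W (D.b v) (D.j v) ≤
        ωH (D.q v) i j - U (D.a v) i - W (D.b v) j) ∧
     (∀ v ∈ D.P, D.pH v → ∀ i, i < D.m →
        ωH (D.q v) (D.i v) (D.j v) - U (D.a v) (D.i v) ≤ ωH (D.q v) i (D.j v) - U (D.a v) i) ∧
     (∀ v ∈ D.P, D.pV v → ∀ j,
        ωV (D.q v) (D.i v) (D.j v) - W (D.b v) (D.j v) ≤ ωV (D.q v) (D.i v) j - W (D.b v) j) := by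
  classical
  choose U hU1 hU2 using D.exU ωH hH
  choose W hW1 hW2 using D.exW ωV hV
  -- H-fact
  have HF : ∀ a q j p,
      (∀ y ∈ D.P, D.pH y → D.a y = a → D.i y < p → (D.q y < q ∨ D.q y = q ∧ D.j y ≤ j)) →
      (p + 1 = D.m ∨ ∃ y ∈ D.P, D.pH y ∧ D.a y = a ∧ D.i y ≤ p ∧ (q < D.q y ∨ q = D.q y ∧ j ≤ D.j y)) →
      ∀ i, i < D.m → ωH q p j - U a p ≤ ωH q i j - U a i := by
    intro a q j p h1 h2
    refine min_of_incr (fun i => ωH q i j - U a i) p D.m ?_ ?_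
    · intro k hk
      have := hU2 a k q j (fun y hy py ay iy => h1 y hy py ay (by omega))
      show ωH q (k+1) j - U a (k+1) ≤ ωH q k j - U a k
      exact grp1 this
    · intro k hk hkm
      have h3 : ∃ y ∈ D.P, D.pH y ∧ D.a y = a ∧ D.i y ≤ k ∧ (q < D.q y ∨ q = D.q y ∧ j ≤ D.j y) := by
        rcases h2 with h2 | ⟨y, hy, py, ay, iy, hh⟩
        · omega
        · exact ⟨y, hy, py, ay, by omega, hh⟩
      have := hU1 a k q j h3
      show ωH q k j - U a k ≤ ωH q (k+1) j - U a (k+1)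
      exact grp0 this
  refine ⟨U, W, ?_, ?_, ?_⟩
  · intro v0 hv0 hq
    have pv0 := D.hpX v0 hq
    have hHV' := fun i j => hHV (D.q v0) i j hq
    -- i'_j
    have ex : ∀ j, ∃ p, p < D.m ∧
       (∀ y ∈ D.P, D.pH y → D.a y = D.a v0 → (D.q v0 < D.q y ∨ D.q v0 = D.q y ∧ j + 1 ≤ D.j y) → p ≤ D.i y) ∧
       (p + 1 = D.m ∨ ∃ y ∈ D.P, D.pH y ∧ D.a y = D.a v0 ∧ D.i y = p ∧
          (D.q v0 < D.q y ∨ D.q v0 = D.q y ∧ j + 1 ≤ D.j y)) ∧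
       (p + 1 = D.m ∨ ∃ y ∈ D.P, D.pH y ∧ D.a y = D.a v0 ∧ D.i y = p ∧
          (D.q v0 < D.q y ∨ D.q v0 = D.q y ∧ j + 1 ≤ D.j y)) ∧
       (D.j v0 ≤ j ∨ ∃ y ∈ D.P, D.pH y ∧ D.a y = D.a v0 ∧ D.i y = p ∧
          (D.q v0 < D.q y ∨ D.q v0 = D.q y ∧ j + 1 ≤ D.j y)) := by
      intro j
      have hm := D.him v0 pv0.1
      set S := D.P.filter (fun y => D.pH y ∧ D.a y = D.a v0 ∧ (D.q v0 < D.q y ∨ D.q v0 = D.q y ∧ j + 1 ≤ D.j y)) with hS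
      rcases S.eq_empty_or_nonempty with h | h
      · have hno : ∀ y ∈ D.P, D.pH y → D.a y = D.a v0 → (D.q v0 < D.q y ∨ D.q v0 = D.q y ∧ j + 1 ≤ D.j y) → False := by
          intro y hy h1 h2 h3
          have : y ∈ S := by
            rw [hS, Finset.mem_filter]; exact ⟨hy, h1, h2, h3⟩
          simp [h] at this
        refine ⟨D.m - 1, by omega, fun y hy h1 h2 h3 => (hno y hy h1 h2 h3).elim, Or.inl (by omega), Or.inl (by omega), Or.inl ?_⟩
        by_contra hj
        exact hno v0 hv0 pv0.1 rfl (by omega)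
      · obtain ⟨y, hy, hmin⟩ := S.exists_min_image D.i h
        simp only [hS, Finset.mem_filter] at hy hmin
        have : ∃ z ∈ D.P, D.pH z ∧ D.a z = D.a v0 ∧ D.i z = D.i y ∧
          (D.q v0 < D.q z ∨ D.q v0 = D.q z ∧ j + 1 ≤ D.j z) := ⟨y, hy.1, hy.2.1, hy.2.2.1, rfl, hy.2.2.2⟩
        exact ⟨D.i y, D.him y hy.2.1, fun z hz h1 h2 h3 => hmin z ⟨hz, h1, h2, h3⟩, Or.inr this, Or.inr this, Or.inr this⟩
    -- step up
    have up : ∀ j, D.j v0 ≤ j → ∀ i, i < D.m → ∃ p, p < D.m ∧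
        ωH (D.q v0) p j - U (D.a v0) p - W (D.b v0) j ≤
        ωH (D.q v0) i (j+1) - U (D.a v0) i - W (D.b v0) (j+1) := by
      intro j hj i hi
      obtain ⟨p, hp, h1, h2, -, -⟩ := ex j
      refine ⟨p, hp, ?_⟩
      have e1 := HF (D.a v0) (D.q v0) (j+1) p (by
        intro y hy py ay iy
        by_contra hcon
        have := h1 y hy py ay (by omega)
        omega) (by
        rcases h2 with h2 | ⟨y, hy, py, ay, iy, hh⟩
        · exact Or.inl h2
        · exact Or.inr ⟨y, hy, py, ay, iy.le, hh⟩) i hi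
      have e2 := hW1 (D.b v0) j (D.q v0) p (by omega) (by
        intro z hz pz bz jz
        have hd : ¬ (D.q z < D.q v0 ∨ D.q z = D.q v0 ∧ D.i z < D.i v0) := fun h => by
          have := D.hb1 z hz v0 hv0 ⟨pz, pv0.2, by omega, h⟩
          omega
        by_cases hqz : D.q z = D.q v0
        · have pz' := D.hpX z (by omega)
          have ha := D.lem1' hv0 hz hq hqz (by omega) (by omega) (by omega)
          obtain ⟨y, hy, hay, hyz⟩ := D.climbH _ hz ha
          rcases hyz with rfl | ⟨g1, g2, g3, g4⟩
          · have := h1 y hy pz'.1 hay (by omega)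
            omega
          · have := h1 y hy g1 hay (by omega)
            omega
        · omega)
      rw [← hHV', ← hHV'] at e2
      exact grp2 e1 e2
    -- step down
    have down : ∀ j, j < D.j v0 → ∀ i, i < D.m → ∃ p, p < D.m ∧
        ωH (D.q v0) p (j+1) - U (D.a v0) p - W (D.b v0) (j+1) ≤
        ωH (D.q v0) i j - U (D.a v0) i - W (D.b v0) j := by
      intro j hj i hi
      obtain ⟨p, hp, h1, -, h2, h4⟩ := ex j
      refine ⟨p, hp, ?_⟩
      rcases h4 with h4 | ⟨y, hy, py, ay, iy, hh⟩
      · omega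
      have hpi := h1 v0 hv0 pv0.1 rfl (by omega)
      have e1 := HF (D.a v0) (D.q v0) j p (by
        intro z hz pz az iz
        by_contra hcon
        have := h1 z hz pz az (by omega)
        omega) (Or.inr ⟨y, hy, py, ay, iy.le, by omega⟩) i hi
      have e2 := hW2 (D.b v0) j (D.q v0) p (by
        by_cases hpe : p = D.i v0
        · exact ⟨v0, hv0, pv0.2, rfl, hj, by omega⟩
        have hc : ¬ (D.q v0 < D.q y ∨ D.q v0 = D.q y ∧ D.j v0 < D.j y) := fun h => by
          have := D.ha1 y hy v0 hv0 ⟨py, pv0.1, by omega, h⟩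
          omega
        have hqy : D.q y = D.q v0 := by omega
        have py' := D.hpX y (by omega)
        have hb := D.lem2 hy hv0 (by omega) hqy.symm (by omega) (by omega) (by omega)
        obtain ⟨z, hz, hbz, hzy⟩ := D.climbV _ hy hb
        rcases hzy with rfl | ⟨g1, g2, g3, g4⟩
        · exact ⟨z, hz, py'.2, hbz, by omega, by omega⟩
        · exact ⟨z, hz, g1, hbz, by omega, by omega⟩)
      rw [← hHV', ← hHV'] at e2
      exact grp3 e1 e2
    have base : ∀ i, i < D.m →
        ωH (D.q v0) (D.i v0) (D.j v0) - U (D.a v0) (D.i v0) - W (D.b v0) (D.j v0) ≤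
        ωH (D.q v0) i (D.j v0) - U (D.a v0) i - W (D.b v0) (D.j v0) := by
      intro i hi
      apply sub_le_sub_right
      refine HF _ _ _ _ ?_ (Or.inr ⟨v0, hv0, pv0.1, rfl, le_refl _, by omega⟩) i hi
      intro y hy py ay iy
      by_contra hcon
      have := D.ha1 y hy v0 hv0 ⟨py, pv0.1, iy, by omega⟩
      omega
    have UP : ∀ d i, i < D.m →
        ωH (D.q v0) (D.i v0) (D.j v0) - U (D.a v0) (D.i v0) - W (D.b v0) (D.j v0) ≤
        ωH (D.q v0) i (D.j v0 + d) - U (D.a v0) i - W (D.b v0) (D.j v0 + d) := by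
      intro d
      induction d with
      | zero => exact base
      | succ d ih =>
        intro i hi
        obtain ⟨p, hp, h⟩ := up (D.j v0 + d) (by omega) i hi
        exact (ih p hp).trans h
    have DOWN : ∀ d i, i < D.m → d ≤ D.j v0 →
        ωH (D.q v0) (D.i v0) (D.j v0) - U (D.a v0) (D.i v0) - W (D.b v0) (D.j v0) ≤
        ωH (D.q v0) i (D.j v0 - d) - U (D.a v0) i - W (D.b v0) (D.j v0 - d) := by
      intro d
      induction d with
      | zero => intro i hi _; exact base i hi
      | succ d ih =>
        intro i hi hd
        obtain ⟨p, hp, h⟩ := down (D.j v0 - (d+1)) (by omega) i hi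
        rw [show D.j v0 - (d+1) + 1 = D.j v0 - d by omega] at h
        exact (ih p hp (by omega)).trans h
    intro i j hi
    rcases le_total (D.j v0) j with h | h
    · have := UP (j - D.j v0) i hi
      rwa [show D.j v0 + (j - D.j v0) = j by omega] at this
    · have := DOWN (D.j v0 - j) i hi (by omega)
      rwa [show D.j v0 - (D.j v0 - j) = j by omega] at this
  · intro v hv pv i hi
    refine HF _ _ _ _ ?_ (Or.inr ⟨v, hv, pv, rfl, le_refl _, by omega⟩) i hi
    intro y hy py ay iy
    by_contra hcon
    have := D.ha1 y hy v hv ⟨py, pv, iy, by omega⟩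
    omega
  · intro v hv pv j
    refine min_of_incr (fun j => ωV (D.q v) (D.i v) j - W (D.b v) j) (D.j v) (j+1) ?_ ?_ j (by omega)
    · intro k hk
      have := hW2 (D.b v) k (D.q v) (D.i v) ⟨v, hv, pv, rfl, hk, by omega⟩
      show ωV (D.q v) (D.i v) (k+1) - W (D.b v) (k+1) ≤ ωV (D.q v) (D.i v) k - W (D.b v) k
      exact grp1 this
    · intro k hk _
      have := hW1 (D.b v) k (D.q v) (D.i v) (D.hpq v) (by
        intro z hz pz bz jz
        by_contra hcon
        have := D.hb1 z hz v hv ⟨pz, pv, by omega, by omega⟩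
        omega)
      show ωV (D.q v) (D.i v) k - W (D.b v) k ≤ ωV (D.q v) (D.i v) (k+1) - W (D.b v) (k+1)
      exact grp0 this
end Pts
end DD

namespace DD
open MvPolynomial
universe u

/-- All k-minors vanish. -/
def MinZ {S a b : Type*} [CommRing S] (k : ℕ) (M : Matrix a b S) : Prop :=
  ∀ (ρ : Fin k → a) (γ : Fin k → b), (M.submatrix ρ γ).det = 0

lemma det_mul_expand {S : Type*} [CommRing S] {k : ℕ} {c : Type*} [Fintype c] [DecidableEq c]
    (A : Matrix (Fin k) c S) (B : Matrix c (Fin k) S) :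
    (A * B).det = ∑ f : Fin k → c, (∏ i, B (f i) i) * (A.submatrix id f).det := by
  have h1 : (A * B).det = Matrix.detRowAlternating (fun j => ∑ l, B l j • (fun i => A i l)) := by
    rw [← Matrix.det_transpose]
    show Matrix.detRowAlternating _ = _
    congr 1
    ext j i
    simp [Matrix.mul_apply, mul_comm]
  rw [h1]
  have h2 := (Matrix.detRowAlternating (n := Fin k) (R := S)).toMultilinearMap.map_sum
    (fun j l => B l j • (fun i => A i l))
  refine h2.trans ?_
  refine Finset.sum_congr rfl fun f _ => ?_
  rw [MultilinearMap.map_smul_univ, smul_eq_mul]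
  congr 1
  rw [← Matrix.det_transpose]
  rfl

lemma MinZ.mul {S a b c : Type*} [CommRing S] [Fintype c] {k : ℕ} {A : Matrix a c S}
    (hA : MinZ k A) (B : Matrix c b S) : MinZ k (A * B) := by
  classical
  intro ρ γ
  have : (A * B).submatrix ρ γ = A.submatrix ρ id * B.submatrix id γ := by
    ext i j; simp [Matrix.mul_apply]
  rw [this, det_mul_expand]
  refine Finset.sum_eq_zero fun f _ => ?_
  have := hA ρ f
  rw [Matrix.submatrix_submatrix]
  simp only [Function.comp_id, Function.id_comp, this, mul_zero]

lemma MinZ.of_small {S a : Type*} [CommRing S] {s : ℕ} (A : Matrix a (Fin s) S) : MinZ (s+1) A := by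
  intro ρ γ
  obtain ⟨x, y, hne, he⟩ := Fintype.exists_ne_map_eq_of_card_lt γ (by simp)
  exact Matrix.det_zero_of_column_eq hne (fun i => by simp [he])

lemma MinZ.map {S T a b : Type*} [CommRing S] [CommRing T] {k : ℕ} {A : Matrix a b S}
    (hA : MinZ k A) (f : S →+* T) : MinZ k (A.map f) := by
  intro ρ γ
  have := congrArg f (hA ρ γ)
  rw [map_zero, RingHom.map_det] at this
  exact this

/-- variables -/
abbrev Var (r m n : ℕ) (E F : Type) := (Fin r × Fin m × Fin n) ⊕ (Fin m × E) ⊕ (F × Fin n)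

section
variable {r m n : ℕ} {E F : Type} {S : Type*}

def Hm (f : Var r m n E F → S) : Matrix (Fin m) ((Fin r × Fin n) ⊕ E) S := fun i c =>
  match c with
  | .inl (q, j) => f (.inl (q, i, j))
  | .inr k => f (.inr (.inl (i, k)))

def Vm (f : Var r m n E F → S) : Matrix (Fin n) ((Fin r × Fin m) ⊕ F) S := fun j c =>
  match c with
  | .inl (q, i) => f (.inl (q, i, j))
  | .inr l => f (.inr (.inr (l, j)))

def Good [CommRing S] (s t : ℕ) (f : Var r m n E F → S) : Prop :=
  MinZ (s+1) (Hm f) ∧ MinZ (t+1) (Vm f)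

lemma Good.map {S T : Type*} [CommRing S] [CommRing T] {s t : ℕ} {f : Var r m n E F → S}
    (h : Good s t f) (g : S →+* T) : Good s t (fun v => g (f v)) := by
  have e1 : Hm (fun v => g (f v)) = (Hm f).map g := by
    ext i c; rcases c with ⟨q, j⟩ | k <;> rfl
  have e2 : Vm (fun v => g (f v)) = (Vm f).map g := by
    ext i c; rcases c with ⟨q, j⟩ | k <;> rfl
  exact ⟨e1 ▸ h.1.map g, e2 ▸ h.2.map g⟩
end

variable (K : Type u) [Field K] (r m n : ℕ) (E F : Type) (s t : ℕ)

noncomputable def JJ : Ideal (MvPolynomial (Var r m n E F) K) :=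
  Ideal.span ({d | ∃ (ρ : Fin (s+1) → Fin m) (γ : Fin (s+1) → (Fin r × Fin n) ⊕ E),
      d = ((Hm (fun v => (X v : MvPolynomial (Var r m n E F) K))).submatrix ρ γ).det} ∪
    {d | ∃ (ρ : Fin (t+1) → Fin n) (γ : Fin (t+1) → (Fin r × Fin m) ⊕ F),
      d = ((Vm (fun v => (X v : MvPolynomial (Var r m n E F) K))).submatrix ρ γ).det})

abbrev AA := MvPolynomial (Var r m n E F) K ⧸ JJ K r m n E F s t

variable {K r m n E F s t}

lemma JJ_le_ker {S : Type*} [CommRing S] (φ : MvPolynomial (Var r m n E F) K →+* S)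
    (h : Good s t (fun v => φ (X v))) : JJ K r m n E F s t ≤ RingHom.ker φ := by
  rw [JJ, Ideal.span_le]
  rintro d (⟨ρ, γ, rfl⟩ | ⟨ρ, γ, rfl⟩)
  · have := h.1 ρ γ
    rw [SetLike.mem_coe, RingHom.mem_ker, RingHom.map_det, ← this]
    congr 1
    ext i j
    simp only [RingHom.mapMatrix_apply, Matrix.map_apply, Matrix.submatrix_apply]
    rcases γ j with ⟨q, j⟩ | k <;> rfl
  · have := h.2 ρ γ
    rw [SetLike.mem_coe, RingHom.mem_ker, RingHom.map_det, ← this]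
    congr 1
    ext i j
    simp only [RingHom.mapMatrix_apply, Matrix.map_apply, Matrix.submatrix_apply]
    rcases γ j with ⟨q, j⟩ | k <;> rfl

lemma good_of_le_ker {S : Type*} [CommRing S] (φ : MvPolynomial (Var r m n E F) K →+* S)
    (h : JJ K r m n E F s t ≤ RingHom.ker φ) : Good s t (fun v => φ (X v)) := by
  constructor
  · intro ρ γ
    have : _ ∈ RingHom.ker φ := h (Ideal.subset_span (Or.inl ⟨ρ, γ, rfl⟩))
    rw [RingHom.mem_ker, RingHom.map_det] at this
    rw [← this]
    congr 1
    ext i j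
    simp only [RingHom.mapMatrix_apply, Matrix.map_apply, Matrix.submatrix_apply]
    rcases γ j with ⟨q, j⟩ | k <;> rfl
  · intro ρ γ
    have : _ ∈ RingHom.ker φ := h (Ideal.subset_span (Or.inr ⟨ρ, γ, rfl⟩))
    rw [RingHom.mem_ker, RingHom.map_det] at this
    rw [← this]
    congr 1
    ext i j
    simp only [RingHom.mapMatrix_apply, Matrix.map_apply, Matrix.submatrix_apply]
    rcases γ j with ⟨q, j⟩ | k <;> rfl

lemma good_mk : Good s t (fun v => (Ideal.Quotient.mk (JJ K r m n E F s t) (X v))) :=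
  good_of_le_ker (Ideal.Quotient.mk (JJ K r m n E F s t)) (by rw [Ideal.mk_ker])

/-! coordinates -/
section coord
variable {r m n : ℕ} {E F : Type} [Fintype E] [Fintype F]
noncomputable def eN (E : Type) [Fintype E] (k : E) : ℕ := (Fintype.equivFin E k : ℕ)
lemma eN_inj (E : Type) [Fintype E] : Function.Injective (eN E) := fun a b h =>
  (Fintype.equivFin E).injective (Fin.ext h)
lemma eN_lt (E : Type) [Fintype E] (k : E) : eN E k < Fintype.card E := (Fintype.equivFin E k).2

def cq : Var r m n E F → ℕ
  | .inl (q, _, _) => q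
  | .inr _ => r
noncomputable def ci : Var r m n E F → ℕ
  | .inl (_, i, _) => i
  | .inr (.inl (i, _)) => i
  | .inr (.inr (l, _)) => eN F l
noncomputable def cj : Var r m n E F → ℕ
  | .inl (_, _, j) => j
  | .inr (.inl (_, k)) => eN E k
  | .inr (.inr (_, j)) => j
def pH : Var r m n E F → Prop
  | .inl _ => True
  | .inr (.inl _) => True
  | .inr (.inr _) => False
def pV : Var r m n E F → Prop
  | .inl _ => True
  | .inr (.inl _) => False
  | .inr (.inr _) => True
abbrev gH : Var r m n E F → Var r m n E F → Prop := gtH cq ci cj pH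
abbrev gV : Var r m n E F → Var r m n E F → Prop := gtV cq ci cj pV

def NF (s t : ℕ) (P : Finset (Var r m n E F)) : Prop :=
  (∀ v, ¬ Ch gH P s v) ∧ (∀ v, ¬ Ch gV P t v)

noncomputable def om {Γ : Type*} (ωH ωV : ℕ → ℕ → ℕ → Γ) : Var r m n E F → Γ
  | .inl (q, i, j) => ωH q i j
  | .inr (.inl (i, k)) => ωH r i (eN E k)
  | .inr (.inr (l, j)) => ωV r (eN F l) j
end coord

lemma exists_min_val {Γ : Type*} [LinearOrder Γ] [Inhabited Γ] {ι : Type*} [Finite ι] (g : ι → Γ) :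
    ∃ y, (∀ p, y ≤ g p) ∧ ∀ p, (∀ p', g p ≤ g p') → y = g p := by
  rcases isEmpty_or_nonempty ι with h | h
  · exact ⟨default, fun p => h.elim p, fun p => h.elim p⟩
  · obtain ⟨p0, h0⟩ := Finite.exists_min g
    exact ⟨g p0, h0, fun p hp => le_antisymm (h0 p) (hp p0)⟩

lemma val_sum_single {Γ : Type*} {D : Type u} [AddCommGroup Γ] [LinearOrder Γ] [IsOrderedAddMonoid Γ]
    [CommRing D] [IsDomain D] {ι : Type*} [Fintype ι] (g : ι → Γ) (c : ι → D) (γ : Γ)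
    (h : ∀ p, γ ≤ g p) :
    (γ : WithTop Γ) ≤ HahnSeries.addVal Γ D (∑ p, HahnSeries.single (g p) (c p)) ∧
    ∀ p0 : ι, γ = g p0 → ∀ {D' : Type u} [CommRing D'] [Nontrivial D'] (e : D →+* D'),
      e (c p0) = 1 → (∀ p, p ≠ p0 → e (c p) = 0) →
      HahnSeries.addVal Γ D (∑ p, HahnSeries.single (g p) (c p)) = γ := by
  classical
  have h1 : (γ : WithTop Γ) ≤ HahnSeries.addVal Γ D (∑ p, HahnSeries.single (g p) (c p)) := by
    refine AddValuation.map_le_sum _ fun p _ => ?_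
    rw [HahnSeries.addVal_apply]
    exact (WithTop.coe_le_coe.2 (h p)).trans HahnSeries.orderTop_single_le
  refine ⟨h1, ?_⟩
  intro p0 hp0 D' _ _ e h2 h3
  refine le_antisymm ?_ h1
  apply HahnSeries.addVal_le_of_coeff_ne_zero
  rw [HahnSeries.coeff_sum]
  intro h0
  have h4 := congrArg e h0
  rw [map_sum, Finset.sum_eq_single p0] at h4
  · rw [hp0, HahnSeries.coeff_single_same, h2, map_zero] at h4
    exact one_ne_zero h4
  · intro p _ hp
    rw [HahnSeries.coeff_single]
    split_ifs
    · exact h3 p hp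
    · exact map_zero e
  · simp
end DD

namespace DD
open MvPolynomial
universe u
variable {K : Type u} [Field K] {r m n : ℕ} {E F : Type} {s t : ℕ} [Fintype E] [Fintype F]

abbrev PolyD (K : Type u) [Field K] (r : ℕ) (E F : Type) (s t : ℕ) :=
  MvPolynomial ((Fin s × Fin t × Fin r) ⊕ (Fin s × E) ⊕ (Fin t × F)) K

def factF {S : Type*} [CommRing S] (u : Fin s → Fin m → S) (w : Fin t → Fin n → S)
    (y : Fin s → Fin t → Fin r → S) (z : Fin s → E → S) (z' : Fin t → F → S) : Var r m n E F → S
    | .inl (q, i, j) => ∑ p : Fin s × Fin t, u p.1 i * (y p.1 p.2 q * w p.2 j)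
    | .inr (.inl (i, k)) => ∑ p : Fin s, u p i * z p k
    | .inr (.inr (l, j)) => ∑ p : Fin t, w p j * z' p l

lemma factF_good {S : Type*} [CommRing S] (u : Fin s → Fin m → S) (w : Fin t → Fin n → S)
    (y : Fin s → Fin t → Fin r → S) (z : Fin s → E → S) (z' : Fin t → F → S) :
    Good s t (factF u w y z z') := by
  constructor
  · have : Hm (factF u w y z z') = (Matrix.of fun i a => u a i) * (Matrix.of fun a c => match c with
        | .inl (q, j) => ∑ b, y a b q * w b j
        | .inr k => z a k) := by
      ext1 i c
      rcases c with ⟨q, j⟩ | k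
      · show ∑ p : Fin s × Fin t, u p.1 i * (y p.1 p.2 q * w p.2 j) = ∑ a, u a i * ∑ b, y a b q * w b j
        rw [Fintype.sum_prod_type]
        refine Finset.sum_congr rfl fun a _ => ?_
        rw [Finset.mul_sum]
      · rfl
    rw [this]
    exact (MinZ.of_small _).mul _
  · have : Vm (factF u w y z z') = (Matrix.of fun j b => w b j) * (Matrix.of fun b c => match c with
        | .inl (q, i) => ∑ a, u a i * y a b q
        | .inr l => z' b l) := by
      ext1 j c
      rcases c with ⟨q, i⟩ | l
      · show ∑ p : Fin s × Fin t, u p.1 i * (y p.1 p.2 q * w p.2 j) = ∑ b, w b j * ∑ a, u a i * y a b q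
        rw [Fintype.sum_prod_type, Finset.sum_comm]
        refine Finset.sum_congr rfl fun b _ => ?_
        rw [Finset.mul_sum]
        exact Finset.sum_congr rfl fun a _ => by ring
      · rfl
    rw [this]
    exact (MinZ.of_small _).mul _

set_option maxHeartbeats 1000000 in
theorem point_lemma {Γ : Type} [AddCommGroup Γ] [LinearOrder Γ] [IsOrderedAddMonoid Γ]
    (ωH ωV : ℕ → ℕ → ℕ → Γ) (hH : MongeH ωH) (hV : MongeV ωV)
    (hHV : ∀ q i j, q < r → ωH q i j = ωV q i j)
    (P : Finset (Var r m n E F)) (hP : NF s t P) :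
    ∃ v : AddValuation (MvPolynomial (Var r m n E F) K) (WithTop Γ),
      (∀ f ∈ JJ K r m n E F s t, v f = ⊤) ∧
      (∀ c : K, c ≠ 0 → v (C c) = 0) ∧
      (∀ x, ((-(om ωH ωV x) : Γ) : WithTop Γ) ≤ v (X x)) ∧
      (∀ x ∈ P, v (X x) = ((-(om ωH ωV x) : Γ) : WithTop Γ)) := by
  classical
  obtain ⟨a, ha0, ha1, ha2⟩ := exists_height gH P s hP.1
  obtain ⟨b, hb0, hb1, hb2⟩ := exists_height gV P t hP.2
  let D : Pts (Var r m n E F) :=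
    { P := P, q := cq, i := ci, j := cj, pH := pH, pV := pV, r := r, m := m, a := a, b := b
      hpX := by
        rintro (⟨q, i, j⟩ | ⟨i, k⟩ | ⟨l, j⟩) h
        · exact ⟨trivial, trivial⟩
        · simp [cq] at h
        · simp [cq] at h
      hpq := by
        rintro (⟨q, i, j⟩ | ⟨i, k⟩ | ⟨l, j⟩)
        · exact q.2.le
        · exact le_refl _
        · exact le_refl _
      him := by
        rintro (⟨q, i, j⟩ | ⟨i, k⟩ | ⟨l, j⟩) h
        · exact i.2
        · exact i.2
        · exact h.elim
      ha1 := ha1, ha2 := ha2, hb1 := hb1, hb2 := hb2 }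
  obtain ⟨U, W, hX, hE, hF⟩ := D.trop ωH ωV hH hV hHV
  haveI : Inhabited Γ := ⟨0⟩
  choose Y hY1 hY2 using fun (x : Fin s × Fin t × Fin r) =>
    exists_min_val (fun p : Fin m × Fin n => ωH x.2.2 p.1 p.2 - U x.1 p.1 - W x.2.1 p.2)
  choose Z hZ1 hZ2 using fun (x : Fin s × E) =>
    exists_min_val (fun p : Fin m => ωH r p (eN E x.2) - U x.1 p)
  choose Z' hZ1' hZ2' using fun (x : Fin t × F) =>
    exists_min_val (fun p : Fin n => ωV r (eN F x.2) p - W x.1 p)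
  let u (a : Fin s) (i : Fin m) : HahnSeries Γ (PolyD K r E F s t) := HahnSeries.single (-U a i) 1
  let w (b : Fin t) (j : Fin n) : HahnSeries Γ (PolyD K r E F s t) := HahnSeries.single (-W b j) 1
  let y (a : Fin s) (b : Fin t) (q : Fin r) : HahnSeries Γ (PolyD K r E F s t) := HahnSeries.single (-Y (a, b, q)) (X (.inl (a, b, q)))
  let z (a : Fin s) (k : E) : HahnSeries Γ (PolyD K r E F s t) := HahnSeries.single (-Z (a, k)) (X (.inr (.inl (a, k))))
  let z' (b : Fin t) (l : F) : HahnSeries Γ (PolyD K r E F s t) := HahnSeries.single (-Z' (b, l)) (X (.inr (.inr (b, l))))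
  let f : Var r m n E F → HahnSeries Γ (PolyD K r E F s t) := factF u w y z z'
  have hgood : Good s t f := factF_good u w y z z'
  let Φ : MvPolynomial (Var r m n E F) K →+* HahnSeries Γ (PolyD K r E F s t) := eval₂Hom ((HahnSeries.C : PolyD K r E F s t →+* HahnSeries Γ (PolyD K r E F s t)).comp MvPolynomial.C) f
  have hΦX : ∀ v, Φ (X v) = f v := fun v => eval₂Hom_X' _ _ _
  have hΦC : ∀ c, Φ (C c) = HahnSeries.C (MvPolynomial.C c) := fun v => eval₂Hom_C _ _ _
  have hJ : JJ K r m n E F s t ≤ RingHom.ker Φ := JJ_le_ker Φ (by simpa only [hΦX] using hgood)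
  have fX : ∀ q i j, f (.inl (q, i, j)) = ∑ p : Fin s × Fin t,
      HahnSeries.single (-(U p.1 i + Y (p.1, p.2, q) + W p.2 j)) (X (.inl (p.1, p.2, q)) : PolyD K r E F s t) := by
    intro q i j
    refine Finset.sum_congr rfl fun p _ => ?_
    simp only [u, y, w, HahnSeries.single_mul_single, one_mul, mul_one]
    congr 1
    abel
  have fE : ∀ i k, f (.inr (.inl (i, k))) = ∑ p : Fin s,
      HahnSeries.single (-(U p i + Z (p, k))) (X (.inr (.inl (p, k))) : PolyD K r E F s t) := by
    intro i k
    refine Finset.sum_congr rfl fun p _ => ?_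
    simp only [u, z, HahnSeries.single_mul_single, one_mul]
    congr 1
    abel
  have fF : ∀ l j, f (.inr (.inr (l, j))) = ∑ p : Fin t,
      HahnSeries.single (-(W p j + Z' (p, l))) (X (.inr (.inr (p, l))) : PolyD K r E F s t) := by
    intro l j
    refine Finset.sum_congr rfl fun p _ => ?_
    simp only [w, z', HahnSeries.single_mul_single, one_mul]
    congr 1
    abel
  have bX : ∀ (q : Fin r) (i : Fin m) (j : Fin n) (p : Fin s × Fin t), -ωH q i j ≤ -(U p.1 i + Y (p.1, p.2, q) + W p.2 j) := by
    intro q i j p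
    have := hY1 (p.1, p.2, q) (i, j)
    simp only at this
    rw [neg_le_neg_iff]
    rw [le_sub_iff_add_le, le_sub_iff_add_le] at this
    calc _ = Y (p.1, p.2, q) + W p.2 j + U p.1 i := by abel
      _ ≤ _ := this
  have bE : ∀ (i : Fin m) (k : E) (p : Fin s), -ωH r i (eN E k) ≤ -(U p i + Z (p, k)) := by
    intro i k p
    have := hZ1 (p, k) i
    simp only at this
    rw [neg_le_neg_iff]
    rwa [le_sub_iff_add_le, add_comm] at this
  have bF : ∀ (l : F) (j : Fin n) (p : Fin t), -ωV r (eN F l) j ≤ -(W p j + Z' (p, l)) := by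
    intro i k p
    have := hZ1' (p, i) k
    simp only at this
    rw [neg_le_neg_iff]
    rwa [le_sub_iff_add_le, add_comm] at this
  refine ⟨(HahnSeries.addVal Γ (PolyD K r E F s t)).comap Φ, ?_, ?_, ?_, ?_⟩
  · intro g hg
    have : Φ g = 0 := hJ hg
    change HahnSeries.addVal Γ (PolyD K r E F s t) (Φ _) = _; rw [this, AddValuation.map_zero]
  · intro c hc
    change HahnSeries.addVal Γ (PolyD K r E F s t) (Φ _) = _; rw [hΦC, HahnSeries.addVal_apply, HahnSeries.C_apply,
      HahnSeries.orderTop_single (by simpa using hc)]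
    rfl
  · rintro (⟨q, i, j⟩ | ⟨i, k⟩ | ⟨l, j⟩)
    · change _ ≤ HahnSeries.addVal Γ (PolyD K r E F s t) (Φ _); rw [hΦX, fX]
      exact (val_sum_single _ _ _ (bX q i j)).1
    · change _ ≤ HahnSeries.addVal Γ (PolyD K r E F s t) (Φ _); rw [hΦX, fE]
      exact (val_sum_single _ _ _ (bE i k)).1
    · change _ ≤ HahnSeries.addVal Γ (PolyD K r E F s t) (Φ _); rw [hΦX, fF]
      exact (val_sum_single _ _ _ (bF l j)).1
  · rintro (⟨q, i, j⟩ | ⟨i, k⟩ | ⟨l, j⟩) hx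
    · change HahnSeries.addVal Γ (PolyD K r E F s t) (Φ _) = _; rw [hΦX, fX]
      have hx' := hX _ hx q.2
      refine (val_sum_single _ _ _ (bX q i j)).2 (⟨a _, ha0 _ hx⟩, ⟨b _, hb0 _ hx⟩) ?_
        (eval₂Hom (RingHom.id K) (fun x => if x = .inl (⟨a _, ha0 _ hx⟩, ⟨b _, hb0 _ hx⟩, q) then 1 else 0)) ?_ ?_
      · have := hY2 (⟨a _, ha0 _ hx⟩, ⟨b _, hb0 _ hx⟩, q) (i, j) (fun p' => hx' _ _ p'.1.2)
        rw [this]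
        simp [om]; abel
      · rw [eval₂Hom_X', if_pos rfl]
      · rintro ⟨p1, p2⟩ hp
        rw [eval₂Hom_X', if_neg]
        rintro h
        simp only [Sum.inl.injEq, Prod.mk.injEq, and_true] at h
        exact hp (Prod.ext h.1 h.2)
    · change HahnSeries.addVal Γ (PolyD K r E F s t) (Φ _) = _; rw [hΦX, fE]
      have hx' := hE _ hx trivial
      refine (val_sum_single _ _ _ (bE i k)).2 ⟨a _, ha0 _ hx⟩ ?_
        (eval₂Hom (RingHom.id K) (fun x => if x = .inr (.inl (⟨a _, ha0 _ hx⟩, k)) then 1 else 0)) ?_ ?_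
      · have := hZ2 (⟨a _, ha0 _ hx⟩, k) i (fun p' => hx' _ p'.2)
        rw [this]
        simp
      · rw [eval₂Hom_X', if_pos rfl]
      · rintro p hp
        rw [eval₂Hom_X', if_neg]
        rintro h
        simp only [Sum.inr.injEq, Sum.inl.injEq, Prod.mk.injEq, and_true] at h
        exact hp h
    · change HahnSeries.addVal Γ (PolyD K r E F s t) (Φ _) = _; rw [hΦX, fF]
      have hx' := hF _ hx trivial
      refine (val_sum_single _ _ _ (bF l j)).2 ⟨b _, hb0 _ hx⟩ ?_
        (eval₂Hom (RingHom.id K) (fun x => if x = .inr (.inr (⟨b _, hb0 _ hx⟩, l)) then 1 else 0)) ?_ ?_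
      · have := hZ2' (⟨b _, hb0 _ hx⟩, l) j (fun p' => hx' _)
        rw [this]
        simp
      · rw [eval₂Hom_X', if_pos rfl]
      · rintro p hp
        rw [eval₂Hom_X', if_neg]
        rintro h
        simp only [Sum.inr.injEq, Prod.mk.injEq, and_true] at h
        exact hp h
end DD

namespace DD
open MvPolynomial
universe u

abbrev Gam (N : ℕ) := Lex (ℤ × Lex (ℤ × Lex (ℤ × Lex (Fin N → ℤ))))
abbrev mk4 {N : ℕ} (a b c : ℤ) (e : Lex (Fin N → ℤ)) : Gam N := toLex (a, toLex (b, toLex (c, e)))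

lemma mk4_le {N : ℕ} {a b c a' b' c' : ℤ} {e e' : Lex (Fin N → ℤ)} :
    mk4 a b c e ≤ mk4 a' b' c' e' ↔
      (a < a' ∨ a = a' ∧ (b < b' ∨ b = b' ∧ (c < c' ∨ c = c' ∧ e ≤ e'))) := by
  simp [mk4, Prod.Lex.toLex_le_toLex]
lemma mk4_sub {N : ℕ} {a b c a' b' c' : ℤ} {e e' : Lex (Fin N → ℤ)} :
    mk4 a b c e - mk4 a' b' c' e' = mk4 (a - a') (b - b') (c - c') (e - e') := rfl

noncomputable example (N : ℕ) : AddCommGroup (Gam N) := inferInstance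
noncomputable example (N : ℕ) : LinearOrder (Gam N) := inferInstance
example (N : ℕ) : IsOrderedAddMonoid (Gam N) := inferInstance

noncomputable def wH {N : ℕ} (r : ℕ) (e : ℕ → ℕ → ℕ → Lex (Fin N → ℤ)) (q i j : ℕ) : Gam N :=
  mk4 (-(if q = 0 ∧ i = 0 ∧ j = 0 then 1 else 0)) (-(q * (if q < r then i + j else i))) (-(i * j)) (e q i j)
noncomputable def wV {N : ℕ} (r : ℕ) (e : ℕ → ℕ → ℕ → Lex (Fin N → ℤ)) (q i j : ℕ) : Gam N :=
  mk4 (-(if q = 0 ∧ i = 0 ∧ j = 0 then 1 else 0)) (-(q * (if q < r then i + j else j))) (-(i * j)) (e q i j)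

lemma mongeH {N : ℕ} (r : ℕ) (e : ℕ → ℕ → ℕ → Lex (Fin N → ℤ)) : MongeH (wH r e) := by
  intro i q j q' j' h
  have key : ∀ q j : ℕ, wH r e q (i+1) j - wH r e q i j =
      mk4 (if q = 0 ∧ i = 0 ∧ j = 0 then 1 else 0) (-q) (-j) (e q (i+1) j - e q i j) := by
    intro q j
    rw [wH, wH, mk4_sub]
    congr 1
    · simp
    · split_ifs <;> push_cast <;> ring
    · push_cast; ring
  rw [key, key, mk4_le]
  by_cases hj : q = q' ∧ j = j'
  · obtain ⟨rfl, rfl⟩ := hj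
    simp
  · have h0 : ¬ (q' = 0 ∧ i = 0 ∧ j' = 0) := by omega
    rw [if_neg h0]
    split_ifs <;> omega

lemma mongeV {N : ℕ} (r : ℕ) (e : ℕ → ℕ → ℕ → Lex (Fin N → ℤ)) : MongeV (wV r e) := by
  intro j q i q' i' h
  have key : ∀ q i : ℕ, wV r e q i (j+1) - wV r e q i j =
      mk4 (if q = 0 ∧ i = 0 ∧ j = 0 then 1 else 0) (-q) (-i) (e q i (j+1) - e q i j) := by
    intro q i
    rw [wV, wV, mk4_sub]
    congr 1
    · simp
    · split_ifs <;> push_cast <;> ring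
    · push_cast; ring
  rw [key, key, mk4_le]
  by_cases hj : q = q' ∧ i = i'
  · obtain ⟨rfl, rfl⟩ := hj
    simp
  · have h0 : ¬ (q' = 0 ∧ i' = 0 ∧ j = 0) := by omega
    rw [if_neg h0]
    split_ifs <;> omega

section val
variable {K : Type u} [Field K] {σ : Type} [Fintype σ] {Γ : Type} [AddCommGroup Γ] [LinearOrder Γ] [IsOrderedAddMonoid Γ]

noncomputable def wt (ω : σ → Γ) (M : σ →₀ ℕ) : Γ := ∑ x, M x • ω x

lemma val_monomial (v : AddValuation (MvPolynomial σ K) (WithTop Γ)) (ω : σ → Γ) (P : Finset σ)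
    (hC : ∀ c : K, c ≠ 0 → v (C c) = 0)
    (h1 : ∀ x, ((-(ω x) : Γ) : WithTop Γ) ≤ v (X x))
    (h2 : ∀ x ∈ P, v (X x) = ((-(ω x) : Γ) : WithTop Γ)) (M : σ →₀ ℕ) (c : K) (hc : c ≠ 0) :
    ((-wt ω M : Γ) : WithTop Γ) ≤ v (monomial M c) ∧
    (M.support ⊆ P → v (monomial M c) = ((-wt ω M : Γ) : WithTop Γ)) := by
  classical
  have hp : ∀ T : Finset σ, ((-(∑ x ∈ T, M x • ω x) : Γ) : WithTop Γ) ≤ v (∏ x ∈ T, X x ^ M x) ∧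
     (M.support ⊆ P → v (∏ x ∈ T, X x ^ M x) = ((-(∑ x ∈ T, M x • ω x) : Γ) : WithTop Γ)) := by
    intro T
    induction T using Finset.induction_on with
    | empty => simp
    | insert x T hx ih =>
      rw [Finset.sum_insert hx, Finset.prod_insert hx, neg_add, WithTop.coe_add, AddValuation.map_mul,
        AddValuation.map_pow, ← smul_neg, WithTop.coe_nsmul]
      refine ⟨add_le_add (nsmul_le_nsmul_right (h1 x) _) ih.1, fun hM => ?_⟩
      rw [ih.2 hM]
      by_cases hx : x ∈ M.support
      · rw [h2 x (hM hx)]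
      · have : M x = 0 := by simpa using hx
        rw [this, zero_nsmul, zero_nsmul]
  rw [monomial_eq, AddValuation.map_mul, hC c hc, zero_add, Finsupp.prod_fintype _ _ (by simp)]
  exact hp _

lemma val_lower (v : AddValuation (MvPolynomial σ K) (WithTop Γ)) (ω : σ → Γ)
    (hC : ∀ c : K, c ≠ 0 → v (C c) = 0)
    (h1 : ∀ x, ((-(ω x) : Γ) : WithTop Γ) ≤ v (X x)) (f : MvPolynomial σ K) (g : WithTop Γ)
    (hg : ∀ M ∈ f.support, g < ((-wt ω M : Γ) : WithTop Γ)) (hgt : g < ⊤) : g < v f := by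
  classical
  rw [f.as_sum]
  refine AddValuation.map_lt_sum _ hgt.ne fun M hM => ?_
  exact (hg M hM).trans_le (val_monomial v ω ∅ hC h1 (by simp) M _ (by simpa using hM)).1

lemma val_exact (v : AddValuation (MvPolynomial σ K) (WithTop Γ)) (ω : σ → Γ)
    (hC : ∀ c : K, c ≠ 0 → v (C c) = 0)
    (h1 : ∀ x, ((-(ω x) : Γ) : WithTop Γ) ≤ v (X x)) (f : MvPolynomial σ K) 
    (hinj : Function.Injective (wt ω)) (M : σ →₀ ℕ) (hM : M ∈ f.support)
    (hmax : ∀ M' ∈ f.support, wt ω M' ≤ wt ω M)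
    (h2 : ∀ x ∈ M.support, v (X x) = ((-(ω x) : Γ) : WithTop Γ)) :
    v f = ((-wt ω M : Γ) : WithTop Γ) := by
  classical
  have e1 : f = monomial M (f.coeff M) + (f - monomial M (f.coeff M)) := by ring
  have e2 := (val_monomial v ω M.support hC h1 h2 M (f.coeff M) (by simpa using hM)).2 (le_refl _)
  have e3 := val_lower v ω hC h1 (f - monomial M (f.coeff M)) ((-wt ω M : Γ) : WithTop Γ) (by
    intro M' hM'
    rw [mem_support_iff, coeff_sub, coeff_monomial] at hM'
    have hne : M ≠ M' := by
      rintro rfl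
      simp at hM'
    rw [if_neg hne, sub_zero] at hM'
    rw [WithTop.coe_lt_coe, neg_lt_neg_iff]
    exact lt_of_le_of_ne (hmax M' (by simpa using hM')) (fun h => hne (hinj h).symm)) (WithTop.coe_lt_top _)
  rw [e1, AddValuation.map_add_eq_of_lt_left _ (by rw [e2]; exact e3), e2]
end val
end DD

namespace DD
open MvPolynomial
universe u
section
variable {σ : Type} [Fintype σ] {Γ : Type} [AddCommGroup Γ]
lemma wt_hom {B : Type} [AddCommGroup B] (p : Γ →+ B) (ω : σ → Γ) (M : σ →₀ ℕ) :
    p (wt ω M) = ∑ x, M x • p (ω x) := by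
  simp [wt, map_sum]
lemma neg_wt_smul (ω : σ → Γ) (M : σ →₀ ℕ) (k : ℕ) : k • (-wt ω M) = -wt ω (k • M) := by
  simp [wt, Finset.smul_sum, mul_smul]
end
def gp1 (N : ℕ) : Gam N →+ ℤ where
  toFun g := (ofLex g).1
  map_zero' := rfl
  map_add' _ _ := rfl
def gp4 (N : ℕ) : Gam N →+ (Fin N → ℤ) where
  toFun g := ofLex (ofLex (ofLex (ofLex g).2).2).2
  map_zero' := rfl
  map_add' _ _ := rfl
lemma gp1_wH (N r : ℕ) (e : ℕ → ℕ → ℕ → Lex (Fin N → ℤ)) (q i j : ℕ) :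
    gp1 N (wH r e q i j) = -(if q = 0 ∧ i = 0 ∧ j = 0 then 1 else 0) := rfl
lemma gp1_wV (N r : ℕ) (e : ℕ → ℕ → ℕ → Lex (Fin N → ℤ)) (q i j : ℕ) :
    gp1 N (wV r e q i j) = -(if q = 0 ∧ i = 0 ∧ j = 0 then 1 else 0) := rfl
section
variable {r m n : ℕ} {E F : Type} [Fintype E] [Fintype F]

lemma coord_injH {v v' : Var r m n E F} (h : pH v) (h' : pH v') (hq : cq v = cq v') (hi : ci v = ci v')
    (hj : cj v = cj v') : v = v' := by
  rcases v with ⟨q, i, j⟩ | ⟨i, k⟩ | ⟨l, j⟩ <;> rcases v' with ⟨q', i', j'⟩ | ⟨i', k'⟩ | ⟨l', j'⟩ <;>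
    simp only [cq, ci, cj, pH] at h h' hq hi hj
  · rw [Fin.ext hq, Fin.ext hi, Fin.ext hj]
  · have := q.2; omega
  · have := q'.2; omega
  · rw [Fin.ext hi, eN_inj E hj]

lemma coord_injV {v v' : Var r m n E F} (h : pV v) (h' : pV v') (hq : cq v = cq v') (hi : ci v = ci v')
    (hj : cj v = cj v') : v = v' := by
  rcases v with ⟨q, i, j⟩ | ⟨i, k⟩ | ⟨l, j⟩ <;> rcases v' with ⟨q', i', j'⟩ | ⟨i', k'⟩ | ⟨l', j'⟩ <;>
    simp only [cq, ci, cj, pV] at h h' hq hi hj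
  · rw [Fin.ext hq, Fin.ext hi, Fin.ext hj]
  · have := q.2; omega
  · have := q'.2; omega
  · rw [Fin.ext hj, eN_inj F hi]

lemma cq_lt {v : Var r m n E F} (h : cq v < r) : pH v ∧ pV v := by
  rcases v with ⟨q, i, j⟩ | ⟨i, k⟩ | ⟨l, j⟩
  · exact ⟨trivial, trivial⟩
  · simp [cq] at h
  · simp [cq] at h

abbrev x0 : Var (r+1) (m+1) (n+1) E F := .inl (0, 0, 0)

lemma exists_weights : ∃ (N : ℕ) (ωH ωV : ℕ → ℕ → ℕ → Gam N), MongeH ωH ∧ MongeV ωV ∧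
    (∀ q i j, q < r + 1 → ωH q i j = ωV q i j) ∧
    Function.Injective (wt (om ωH ωV : Var (r+1) (m+1) (n+1) E F → Gam N)) ∧
    (∀ M : Var (r+1) (m+1) (n+1) E F →₀ ℕ, (ofLex (wt (om ωH ωV) M)).1 = -(M x0 : ℤ)) := by
  classical
  let V := Var (r+1) (m+1) (n+1) E F
  let N := Fintype.card V
  let idx : V ≃ Fin N := Fintype.equivFin V
  let e : V → Lex (Fin N → ℤ) := fun v => toLex (Pi.single (idx v) 1)
  let eH : ℕ → ℕ → ℕ → Lex (Fin N → ℤ) := fun q i j =>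
    ∑ v : V, if pH v ∧ cq v = q ∧ ci v = i ∧ cj v = j then e v else 0
  let eV : ℕ → ℕ → ℕ → Lex (Fin N → ℤ) := fun q i j =>
    ∑ v : V, if pV v ∧ cq v = q ∧ ci v = i ∧ cj v = j then e v else 0
  have hagree : ∀ q i j, q < r + 1 → eH q i j = eV q i j := by
    intro q i j hq
    refine Finset.sum_congr rfl fun v _ => ?_
    congr 1
    apply propext
    constructor
    · rintro ⟨h1, h2⟩
      exact ⟨(cq_lt (by omega)).2, h2⟩
    · rintro ⟨h1, h2⟩
      exact ⟨(cq_lt (by omega)).1, h2⟩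
  have hH : ∀ v : V, pH v → eH (cq v) (ci v) (cj v) = e v := by
    intro v hv
    show (∑ v', if pH v' ∧ cq v' = cq v ∧ ci v' = ci v ∧ cj v' = cj v then e v' else 0) = e v
    rw [Finset.sum_eq_single v]
    · simp [hv]
    · intro v' _ hne
      rw [if_neg]
      rintro ⟨h1, h2, h3, h4⟩
      exact hne (coord_injH h1 hv h2 h3 h4)
    · simp
  have hV : ∀ v : V, pV v → eV (cq v) (ci v) (cj v) = e v := by
    intro v hv
    show (∑ v', if pV v' ∧ cq v' = cq v ∧ ci v' = ci v ∧ cj v' = cj v then e v' else 0) = e v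
    rw [Finset.sum_eq_single v]
    · simp [hv]
    · intro v' _ hne
      rw [if_neg]
      rintro ⟨h1, h2, h3, h4⟩
      exact hne (coord_injV h1 hv h2 h3 h4)
    · simp
  have hp1 : ∀ v : V, gp1 N (om (wH (r+1) eH) (wV (r+1) eV) v) = -(if v = x0 then 1 else 0) := by
    rintro (⟨q, i, j⟩ | ⟨i, k⟩ | ⟨l, j⟩)
    · change gp1 N (wH _ _ q i j) = _
      rw [gp1_wH]
      congr 1
      by_cases h : (q : ℕ) = 0 ∧ (i : ℕ) = 0 ∧ (j : ℕ) = 0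
      · rw [if_pos h, if_pos]
        rw [x0, Fin.ext (a := q) (b := 0) h.1, Fin.ext (a := i) (b := 0) h.2.1, Fin.ext (a := j) (b := 0) h.2.2]
      · rw [if_neg h, if_neg]
        intro h'
        simp only [x0, Sum.inl.injEq, Prod.mk.injEq] at h'
        obtain ⟨rfl, rfl, rfl⟩ := h'
        simp at h
    · change gp1 N (wH _ _ (r+1) _ _) = _
      rw [gp1_wH]
      simp [x0]
    · change gp1 N (wV _ _ (r+1) _ _) = _
      rw [gp1_wV]
      simp [x0]
  have hp4 : ∀ v : V, gp4 N (om (wH (r+1) eH) (wV (r+1) eV) v) = Pi.single (idx v) 1 := by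
    rintro (⟨q, i, j⟩ | ⟨i, k⟩ | ⟨l, j⟩)
    · exact congrArg ofLex (hH (.inl (q, i, j)) trivial)
    · exact congrArg ofLex (hH (.inr (.inl (i, k))) trivial)
    · exact congrArg ofLex (hV (.inr (.inr (l, j))) trivial)
  refine ⟨N, wH (r+1) eH, wV (r+1) eV, mongeH _ _, mongeV _ _, ?_, ?_, ?_⟩
  · intro q i j hq
    simp only [wH, wV, if_pos hq, hagree q i j hq]
  · intro M M' h
    ext v
    have h2 := congrArg (fun g => gp4 N g (idx v)) h
    have h3 : ∀ M : V →₀ ℕ, gp4 N (wt (om (wH (r+1) eH) (wV (r+1) eV)) M) (idx v) = M v := by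
      intro M
      rw [wt_hom, Finset.sum_apply, Finset.sum_eq_single v]
      · simp [hp4]
      · intro v' _ hne
        simp [hne.symm, Pi.single_apply, hp4]
      · simp
    simp only [h3] at h2
    exact_mod_cast h2
  · intro M
    show gp1 N _ = _
    rw [wt_hom, Finset.sum_eq_single x0]
    · simp [hp1]
    · intro v _ hne
      simp [hne, hp1]
    · simp
end

section
variable {K : Type u} [Field K] {r m n : ℕ} {E F : Type} {s t : ℕ} [Fintype E] [Fintype F]

def NFp (s t : ℕ) (f : MvPolynomial (Var r m n E F) K) : Prop := ∀ M ∈ f.support, NF s t M.support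

lemma indep (f : MvPolynomial (Var (r+1) (m+1) (n+1) E F) K) (hf : NFp s t f)
    (hJ : f ∈ JJ K (r+1) (m+1) (n+1) E F s t) : f = 0 := by
  by_contra h0
  obtain ⟨N, ωH, ωV, hH, hV, hHV, hinj, hx⟩ := exists_weights (r := r) (m := m) (n := n) (E := E) (F := F)
  obtain ⟨M, hM, hmax⟩ := f.support.exists_max_image (wt (om ωH ωV)) (by
    rwa [Finset.nonempty_iff_ne_empty, Ne, MvPolynomial.support_eq_empty])
  obtain ⟨v, v1, v2, v3, v4⟩ := point_lemma (K := K) ωH ωV hH hV hHV M.support (hf M hM)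
  have := val_exact v _ v2 v3 f hinj M hM hmax v4
  rw [v1 f hJ] at this
  exact WithTop.coe_ne_top this.symm

lemma NF_insert {P : Finset (Var (r+1) (m+1) (n+1) E F)} (h : NF (s+1) (t+1) P) (Q : Finset (Var (r+1) (m+1) (n+1) E F))
    (hQ : ∀ v ∈ Q, v = x0 ∨ v ∈ P) : NF (s+1) (t+1) Q := by
  have key : ∀ (R : Var (r+1) (m+1) (n+1) E F → Var (r+1) (m+1) (n+1) E F → Prop),
      (∀ y, ¬ R x0 y) → (∀ y, ¬ R y x0) → ∀ k v, Ch R Q k v → v ≠ x0 → Ch R P k v := by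
    intro R h1 h2 k
    induction k with
    | zero =>
      intro v hv hne
      exact (hQ v hv).resolve_left hne
    | succ k ih =>
      rintro v ⟨hv, y, hy, hc⟩ hne
      refine ⟨(hQ v hv).resolve_left hne, y, hy, ih y hc ?_⟩
      rintro rfl
      exact h1 _ hy
  have a1 : ∀ y, ¬ gH (x0 : Var (r+1) (m+1) (n+1) E F) y := by
    rintro y ⟨_, _, h3, h4⟩
    simp [cq, ci, cj] at h3 h4
  have a2 : ∀ y, ¬ gH y (x0 : Var (r+1) (m+1) (n+1) E F) := by
    rintro y ⟨_, _, h3, h4⟩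
    simp [ci] at h3
  have b1 : ∀ y, ¬ gV (x0 : Var (r+1) (m+1) (n+1) E F) y := by
    rintro y ⟨_, _, h3, h4⟩
    simp [cj] at h3
  have b2 : ∀ y, ¬ gV y (x0 : Var (r+1) (m+1) (n+1) E F) := by
    rintro y ⟨_, _, h3, h4⟩
    simp [cq, ci, cj] at h3 h4
  constructor
  · intro v hv
    have hne : v ≠ x0 := by
      rintro rfl
      obtain ⟨_, y, hy, _⟩ := hv
      exact a2 _ hy
    exact h.1 v (key _ a1 a2 _ v hv hne)
  · intro v hv
    have hne : v ≠ x0 := by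
      rintro rfl
      obtain ⟨_, y, hy, _⟩ := hv
      exact b2 _ hy
    exact h.2 v (key _ b1 b2 _ v hv hne)

lemma x_mul_mem {f : MvPolynomial (Var (r+1) (m+1) (n+1) E F) K} (hf : NFp (s+1) (t+1) f)
    (h : X x0 * f ∈ JJ K (r+1) (m+1) (n+1) E F (s+1) (t+1)) : f = 0 := by
  classical
  have := indep (s := s+1) (t := t+1) (X x0 * f) (by
    intro M hM
    rw [mem_support_iff, coeff_X_mul'] at hM
    split_ifs at hM with hx
    · refine NF_insert (hf _ (by simpa using hM)) _ ?_
      intro v hv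
      by_cases hv0 : v = x0
      · exact Or.inl hv0
      · right
        simp only [Finsupp.mem_support_iff, Finsupp.coe_tsub, Pi.sub_apply] at hv ⊢
        rwa [Finsupp.single_eq_of_ne hv0]
    · exact (hM rfl).elim) h
  exact (mul_eq_zero.1 this).resolve_left (X_ne_zero _)

lemma x_radical {f : MvPolynomial (Var (r+1) (m+1) (n+1) E F) K} (hf : NFp s t f)
    (hfx : ∀ M ∈ f.support, M x0 = 0) (k : ℕ) (h : MvPolynomial (Var (r+1) (m+1) (n+1) E F) K)
    (hJ : f ^ k - X x0 * h ∈ JJ K (r+1) (m+1) (n+1) E F s t) : f = 0 := by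
  classical
  by_contra h0
  obtain ⟨N, ωH, ωV, hH, hV, hHV, hinj, hx⟩ := exists_weights (r := r) (m := m) (n := n) (E := E) (F := F)
  obtain ⟨M, hM, hmax⟩ := f.support.exists_max_image (wt (om ωH ωV)) (by
    rwa [Finset.nonempty_iff_ne_empty, Ne, MvPolynomial.support_eq_empty])
  obtain ⟨v, v1, v2, v3, v4⟩ := point_lemma (K := K) ωH ωV hH hV hHV M.support (hf M hM)
  have e1 := val_exact v _ v2 v3 f hinj M hM hmax v4
  have e2 : v (f ^ k) = ((k • (-wt (om ωH ωV) M) : Gam N) : WithTop (Gam N)) := by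
    rw [AddValuation.map_pow, e1, WithTop.coe_nsmul]
  rw [neg_wt_smul] at e2
  have e3 := val_lower v _ v2 v3 (X x0 * h) (v (f^k)) (by
    intro M' hM'
    rw [e2, WithTop.coe_lt_coe, neg_lt_neg_iff]
    refine Prod.Lex.lt_iff.2 (Or.inl ?_)
    rw [hx, hx]
    have hM0 := hfx M hM
    have : 0 < M' x0 := by
      rw [mem_support_iff, coeff_X_mul'] at hM'
      split_ifs at hM' with hx
      · exact Nat.pos_of_ne_zero (Finsupp.mem_support_iff.1 hx)
      · exact (hM' rfl).elim
    simp [hM0, this]) (by rw [e2]; exact WithTop.coe_lt_top _)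
  have e4 : v (f ^ k) < v (f ^ k - X x0 * h) := by
    rw [v1 _ hJ, e2]; exact WithTop.coe_lt_top _
  have e5 := AddValuation.map_lt_add v e4 e3
  simp at e5
end
end DD

namespace DD
open MvPolynomial
universe u

lemma rearr {k : ℕ} (I c : Fin k → ℕ) (hI : StrictMono I) (hc : StrictAnti c) (σ : Equiv.Perm (Fin k))
    (hσ : σ ≠ 1) : ∑ b, I b * c b < ∑ b, I (σ b) * c b := by
  have ha : Antivary I c := fun a b h => (hI (hc.lt_iff_gt.1 h)).le
  refine ha.sum_mul_lt_sum_comp_perm_mul_iff.2 fun h => hσ ?_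
  have hm : StrictMono σ := by
    intro a b hab
    have h1 : I (σ a) ≤ I (σ b) := h (hc hab)
    exact lt_of_le_of_ne (hI.le_iff_le.1 h1) (fun e => hab.ne (σ.injective e))
  ext b
  have : (σ : Fin k → Fin k) = id := by
    have := Subsingleton.elim (hm.orderIsoOfSurjective _ σ.surjective) (OrderIso.refl _)
    funext b
    exact congrArg (fun e : Fin k ≃o Fin k => e b) this
  rw [this]; rfl

section
variable {K : Type u} [Field K] {τ : Type}

lemma reduce (J : Ideal (MvPolynomial τ K)) (w : τ → ℕ) {k : ℕ} (u : Fin k → Fin k → τ)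
    (I c e : Fin k → ℕ) (hI : StrictMono I) (hc : StrictAnti c)
    (hw : ∀ a b, w (u a b) = I a * c b + e b) (hJ : (Matrix.of fun a b => (X (u a b) : MvPolynomial τ K)).det ∈ J)
    (hu : Function.Injective (fun a => u a a)) (M : τ →₀ ℕ) (hM : ∀ a, u a a ∈ M.support) :
    ∃ g : MvPolynomial τ K, monomial M 1 - g ∈ J ∧ ∀ M' ∈ g.support,
      M'.degree = M.degree ∧ Finsupp.weight w M < Finsupp.weight w M' := by
  classical
  let D : Equiv.Perm (Fin k) → (τ →₀ ℕ) := fun σ => ∑ b, Finsupp.single (u (σ b) b) 1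
  have hD : D 1 ≤ M := by
    intro x
    simp only [D, Finsupp.finsetSum_apply, Equiv.Perm.one_apply]
    by_cases hx : ∃ a, u a a = x
    · obtain ⟨a, rfl⟩ := hx
      rw [Finset.sum_eq_single a]
      · simpa [Nat.one_le_iff_ne_zero] using hM a
      · intro b _ hb
        exact Finsupp.single_eq_of_ne (fun h => hb (hu h).symm)
      · simp
    · push Not at hx
      rw [Finset.sum_eq_zero]
      · exact Nat.zero_le _
      · intro b _
        exact Finsupp.single_eq_of_ne (fun h => hx b h.symm)
  have hdet : (Matrix.of fun a b => (X (u a b) : MvPolynomial τ K)).det =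
      ∑ σ : Equiv.Perm (Fin k), monomial (D σ) (((Equiv.Perm.sign σ : ℤ) : K)) := by
    rw [Matrix.det_apply']
    refine Finset.sum_congr rfl fun σ _ => ?_
    have : ∏ i, (X (u (σ i) i) : MvPolynomial τ K) = monomial (D σ) 1 := by
      simp only [X, D]
      rw [← monomial_sum_one]
    simp only [Matrix.of_apply, this]
    rw [show (((Equiv.Perm.sign σ : ℤ)) : MvPolynomial τ K) = C (((Equiv.Perm.sign σ : ℤ) : K)) by simp, C_mul_monomial, mul_one]
  have hdeg : ∀ σ, (D σ).degree = (D 1).degree := by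
    intro σ
    simp [D, map_sum, Finsupp.degree_single]
  have hwt : ∀ σ, Finsupp.weight w (D σ) = ∑ b, I (σ b) * c b + ∑ b, e b := by
    intro σ
    simp [D, map_sum, Finsupp.weight_single, hw, Finset.sum_add_distrib]
  refine ⟨- ∑ σ ∈ Finset.univ.erase (1 : Equiv.Perm (Fin k)), monomial (M - D 1 + D σ) (((Equiv.Perm.sign σ : ℤ) : K)), ?_, ?_⟩
  · have h1 := J.mul_mem_left (monomial (M - D 1) 1) hJ
    rw [hdet, Finset.mul_sum, ← Finset.add_sum_erase _ _ (Finset.mem_univ (1 : Equiv.Perm (Fin k)))] at h1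
    simp only [monomial_mul, one_mul, tsub_add_cancel_of_le hD, Equiv.Perm.sign_one, Units.val_one, Int.cast_one] at h1
    rwa [sub_neg_eq_add]
  · intro M' hM'
    rw [support_neg] at hM'
    have := (support_sum (σ := τ)) hM'
    rw [Finset.mem_biUnion] at this
    obtain ⟨σ, hσ, h2⟩ := this
    have h3 := Finset.mem_singleton.1 (support_monomial_subset h2)
    have hM1 : M = M - D 1 + D 1 := (tsub_add_cancel_of_le hD).symm
    subst h3
    constructor
    · conv_rhs => rw [hM1]
      rw [map_add, map_add, hdeg]
    · conv_lhs => rw [hM1]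
      rw [map_add, map_add, hwt, hwt]
      have := rearr I c hI hc σ (Finset.ne_of_mem_erase hσ)
      simpa using this

lemma weight_le [Fintype τ] (w : τ → ℕ) : ∃ W, ∀ M : τ →₀ ℕ, Finsupp.weight w M ≤ W * M.degree := by
  refine ⟨∑ x, w x, fun M => ?_⟩
  rw [Finsupp.weight_apply, Finsupp.degree_apply, Finset.mul_sum, Finsupp.sum]
  refine Finset.sum_le_sum fun x _ => ?_
  rw [smul_eq_mul, mul_comm]
  exact Nat.mul_le_mul_right _ (Finset.single_le_sum (fun _ _ => Nat.zero_le _) (Finset.mem_univ x))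

lemma span_abstract [Fintype τ] (J : Ideal (MvPolynomial τ K)) (w : τ → ℕ) (P : (τ →₀ ℕ) → Prop)
    (h : ∀ M, ¬ P M → ∃ g : MvPolynomial τ K, monomial M 1 - g ∈ J ∧ ∀ M' ∈ g.support,
      M'.degree = M.degree ∧ Finsupp.weight w M < Finsupp.weight w M') (f : MvPolynomial τ K) :
    ∃ g, f - g ∈ J ∧ ∀ M ∈ g.support, P M := by
  classical
  obtain ⟨W, hW⟩ := weight_le w
  let T : Submodule K (MvPolynomial τ K) :=
    { carrier := {f | ∃ g, f - g ∈ J ∧ ∀ M ∈ g.support, P M}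
      add_mem' := by
        rintro a b ⟨g, h1, h2⟩ ⟨g', h3, h4⟩
        refine ⟨g + g', ?_, fun M hM => ?_⟩
        · rw [add_sub_add_comm]; exact J.add_mem h1 h3
        · rcases Finset.mem_union.1 (support_add hM) with h | h
          · exact h2 M h
          · exact h4 M h
      zero_mem' := ⟨0, by simp, by simp⟩
      smul_mem' := by
        rintro c a ⟨g, h1, h2⟩
        refine ⟨c • g, ?_, fun M hM => h2 M (support_smul hM)⟩
        rw [← smul_sub, smul_eq_C_mul]
        exact J.mul_mem_left _ h1 }
  have hlin : ∀ g : MvPolynomial τ K, (∀ M ∈ g.support, monomial M 1 ∈ T) → g ∈ T := by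
    intro g hg
    rw [g.as_sum]
    refine T.sum_mem fun M hM => ?_
    have := T.smul_mem (coeff M g) (hg M hM)
    rwa [smul_monomial, smul_eq_mul, mul_one] at this
  have key : ∀ k : ℕ, ∀ M : τ →₀ ℕ, W * M.degree - Finsupp.weight w M = k → monomial M 1 ∈ T := by
    intro k
    induction k using Nat.strong_induction_on with
    | _ k ih =>
      intro M hk
      by_cases hP : P M
      · refine ⟨monomial M 1, by simp, fun M' hM' => ?_⟩
        rw [Finset.mem_singleton.1 (support_monomial_subset hM')]
        exact hP
      · obtain ⟨g, h1, h2⟩ := h M hP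
        have hg : g ∈ T := hlin g fun M' hM' => by
          obtain ⟨h3, h4⟩ := h2 M' hM'
          refine ih _ ?_ M' rfl
          have := hW M'
          rw [h3] at this ⊢
          omega
        obtain ⟨g', h3, h4⟩ := hg
        refine ⟨g', ?_, h4⟩
        have := J.add_mem h1 h3
        rwa [sub_add_sub_cancel] at this
  exact hlin f fun M _ => key _ M rfl
end

lemma Ch.toFun {α : Type*} {R : α → α → Prop} (hR : ∀ a b c, R a b → R b c → R a c) {P : Finset α} {k : ℕ} :
    ∀ {v : α}, Ch R P k v → ∃ f : Fin (k+1) → α, f (Fin.last k) = v ∧ (∀ i, f i ∈ P) ∧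
      ∀ i j, i < j → R (f i) (f j) := by
  induction k with
  | zero =>
    intro v h
    refine ⟨fun _ => v, rfl, fun _ => h, fun i j hij => ?_⟩
    omega
  | succ k ih =>
    rintro v ⟨hv, y, hy, hc⟩
    obtain ⟨f, h1, h2, h3⟩ := ih hc
    refine ⟨Fin.snoc f v, by simp, ?_, ?_⟩
    · intro i
      refine Fin.lastCases ?_ (fun i => ?_) i
      · simpa using hv
      · simpa using h2 i
    · intro i j
      refine Fin.lastCases ?_ (fun i => ?_) i
      · intro h
        exact absurd (Fin.le_last j) (not_le.2 h)
      · refine Fin.lastCases ?_ (fun j => ?_) j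
        · intro _
          simp only [Fin.snoc_castSucc, Fin.snoc_last]
          rcases eq_or_ne i (Fin.last k) with rfl | hne
          · rw [h1]; exact hy
          · refine hR _ _ _ (h3 i _ (Fin.lt_last_iff_ne_last.2 hne)) ?_
            rw [h1]; exact hy
        · intro h
          simp only [Fin.snoc_castSucc]
          exact h3 i j (by simpa using h)

section
variable {r m n : ℕ} {E F : Type} [Fintype E] [Fintype F]

def hvar (i : Fin m) : (Fin r × Fin n) ⊕ E → Var r m n E F
  | .inl (q, j) => .inl (q, i, j)
  | .inr k => .inr (.inl (i, k))
def vvar (j : Fin n) : (Fin r × Fin m) ⊕ F → Var r m n E F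
  | .inl (q, i) => .inl (q, i, j)
  | .inr l => .inr (.inr (l, j))

lemma Hm_apply {S : Type*} (f : Var r m n E F → S) (i) (c) : Hm f i c = f (hvar i c) := by
  rcases c with ⟨q, j⟩ | k <;> rfl
lemma Vm_apply {S : Type*} (f : Var r m n E F → S) (i) (c) : Vm f i c = f (vvar i c) := by
  rcases c with ⟨q, j⟩ | k <;> rfl

lemma pH_hvar {v : Var r m n E F} (h : pH v) : ∃ i c, v = hvar i c := by
  rcases v with ⟨q, i, j⟩ | ⟨i, k⟩ | ⟨l, j⟩
  · exact ⟨i, .inl (q, j), rfl⟩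
  · exact ⟨i, .inr k, rfl⟩
  · exact h.elim
lemma pV_vvar {v : Var r m n E F} (h : pV v) : ∃ i c, v = vvar i c := by
  rcases v with ⟨q, i, j⟩ | ⟨i, k⟩ | ⟨l, j⟩
  · exact ⟨j, .inl (q, i), rfl⟩
  · exact h.elim
  · exact ⟨j, .inr l, rfl⟩

noncomputable def wgt (N : ℕ) : Var r m n E F → ℕ
  | .inl (q, i, j) => N * q * (i + j) + i * j
  | .inr (.inl (i, k)) => i * (N * r + eN E k)
  | .inr (.inr (l, j)) => j * (N * r + eN F l)

noncomputable def hcol (N : ℕ) : (Fin r × Fin n) ⊕ E → ℕ × ℕ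
  | .inl (q, j) => (N * q + j, N * q * j)
  | .inr k => (N * r + eN E k, 0)

lemma wgt_h (N : ℕ) (i : Fin m) (c : (Fin r × Fin n) ⊕ E) :
    wgt N (hvar i c : Var r m n E F) = i * (hcol N c).1 + (hcol N c).2 := by
  rcases c with ⟨q, j⟩ | k <;> simp [wgt, hvar, hcol]; ring
lemma wgt_v (N : ℕ) (j : Fin n) (c : (Fin r × Fin m) ⊕ F) :
    wgt N (vvar j c : Var r m n E F) = j * (hcol N c).1 + (hcol N c).2 := by
  rcases c with ⟨q, i⟩ | k <;> simp [wgt, vvar, hcol]; ring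

lemma hcol_h (N : ℕ) (i : Fin m) (c : (Fin r × Fin n) ⊕ E) :
    (hcol N c).1 = N * cq (hvar i c : Var r m n E F) + cj (hvar i c : Var r m n E F) ∧ ci (hvar i c : Var r m n E F) = i := by
  rcases c with ⟨q, j⟩ | k <;> exact ⟨rfl, rfl⟩
lemma hcol_v (N : ℕ) (j : Fin n) (c : (Fin r × Fin m) ⊕ F) :
    (hcol N c).1 = N * cq (vvar j c : Var r m n E F) + ci (vvar j c : Var r m n E F) ∧ cj (vvar j c : Var r m n E F) = j := by
  rcases c with ⟨q, j⟩ | k <;> exact ⟨rfl, rfl⟩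

lemma ccol_lt {N q j q' j' : ℕ} (h : j < N) (h2 : q < q' ∨ q = q' ∧ j < j') : N * q + j < N * q' + j' := by
  rcases h2 with h2 | ⟨rfl, h2⟩
  · have := Nat.mul_le_mul_left N h2
    rw [Nat.succ_eq_add_one, mul_add] at this
    omega
  · omega

variable {K : Type u} [Field K] {s t : ℕ}

lemma span_nf (f : MvPolynomial (Var r m n E F) K) :
    ∃ g, f - g ∈ JJ K r m n E F (s+1) (t+1) ∧ NFp (s+1) (t+1) g := by
  classical
  let N := m + n + Fintype.card E + Fintype.card F
  have hcj : ∀ v : Var r m n E F, cj v < N ∧ ci v < N := by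
    rintro (⟨q, i, j⟩ | ⟨i, k⟩ | ⟨l, j⟩) <;> simp only [ci, cj, N]
    · omega
    · have := eN_lt E k; omega
    · have := eN_lt F l; omega
  refine span_abstract _ (wgt N) _ ?_ f
  intro M hM
  rw [NF, not_and_or] at hM
  rcases hM with hM | hM
  · push Not at hM
    obtain ⟨v, hv⟩ := hM
    obtain ⟨f, -, h2, h3⟩ := hv.toFun (fun a b c h h' => ⟨h.1, h'.2.1, h.2.2.1.trans h'.2.2.1, by
      have := h.2.2.2; have := h'.2.2.2; omega⟩)
    have hp : ∀ a, pH (f a) := by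
      intro a
      rcases eq_or_ne a (Fin.last _) with rfl | hne
      · exact (h3 0 (Fin.last _) (by simp [Fin.lt_def])).2.1
      · exact (h3 a _ (Fin.lt_last_iff_ne_last.2 hne)).1
    choose ρ γ hργ using fun a => pH_hvar (hp a)
    refine reduce _ (wgt N) (fun a b => hvar (ρ a) (γ b)) (fun a => ρ a) (fun b => (hcol N (γ b)).1)
      (fun b => (hcol N (γ b)).2) ?_ ?_ (fun a b => wgt_h _ _ _) ?_ ?_ M ?_
    · intro a b hab
      have := (h3 a b hab).2.2.1
      rwa [hργ a, hργ b, (hcol_h N _ _).2, (hcol_h N _ _).2] at this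
    · intro a b hab
      show (hcol N (γ b)).1 < (hcol N (γ a)).1
      have := (h3 a b hab).2.2.2
      rw [(hcol_h (F := F) N (ρ b) (γ b)).1, (hcol_h (F := F) N (ρ a) (γ a)).1, ← hργ, ← hργ]
      exact ccol_lt (hcj _).1 this
    · refine Ideal.subset_span (Or.inl ⟨ρ, γ, ?_⟩)
      congr 1
      ext a b
      simp [Hm_apply]
    · intro a b hab
      simp only [← hργ] at hab
      by_contra hne
      rcases lt_or_gt_of_ne hne with h | h
      · have := (h3 _ _ h).2.2.1
        rw [hab] at this
        exact lt_irrefl _ this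
      · have := (h3 _ _ h).2.2.1
        rw [hab] at this
        exact lt_irrefl _ this
    · intro a
      rw [← hργ]; exact h2 a
  · push Not at hM
    obtain ⟨v, hv⟩ := hM
    obtain ⟨f, -, h2, h3⟩ := hv.toFun (fun a b c h h' => ⟨h.1, h'.2.1, h'.2.2.1.trans h.2.2.1, by
      have := h.2.2.2; have := h'.2.2.2; omega⟩)
    have hp : ∀ a, pV (f a) := by
      intro a
      rcases eq_or_ne a (Fin.last _) with rfl | hne
      · exact (h3 0 (Fin.last _) (by simp [Fin.lt_def])).2.1
      · exact (h3 a _ (Fin.lt_last_iff_ne_last.2 hne)).1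
    choose ρ γ hργ using fun a => pV_vvar (hp (Fin.rev a))
    refine reduce _ (wgt N) (fun a b => vvar (ρ a) (γ b)) (fun a => ρ a) (fun b => (hcol N (γ b)).1)
      (fun b => (hcol N (γ b)).2) ?_ ?_ (fun a b => wgt_v _ _ _) ?_ ?_ M ?_
    · intro a b hab
      have := (h3 _ _ (Fin.rev_lt_rev.2 hab)).2.2.1
      rwa [hργ a, hργ b, (hcol_v N _ _).2, (hcol_v N _ _).2] at this
    · intro a b hab
      show (hcol N (γ b)).1 < (hcol N (γ a)).1
      have := (h3 _ _ (Fin.rev_lt_rev.2 hab)).2.2.2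
      rw [(hcol_v (E := E) N (ρ b) (γ b)).1, (hcol_v (E := E) N (ρ a) (γ a)).1, ← hργ, ← hργ]
      exact ccol_lt (hcj _).2 this
    · refine Ideal.subset_span (Or.inr ⟨ρ, γ, ?_⟩)
      congr 1
      ext a b
      simp [Vm_apply]
    · intro a b hab
      simp only [← hργ] at hab
      by_contra hne
      rcases lt_or_gt_of_ne hne with h | h
      · have := (h3 _ _ (Fin.rev_lt_rev.2 h)).2.2.1
        rw [hab] at this
        exact lt_irrefl _ this
      · have := (h3 _ _ (Fin.rev_lt_rev.2 h)).2.2.1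
        rw [hab] at this
        exact lt_irrefl _ this
    · intro a
      rw [← hργ]; exact h2 _
end
end DD

namespace DD
open MvPolynomial
universe u

section
variable {K : Type u} [Field K] {r m n : ℕ} {E F : Type} {s t : ℕ} [Fintype E] [Fintype F]

noncomputable abbrev xA (K : Type u) [Field K] (r m n : ℕ) (E F : Type) (s t : ℕ) : AA K (r+1) (m+1) (n+1) E F (s+1) (t+1) :=
  Ideal.Quotient.mk _ (X x0)

lemma exists_nf (a : AA K (r+1) (m+1) (n+1) E F (s+1) (t+1)) : ∃ f, NFp (s+1) (t+1) f ∧ Ideal.Quotient.mk _ f = a := by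
  obtain ⟨f, rfl⟩ := Ideal.Quotient.mk_surjective a
  obtain ⟨g, h1, h2⟩ := span_nf (s := s) (t := t) f
  exact ⟨g, h2, (Ideal.Quotient.eq.2 h1).symm⟩

lemma xA_nzd (a : AA K (r+1) (m+1) (n+1) E F (s+1) (t+1)) (h : xA K r m n E F s t * a = 0) : a = 0 := by
  obtain ⟨f, hf, rfl⟩ := exists_nf a
  rw [xA, ← map_mul, Ideal.Quotient.eq_zero_iff_mem] at h
  rw [x_mul_mem hf h, map_zero]

lemma xA_rad (a : AA K (r+1) (m+1) (n+1) E F (s+1) (t+1)) (k : ℕ) (h : xA K r m n E F s t ∣ a ^ k) :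
    xA K r m n E F s t ∣ a := by
  classical
  obtain ⟨f, hf, rfl⟩ := exists_nf a
  obtain ⟨b, hb⟩ := h
  obtain ⟨g, rfl⟩ := Ideal.Quotient.mk_surjective b
  have e := modMonomial_add_divMonomial_single f x0
  set f1 := modMonomial f (Finsupp.single x0 1)
  set f2 := divMonomial f (Finsupp.single x0 1)
  obtain ⟨g2, hg2⟩ : X x0 ∣ f ^ k - f1 ^ k := by
    refine dvd_trans ?_ (sub_dvd_pow_sub_pow f f1 k)
    exact ⟨f2, by rw [← e]; ring⟩
  have hJ : f1 ^ k - X x0 * (g - g2) ∈ JJ K (r+1) (m+1) (n+1) E F (s+1) (t+1) := by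
    rw [← Ideal.Quotient.eq_zero_iff_mem]
    have : f1 ^ k - X x0 * (g - g2) = f ^ k - X x0 * g := by linear_combination -hg2
    rw [this, map_sub, map_pow, hb, map_mul, sub_self]
  have hsup : ∀ M ∈ f1.support, M ∈ f.support ∧ M x0 = 0 := by
    intro M hM
    by_cases hle : Finsupp.single x0 1 ≤ M
    · rw [mem_support_iff, coeff_modMonomial_of_le _ hle] at hM
      exact (hM rfl).elim
    · rw [mem_support_iff, coeff_modMonomial_of_not_le _ hle] at hM
      refine ⟨by simpa using hM, ?_⟩
      rw [Finsupp.single_le_iff] at hle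
      omega
  have h0 := x_radical (s := s+1) (t := t+1) (f := f1) (fun M hM => hf M (hsup M hM).1) (fun M hM => (hsup M hM).2) k (g - g2) hJ
  refine ⟨Ideal.Quotient.mk _ f2, ?_⟩
  rw [← e, h0, zero_add, map_mul]
end

section
variable {A B : Type*} [CommRing A] [CommRing B] 

lemma dvd_of_root {A : Type*} [CommRing A] (p : Polynomial A) (hp : p.Monic) (x a : A)
    (h : (p.scaleRoots x).eval a = 0) : x ∣ a ^ p.natDegree := by
  rw [← Ideal.mem_span_singleton, ← Ideal.Quotient.eq_zero_iff_mem]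
  set q := Ideal.Quotient.mk (Ideal.span {x})
  have hx : q x = 0 := Ideal.Quotient.eq_zero_iff_mem.2 (Ideal.mem_span_singleton_self x)
  have h1 := congrArg q h
  rcases subsingleton_or_nontrivial (A ⧸ Ideal.span {x}) with hs | hs
  · exact Subsingleton.elim _ _
  rw [map_zero, ← Polynomial.eval_map_apply, Polynomial.map_scaleRoots _ _ _ (by rw [hp.leadingCoeff]; simp), hx] at h1
  have hm := hp.map q
  rw [Polynomial.scaleRoots_zero, hm.leadingCoeff, one_smul, Polynomial.eval_pow, Polynomial.eval_X, hp.natDegree_map] at h1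
  rw [map_pow, h1]

lemma criterion [IsDomain B] [IsIntegrallyClosed B] (f : A →+* B) (hf : Function.Injective f) (x : A) (hx0 : x ≠ 0)
    (hrad : ∀ a k, x ∣ a ^ k → x ∣ a) (hr : ∀ b, ∃ k a, f x ^ k * b = f a) : IsDomain A ∧ IsIntegrallyClosed A := by
  have hd : IsDomain A := hf.isDomain f
  refine ⟨hd, ?_⟩
  rw [isIntegrallyClosed_iff (FractionRing A)]
  intro y hy
  let φ : FractionRing A →+* FractionRing B := IsFractionRing.map (A := A) (B := B) (K := FractionRing A) (L := FractionRing B) hf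
  have hφ : ∀ a, φ (algebraMap _ _ a) = algebraMap _ _ (f a) := fun a => IsLocalization.map_eq _ _
  have hyB : IsIntegral B (φ y) := by
    obtain ⟨p, hp, h⟩ := hy
    refine ⟨p.map f, hp.map f, ?_⟩
    have := congrArg φ h
    rw [map_zero, Polynomial.hom_eval₂] at this
    rw [Polynomial.eval₂_map, ← this]
    congr 1
    ext a
    exact (hφ a).symm
  obtain ⟨b, hb⟩ := (isIntegrallyClosed_iff (FractionRing B)).1 inferInstance hyB
  obtain ⟨k, a, hk⟩ := hr b
  have h1 : algebraMap A (FractionRing A) x ^ k * y = algebraMap A _ a := by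
    apply φ.injective
    rw [map_mul, map_pow, hφ, hφ, ← hb, ← map_pow, ← map_mul, hk]
  clear hk hb
  have hx' : algebraMap A (FractionRing A) x ≠ 0 := by
    rwa [Ne, IsFractionRing.to_map_eq_zero_iff]
  induction k generalizing a with
  | zero => exact ⟨a, by simpa using h1.symm⟩
  | succ k ih =>
    set z := algebraMap A (FractionRing A) x ^ k * y
    have hz : IsIntegral A z := (isIntegral_algebraMap.pow k).mul hy
    have hxz : algebraMap A (FractionRing A) x * z = algebraMap A _ a := by
      rw [← h1]; ring
    obtain ⟨p, hp, h⟩ := hz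
    have h2 := Polynomial.scaleRoots_aeval_eq_zero (a := z) (r := x) (p := p) h
    rw [hxz, Polynomial.aeval_algebraMap_apply, IsFractionRing.to_map_eq_zero_iff] at h2
    obtain ⟨c, hc⟩ := hrad a _ (dvd_of_root p hp x a (by simpa [Polynomial.aeval_def] using h2))
    refine ih c ?_
    apply mul_left_cancel₀ hx'
    rw [hxz, hc, map_mul]
end
end DD

namespace DD
open MvPolynomial
open Matrix
universe u

section
variable {S : Type*} [CommRing S]

lemma MinZ.cols {a b b' : Type*} [Fintype b] {k : ℕ} {M : Matrix a b S} (hM : MinZ k M)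
    {M' : Matrix a b' S} (n : b' → b → S) (h : ∀ i c, M' i c = (M *ᵥ n c) i) : MinZ k M' := by
  have : M' = M * Matrix.of (fun d c => n c d) := by
    ext i c
    rw [h]; rfl
  rw [this]
  exact hM.mul _

lemma MinZ.addCol {a b : Type*} {k : ℕ} {M : Matrix a b S} (hM : MinZ k M) (v : a → S) :
    MinZ (k+1) (Matrix.of (fun i (c : b ⊕ Unit) => Sum.elim (M i) (fun _ => v i) c)) := by
  classical
  intro ρ γ
  by_cases hγ : Function.Injective γ
  · obtain ⟨j, hj⟩ : ∃ j, ∀ l, ∃ a, γ (Fin.succAbove j l) = .inl a := by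
      by_cases h : ∃ j, γ j = .inr ()
      · obtain ⟨j, hj⟩ := h
        refine ⟨j, fun l => ?_⟩
        rcases h : γ (j.succAbove l) with a | ⟨⟩
        · exact ⟨a, rfl⟩
        · exact (Fin.succAbove_ne j l (hγ (h.trans hj.symm))).elim
      · refine ⟨0, fun l => ?_⟩
        rcases h' : γ ((0 : Fin (k+1)).succAbove l) with a | ⟨⟩
        · exact ⟨a, rfl⟩
        · exact (h ⟨_, h'⟩).elim
    choose γ' hγ' using hj
    rw [Matrix.det_succ_column _ j]
    refine Finset.sum_eq_zero fun i _ => ?_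
    have := hM (ρ ∘ i.succAbove) γ'
    rw [Matrix.submatrix_submatrix]
    convert mul_zero _
    rw [← this]
    congr 1
    ext a b
    simp [hγ']
  · obtain ⟨x, y, h1, h2⟩ := Function.not_injective_iff.1 hγ
    exact Matrix.det_zero_of_column_eq h2 (fun i => by simp [h1])

def padM {b : Type*} {m : ℕ} (M : Matrix (Fin m) b S) : Matrix (Fin (m+1)) b S :=
  fun i c => Fin.cases 0 (fun i => M i c) i
@[simp] lemma padM_zero {b : Type*} {m : ℕ} (M : Matrix (Fin m) b S) (c : b) : padM M 0 c = 0 := rfl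
@[simp] lemma padM_succ {b : Type*} {m : ℕ} (M : Matrix (Fin m) b S) (i : Fin m) (c : b) : padM M i.succ c = M i c := rfl

lemma MinZ.pad {b : Type*} {m k : ℕ} {M : Matrix (Fin m) b S} (hM : MinZ k M) :
    MinZ k (padM M) := by
  intro ρ γ
  by_cases h : ∃ a, ρ a = 0
  · obtain ⟨a, ha⟩ := h
    exact Matrix.det_eq_zero_of_row_eq_zero a (fun j => by simp [ha])
  · push Not at h
    choose ρ' hρ' using fun a => Fin.exists_succ_eq_of_ne_zero (h a)
    rw [← hM ρ' γ]
    congr 1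
    ext i j
    simp [← hρ']

lemma MinZ.schur {b : Type*} {m k : ℕ} {M : Matrix (Fin (m+1)) b S} (hM : MinZ (k+1) M) (c0 : b) (y : S)
    (hy : M 0 c0 * y = 1) : MinZ k (Matrix.of fun (i : Fin m) c => M i.succ c - M i.succ c0 * y * M 0 c) := by
  intro ρ γ
  have h1 := hM (Fin.cons 0 (fun a => (ρ a).succ)) (Fin.cons c0 γ)
  have h2 := Matrix.det_eq_of_forall_row_eq_smul_add_const
    (A := M.submatrix (Fin.cons 0 (fun a => (ρ a).succ)) (Fin.cons c0 γ))
    (B := Matrix.of (Fin.cons (fun l => M 0 (Fin.cons (α := fun _ => b) c0 γ l))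
      (fun a l => M (ρ a).succ (Fin.cons (α := fun _ => b) c0 γ l) - M (ρ a).succ c0 * y * M 0 (Fin.cons (α := fun _ => b) c0 γ l)) : Fin (k+1) → Fin (k+1) → S))
    (Fin.cons 0 (fun a => M (ρ a).succ c0 * y)) 0 (by simp) (by
      intro i j
      refine Fin.cases ?_ (fun i => ?_) i
      · simp
      · simp)
  rw [h1, Matrix.det_succ_column_zero, Fin.sum_univ_succ, Finset.sum_eq_zero] at h2
  · have h3 := congrArg (fun z => y * z) h2
    simp only [mul_zero, Fin.val_zero, pow_zero, one_mul, add_zero, Matrix.of_apply, Fin.cons_zero, ← mul_assoc] at h3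
    rw [mul_comm y, hy, one_mul] at h3
    rw [h3]
    congr 1
  · intro i _
    have : M (ρ i).succ c0 - M (ρ i).succ c0 * y * M 0 c0 = 0 := by
      linear_combination -(M (ρ i).succ c0) * hy
    simp [this]
end

section
variable {r m n : ℕ} {E F : Type} {S : Type*}

def swp : Var r n m F E → Var r m n E F
  | .inl (q, j, i) => .inl (q, i, j)
  | .inr (.inl (j, l)) => .inr (.inr (l, j))
  | .inr (.inr (k, i)) => .inr (.inl (i, k))

lemma Vm_swp (f : Var r m n E F → S) : Vm f = Hm (f ∘ swp) := by
  ext j c; rcases c with ⟨q, i⟩ | l <;> rfl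
lemma Hm_swp (f : Var r m n E F → S) : Hm f = Vm (f ∘ swp) := by
  ext j c; rcases c with ⟨q, i⟩ | l <;> rfl

variable [CommRing S]

def Phi (f : Var (r+1) m n (E ⊕ Fin r) (F ⊕ Fin r) → S) (x y : S) (c : Fin m → S) (ρ : Fin n → S)
    (d : Fin r → S) (g : E → S) (h : F → S) : Var (r+1) (m+1) (n+1) E F → S
  | .inl (q, i, j) => Fin.cases
      (Fin.cases (Fin.cases x (fun j => ρ j) j) (fun i => Fin.cases (c i) (fun j => f (.inl (0, i, j)) + c i * ρ j * y) j) i)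
      (fun q => Fin.cases (Fin.cases (d q) (fun j => f (.inr (.inr (.inr q, j))) + d q * ρ j * y) j)
        (fun i => Fin.cases (f (.inr (.inl (i, .inr q))) + c i * d q * y) (fun j => f (.inl (q.succ, i, j))
          + c i * f (.inr (.inr (.inr q, j))) * y + f (.inr (.inl (i, .inr q))) * ρ j * y + c i * d q * ρ j * y ^ 2) j) i) q
  | .inr (.inl (i, k)) => Fin.cases (g k) (fun i => f (.inr (.inl (i, .inl k))) + c i * g k * y) i
  | .inr (.inr (l, j)) => Fin.cases (h l) (fun j => f (.inr (.inr (.inl l, j))) + h l * ρ j * y) j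

lemma Phi_swp (f : Var (r+1) m n (E ⊕ Fin r) (F ⊕ Fin r) → S) (x y : S) (c : Fin m → S) (ρ : Fin n → S)
    (d : Fin r → S) (g : E → S) (h : F → S) : Phi f x y c ρ d g h ∘ swp = Phi (f ∘ swp) x y ρ c d h g := by
  ext v
  rcases v with ⟨q, j, i⟩ | ⟨j, l⟩ | ⟨k, i⟩
  · induction q using Fin.cases <;> induction i using Fin.cases <;> induction j using Fin.cases <;>
      simp [Phi, swp] <;> ring
  · induction j using Fin.cases <;> simp [Phi, swp]; ring
  · induction i using Fin.cases <;> simp [Phi, swp]; ring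

lemma Phi_H [Fintype E] {k : ℕ} (f : Var (r+1) m n (E ⊕ Fin r) (F ⊕ Fin r) → S) (x y : S) (c : Fin m → S) (ρ : Fin n → S)
    (d : Fin r → S) (g : E → S) (h : F → S) (hxy : x * y = 1) (hf : MinZ k (Hm f)) : MinZ (k+1) (Hm (Phi f x y c ρ d g h)) := by
  classical
  refine ((hf.pad).addCol (Fin.cons 1 (fun i => c i * y))).cols
    (fun col => Sum.elim (match col with
      | .inl (q, j) => Fin.cases (Fin.cases 0 (fun j => Pi.single (.inl (0, j)) 1) j)
          (fun q => Fin.cases (Pi.single (.inr (.inr q)) 1) (fun j => Pi.single (.inl (q.succ, j)) 1 + (ρ j * y) • Pi.single (.inr (.inr q)) 1) j) q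
      | .inr k => Pi.single (.inr (.inl k)) 1) (fun _ => Hm (Phi f x y c ρ d g h) 0 col)) ?_
  intro i col
  have e : ∀ (M : Matrix (Fin (m+1)) (((Fin (r+1) × Fin n) ⊕ (E ⊕ Fin r))) S) (v : Fin (m+1) → S)
      (a : ((Fin (r+1) × Fin n) ⊕ (E ⊕ Fin r)) → S) (b : Unit → S),
      ((Matrix.of (fun i (c : _ ⊕ Unit) => Sum.elim (M i) (fun _ => v i) c)) *ᵥ (Sum.elim a b)) i = (M *ᵥ a) i + v i * b () := by
    intro M v a b
    simp [Matrix.mulVec, dotProduct, Fintype.sum_sum_type]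
  rw [e]
  rcases col with ⟨q, j⟩ | k
  · induction q using Fin.cases <;> induction i using Fin.cases <;> induction j using Fin.cases <;>
      simp [Hm, Phi, Matrix.mulVec_add, Matrix.mulVec_smul, Matrix.col]
    all_goals first | ring | skip
    rename_i i
    linear_combination (-(c i)) * hxy
  · induction i using Fin.cases <;> simp [Hm, Phi]; ring

lemma Phi_good [Fintype E] [Fintype F] {s t : ℕ} (f : Var (r+1) m n (E ⊕ Fin r) (F ⊕ Fin r) → S) (x y : S) (c : Fin m → S) (ρ : Fin n → S)
    (d : Fin r → S) (g : E → S) (h : F → S) (hxy : x * y = 1) (hf : Good s t f) : Good (s+1) (t+1) (Phi f x y c ρ d g h) := by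
  refine ⟨Phi_H _ _ _ _ _ _ _ _ hxy hf.1, ?_⟩
  rw [Vm_swp, Phi_swp]
  refine Phi_H _ _ _ _ _ _ _ _ hxy ?_
  rw [← Vm_swp]
  exact hf.2

def Psi (f : Var (r+1) (m+1) (n+1) E F → S) (y : S) : Var (r+1) m n (E ⊕ Fin r) (F ⊕ Fin r) → S
  | .inl (q, i, j) => f (.inl (q, i.succ, j.succ)) - f (.inl (0, i.succ, 0)) * f (.inl (q, 0, j.succ)) * y
      - f (.inl (q, i.succ, 0)) * f (.inl (0, 0, j.succ)) * y
      + f (.inl (q, 0, 0)) * f (.inl (0, i.succ, 0)) * f (.inl (0, 0, j.succ)) * y ^ 2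
  | .inr (.inl (i, .inl k)) => f (.inr (.inl (i.succ, k))) - f (.inl (0, i.succ, 0)) * f (.inr (.inl (0, k))) * y
  | .inr (.inl (i, .inr q)) => f (.inl (q.succ, i.succ, 0)) - f (.inl (0, i.succ, 0)) * f (.inl (q.succ, 0, 0)) * y
  | .inr (.inr (.inl l, j)) => f (.inr (.inr (l, j.succ))) - f (.inl (0, 0, j.succ)) * f (.inr (.inr (l, 0))) * y
  | .inr (.inr (.inr q, j)) => f (.inl (q.succ, 0, j.succ)) - f (.inl (0, 0, j.succ)) * f (.inl (q.succ, 0, 0)) * y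

lemma Psi_swp (f : Var (r+1) (m+1) (n+1) E F → S) (y : S) : Psi f y ∘ swp = Psi (f ∘ swp) y := by
  ext v
  rcases v with ⟨q, j, i⟩ | ⟨j, l | q⟩ | ⟨k | q, i⟩ <;> simp [Psi, swp]
  ring

lemma Psi_H [Fintype E] {k : ℕ} (f : Var (r+1) (m+1) (n+1) E F → S) (y : S) (hy : f x0 * y = 1) (hf : MinZ (k+1) (Hm f)) :
    MinZ k (Hm (Psi f y)) := by
  classical
  refine (hf.schur (.inl (0, 0)) y hy).cols (fun col => match col with
      | .inl (q, j) => Pi.single (.inl (q, j.succ)) 1 - (f (.inl (0, 0, j.succ)) * y) • Pi.single (.inl (q, 0)) 1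
      | .inr (.inl k) => Pi.single (.inr k) 1
      | .inr (.inr q) => Pi.single (.inl (q.succ, 0)) 1) ?_
  intro i col
  rcases col with ⟨q, j⟩ | k | q <;> simp [Hm, Psi, Matrix.mulVec_sub, Matrix.mulVec_smul, Matrix.col] <;> ring

lemma Psi_good [Fintype E] [Fintype F] {s t : ℕ} (f : Var (r+1) (m+1) (n+1) E F → S) (y : S) (hy : f x0 * y = 1) (hf : Good (s+1) (t+1) f) :
    Good s t (Psi f y) := by
  refine ⟨Psi_H _ _ hy hf.1, ?_⟩
  rw [Vm_swp, Psi_swp]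
  refine Psi_H _ _ hy ?_
  rw [← Vm_swp]
  exact hf.2

lemma Phi_Psi (f : Var (r+1) (m+1) (n+1) E F → S) (y : S) (hy : f x0 * y = 1) :
    Phi (Psi f y) (f x0) y (fun i => f (.inl (0, i.succ, 0))) (fun j => f (.inl (0, 0, j.succ)))
      (fun q => f (.inl (q.succ, 0, 0))) (fun k => f (.inr (.inl (0, k)))) (fun l => f (.inr (.inr (l, 0)))) = f := by
  ext v
  rcases v with ⟨q, i, j⟩ | ⟨i, l⟩ | ⟨k, j⟩
  · induction q using Fin.cases <;> induction i using Fin.cases <;> induction j using Fin.cases <;>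
      simp only [Phi, Psi, Fin.cases_zero, Fin.cases_succ]
    all_goals first | ring | skip
    rename_i i j
    linear_combination (f (.inl (0, i.succ, 0)) * f (.inl (0, 0, j.succ)) * y) * hy
  · induction i using Fin.cases <;> simp [Phi, Psi]
  · induction j using Fin.cases <;> simp [Phi, Psi]; ring
end
end DD

namespace DD
open MvPolynomial
universe u

section
variable {r m n : ℕ} {E F : Type} {S T : Type*} [CommRing S] [CommRing T]

lemma Phi_map (e : S →+* T) (f : Var (r+1) m n (E ⊕ Fin r) (F ⊕ Fin r) → S) (x y : S) (c : Fin m → S) (ρ : Fin n → S)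
    (d : Fin r → S) (g : E → S) (h : F → S) (v : Var (r+1) (m+1) (n+1) E F) : e (Phi f x y c ρ d g h v) =
    Phi (fun v => e (f v)) (e x) (e y) (fun i => e (c i)) (fun i => e (ρ i)) (fun i => e (d i)) (fun i => e (g i)) (fun i => e (h i)) v := by
  rcases v with ⟨q, i, j⟩ | ⟨i, l⟩ | ⟨k, j⟩
  · induction q using Fin.cases <;> induction i using Fin.cases <;> induction j using Fin.cases <;>
      simp [Phi]
  · induction i using Fin.cases <;> simp [Phi]
  · induction j using Fin.cases <;> simp [Phi]

lemma Psi_Phi (f : Var (r+1) m n (E ⊕ Fin r) (F ⊕ Fin r) → S) (x y : S) (c : Fin m → S) (ρ : Fin n → S)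
    (d : Fin r → S) (g : E → S) (h : F → S) (hxy : x * y = 1) : Psi (Phi f x y c ρ d g h) y = f := by
  ext v
  rcases v with ⟨q, i, j⟩ | ⟨i, k | q⟩ | ⟨l | q, j⟩
  · induction q using Fin.cases
    · simp [Phi, Psi]
      linear_combination (c i * ρ j * y) * hxy
    · simp [Phi, Psi]
      ring
  all_goals simp [Phi, Psi]; try ring

lemma Psi_mem (U : Subring S) (f : Var (r+1) (m+1) (n+1) E F → S) (y : S) (hf : ∀ v, f v ∈ U) (hy : y ∈ U) (v) :
    Psi f y v ∈ U := by
  rcases v with ⟨q, i, j⟩ | ⟨i, k | q⟩ | ⟨l | q, j⟩ <;> simp only [Psi]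
  · exact U.add_mem (U.sub_mem (U.sub_mem (hf _) (U.mul_mem (U.mul_mem (hf _) (hf _)) hy)) (U.mul_mem (U.mul_mem (hf _) (hf _)) hy))
      (U.mul_mem (U.mul_mem (U.mul_mem (hf _) (hf _)) (hf _)) (U.pow_mem hy 2))
  all_goals exact U.sub_mem (hf _) (U.mul_mem (U.mul_mem (hf _) (hf _)) hy)
end

lemma ic_fin (R : Type u) [CommRing R] [IsDomain R] [IsIntegrallyClosed R] (n : ℕ) :
    IsIntegrallyClosed (MvPolynomial (Fin n) R) := by
  induction n with
  | zero => exact IsIntegrallyClosed.of_equiv (isEmptyRingEquiv R (Fin 0)).symm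
  | succ n ih => exact IsIntegrallyClosed.of_equiv (finSuccEquiv R n).symm.toRingEquiv

lemma ic_mv (R : Type u) [CommRing R] [IsDomain R] [IsIntegrallyClosed R] (τ : Type) [Fintype τ] :
    IsIntegrallyClosed (MvPolynomial τ R) := by
  have := ic_fin R (Fintype.card τ)
  exact IsIntegrallyClosed.of_equiv (renameEquiv R (Fintype.equivFin τ)).symm.toRingEquiv

/-- elements that become in the range after multiplying by powers -/
def rangeSub {A B : Type*} [CommRing A] [CommRing B] (φ : A →+* B) (x : A) : Subring B where
  carrier := {b | ∃ k a, φ x ^ k * b = φ a}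
  mul_mem' := by
    rintro b b' ⟨k, a, h⟩ ⟨k', a', h'⟩
    exact ⟨k + k', a * a', by rw [map_mul, ← h, ← h']; ring⟩
  one_mem' := ⟨0, 1, by simp⟩
  add_mem' := by
    rintro b b' ⟨k, a, h⟩ ⟨k', a', h'⟩
    exact ⟨k + k', x ^ k' * a + x ^ k * a', by rw [map_add, map_mul, map_mul, ← h, ← h', map_pow, map_pow]; ring⟩
  zero_mem' := ⟨0, 0, by simp⟩
  neg_mem' := by
    rintro b ⟨k, a, h⟩
    exact ⟨k, -a, by rw [map_neg, ← h]; ring⟩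

section
variable {K : Type u} [Field K] {r m n : ℕ} {E F : Type} {s t : ℕ}

lemma AA_hom_ext {S : Type*} [CommRing S] {f g : AA K r m n E F s t →+* S}
    (h1 : ∀ k, f (Ideal.Quotient.mk _ (C k)) = g (Ideal.Quotient.mk _ (C k)))
    (h2 : ∀ v, f (Ideal.Quotient.mk _ (X v)) = g (Ideal.Quotient.mk _ (X v))) : f = g := by
  apply Ideal.Quotient.ringHom_ext
  apply MvPolynomial.ringHom_ext
  · exact h1
  · exact h2

lemma AA_mem {S : Type*} [CommRing S] (f : AA K r m n E F s t →+* S) (U : Subring S)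
    (h1 : ∀ k, f (Ideal.Quotient.mk _ (C k)) ∈ U) (h2 : ∀ v, f (Ideal.Quotient.mk _ (X v)) ∈ U) (a) : f a ∈ U := by
  obtain ⟨p, rfl⟩ := Ideal.Quotient.mk_surjective a
  induction p using MvPolynomial.induction_on with
  | C k => exact h1 k
  | add p q hp hq => rw [map_add, map_add]; exact U.add_mem hp hq
  | mul_X p v hp => rw [map_mul, map_mul]; exact U.mul_mem hp (h2 v)

noncomputable def AA_lift {S : Type*} [CommRing S] (e : K →+* S) (f : Var r m n E F → S) (hf : Good s t f) :
    AA K r m n E F s t →+* S :=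
  Ideal.Quotient.lift _ (eval₂Hom e f) (fun a ha => JJ_le_ker (eval₂Hom e f) (by simpa using hf) ha)

lemma AA_lift_C {S : Type*} [CommRing S] (e : K →+* S) (f : Var r m n E F → S) (hf : Good s t f) (k : K) :
    AA_lift e f hf (Ideal.Quotient.mk _ (C k)) = e k := by
  exact eval₂Hom_C e f k
lemma AA_lift_X {S : Type*} [CommRing S] (e : K →+* S) (f : Var r m n E F → S) (hf : Good s t f) (v) :
    AA_lift e f hf (Ideal.Quotient.mk _ (X v)) = f v := by
  exact eval₂Hom_X' e f v
end

abbrev Tau (r m n : ℕ) (E F : Type) := Unit ⊕ Fin m ⊕ Fin n ⊕ Fin r ⊕ E ⊕ F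

section
variable {K : Type u} [Field K] {r m n : ℕ} {E F : Type} {s t : ℕ} [Fintype E] [Fintype F]

lemma step (hd : IsDomain (AA K (r+1) m n (E ⊕ Fin r) (F ⊕ Fin r) s t))
    (hi : IsIntegrallyClosed (AA K (r+1) m n (E ⊕ Fin r) (F ⊕ Fin r) s t)) :
    IsDomain (AA K (r+1) (m+1) (n+1) E F (s+1) (t+1)) ∧ IsIntegrallyClosed (AA K (r+1) (m+1) (n+1) E F (s+1) (t+1)) := by
  let A' := AA K (r+1) m n (E ⊕ Fin r) (F ⊕ Fin r) s t
  let A := AA K (r+1) (m+1) (n+1) E F (s+1) (t+1)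
  let P := MvPolynomial (Tau r m n E F) A'
  let xP : P := X (.inl ())
  let B := Localization.Away xP
  have hP : IsIntegrallyClosed P := ic_mv A' _
  have hle : Submonoid.powers xP ≤ nonZeroDivisors P :=
    powers_le_nonZeroDivisors_of_noZeroDivisors (X_ne_zero _)
  have hB : IsDomain B := IsLocalization.isDomain_localization hle
  have hBi : IsIntegrallyClosed B := isIntegrallyClosed_of_isLocalization (R := P) B (Submonoid.powers xP) hle
  let j : P →+* B := algebraMap P B
  let x : B := j xP
  let y : B := IsLocalization.Away.invSelf xP
  have hxy : x * y = 1 := IsLocalization.Away.mul_invSelf xP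
  let i : A' →+* B := j.comp C
  let c : Fin m → B := fun a => j (X (.inr (.inl a)))
  let ρ : Fin n → B := fun a => j (X (.inr (.inr (.inl a))))
  let d : Fin r → B := fun a => j (X (.inr (.inr (.inr (.inl a)))))
  let g : E → B := fun a => j (X (.inr (.inr (.inr (.inr (.inl a))))))
  let h : F → B := fun a => j (X (.inr (.inr (.inr (.inr (.inr a))))))
  let f' : Var (r+1) m n (E ⊕ Fin r) (F ⊕ Fin r) → B := fun v => i (Ideal.Quotient.mk _ (X v))
  let e : K →+* B := i.comp ((Ideal.Quotient.mk _).comp C)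
  have hg' : Good s t f' := good_mk.map i
  let φ : A →+* B := AA_lift e (Phi f' x y c ρ d g h) (Phi_good _ _ _ _ _ _ _ _ hxy hg')
  have hφC : ∀ k, φ (Ideal.Quotient.mk _ (C k)) = e k := AA_lift_C _ _ _
  have hφX : ∀ v, φ (Ideal.Quotient.mk _ (X v)) = Phi f' x y c ρ d g h v := AA_lift_X _ _ _
  clear_value φ
  -- inverse
  let xa : A := xA K r m n E F s t
  let Ax := Localization.Away xa
  let y' : Ax := IsLocalization.Away.invSelf xa
  let al : A →+* Ax := algebraMap A Ax
  have hxy' : al xa * y' = 1 := IsLocalization.Away.mul_invSelf xa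
  have hinj : Function.Injective al := by
    refine IsLocalization.injective Ax (M := Submonoid.powers xa) ?_
    refine Submonoid.powers_le.2 ?_
    rw [mem_nonZeroDivisors_iff_right]
    intro z hz
    exact xA_nzd z (by rw [mul_comm]; exact hz)
  let fA : Var (r+1) (m+1) (n+1) E F → Ax := fun v => al (Ideal.Quotient.mk _ (X v))
  have hgA : Good (s+1) (t+1) fA := good_mk.map al
  let i2 : A' →+* Ax := AA_lift (al.comp ((Ideal.Quotient.mk _).comp C)) (Psi fA y') (Psi_good _ _ hxy' hgA)
  have hi2C : ∀ k, i2 (Ideal.Quotient.mk _ (C k)) = al (Ideal.Quotient.mk _ (C k)) := AA_lift_C _ _ _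
  have hi2X : ∀ v, i2 (Ideal.Quotient.mk _ (X v)) = Psi fA y' v := AA_lift_X _ _ _
  clear_value i2
  let tv : Tau r m n E F → Ax := Sum.elim (fun _ => fA x0) (Sum.elim (fun i => fA (.inl (0, i.succ, 0)))
    (Sum.elim (fun j => fA (.inl (0, 0, j.succ))) (Sum.elim (fun q => fA (.inl (q.succ, 0, 0)))
      (Sum.elim (fun k => fA (.inr (.inl (0, k)))) (fun l => fA (.inr (.inr (l, 0))))))))
  let ψ0 : P →+* Ax := eval₂Hom i2 tv
  have hψ0X : ∀ v, ψ0 (X v) = tv v := fun v => eval₂Hom_X' i2 tv v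
  have hψ0C : ∀ a, ψ0 (C a) = i2 a := fun a => eval₂Hom_C i2 tv a
  have hu : IsUnit (ψ0 xP) := by
    have : ψ0 xP = al xa := hψ0X _
    rw [this]
    exact IsUnit.of_mul_eq_one _ hxy'
  let ψ : B →+* Ax := IsLocalization.Away.lift xP hu
  have hψj : ∀ p, ψ (j p) = ψ0 p := fun p => IsLocalization.Away.lift_eq xP hu p
  have hψi : ∀ a, ψ (i a) = i2 a := by
    intro a
    show ψ (j (C a)) = _
    rw [hψj]; exact hψ0C _
  have hψx : ψ x = fA x0 := by
    show ψ (j _) = _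
    rw [hψj]; exact hψ0X _
  have hψy : ψ y = y' := by
    have h1 := congrArg ψ hxy
    rw [map_mul, map_one, hψx] at h1
    calc ψ y = (al xa * y') * ψ y := by rw [hxy', one_mul]
      _ = (fA x0 * ψ y) * y' := by show (fA x0 * y') * _ = _; ring
      _ = y' := by rw [h1, one_mul]
  clear_value ψ
  have hcomp : ψ.comp φ = al := by
    apply AA_hom_ext
    · intro k
      rw [RingHom.comp_apply, hφC]
      show ψ (i _) = _
      rw [hψi]; exact hi2C k
    · intro v
      rw [RingHom.comp_apply, hφX, Phi_map, hψx, hψy]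
      refine Eq.trans ?_ (congrFun (Phi_Psi fA y' hxy') v)
      congr 1
      · funext v; show ψ (i _) = _; rw [hψi]; exact hi2X v
      · funext a; show ψ (j _) = _; rw [hψj]; exact hψ0X _
      · funext a; show ψ (j _) = _; rw [hψj]; exact hψ0X _
      · funext a; show ψ (j _) = _; rw [hψj]; exact hψ0X _
      · funext a; show ψ (j _) = _; rw [hψj]; exact hψ0X _
      · funext a; show ψ (j _) = _; rw [hψj]; exact hψ0X _
  have hφinj : Function.Injective φ := by
    have : Function.Injective (ψ.comp φ) := by rw [hcomp]; exact hinj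
    exact Function.Injective.of_comp (f := ψ) (by simpa using this)
  have hφxa : φ xa = x := hφX _
  let U := rangeSub φ xa
  have hUφ : ∀ a, φ a ∈ U := fun a => ⟨0, a, by simp⟩
  have hUy : y ∈ U := ⟨1, 1, by rw [pow_one, map_one, hφxa, hxy]⟩
  have hUP : ∀ v, Phi f' x y c ρ d g h v ∈ U := fun v => by rw [← hφX]; exact hUφ _
  have hUf : ∀ v, f' v ∈ U := by
    intro v
    rw [← Psi_Phi f' x y c ρ d g h hxy]
    exact Psi_mem U _ y hUP hUy v
  have hUi : ∀ a, i a ∈ U := by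
    refine AA_mem i U (fun k => ?_) hUf
    have := hUφ (Ideal.Quotient.mk _ (C k))
    rwa [hφC] at this
  have hUj : ∀ p, j p ∈ U := by
    intro p
    induction p using MvPolynomial.induction_on with
    | C k => exact hUi k
    | add p q hp hq => rw [map_add]; exact U.add_mem hp hq
    | mul_X p v hp =>
      rw [map_mul]
      refine U.mul_mem hp ?_
      rcases v with ⟨⟩ | a | a | a | a | a
      · exact hUP x0
      · exact hUP (.inl (0, a.succ, 0))
      · exact hUP (.inl (0, 0, a.succ))
      · exact hUP (.inl (a.succ, 0, 0))
      · exact hUP (.inr (.inl (0, a)))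
      · exact hUP (.inr (.inr (a, 0)))
  have hUall : ∀ b : B, b ∈ U := by
    intro b
    obtain ⟨k, p, hp⟩ := IsLocalization.Away.surj xP b
    have : b = j p * y ^ k := by
      show b = algebraMap P B p * y ^ k
      rw [← hp, mul_assoc]
      show b = b * (x ^ k * y ^ k)
      rw [← mul_pow, hxy, one_pow, mul_one]
    rw [this]
    exact U.mul_mem (hUj p) (U.pow_mem hUy k)
  have hxa0 : xa ≠ 0 := by
    intro h0
    have h1 := xA_nzd (1 : A) (by rw [mul_one]; exact h0)
    have := congrArg φ h1
    rw [map_one, map_zero] at this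
    exact one_ne_zero this
  exact criterion φ hφinj xa hxa0 xA_rad (fun b => hUall b)
end
end DD

namespace DD
open MvPolynomial
open Matrix
universe u

def ND (A : Type u) [CommRing A] : Prop := IsDomain A ∧ IsIntegrallyClosed A

lemma ND.of_iso {A B : Type u} [CommRing A] [CommRing B] (h : ND A) (f : A →+* B) (g : B →+* A)
    (h1 : f.comp g = RingHom.id B) (h2 : g.comp f = RingHom.id A) : ND B := by
  let e : A ≃+* B := RingEquiv.ofRingHom f g h1 h2
  have := h.1
  have := h.2
  exact ⟨e.symm.injective.isDomain e.symm.toRingHom, IsIntegrallyClosed.of_equiv e⟩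

section
variable {S : Type*} [CommRing S]
lemma MinZ.tr {a b a' b' : Type*} {k : ℕ} {M : Matrix a b S} (hM : MinZ k M) (α : b' → a) (β : a' → b) :
    MinZ k (Matrix.of fun i c => M (α c) (β i)) := by
  intro ρ γ
  rw [← Matrix.det_transpose]
  exact hM (α ∘ γ) (β ∘ ρ)
lemma MinZ.sub {a b a' b' : Type*} {k : ℕ} {M : Matrix a b S} (hM : MinZ k M) (α : a' → a) (β : b' → b) :
    MinZ k (Matrix.of fun i c => M (α i) (β c)) := by
  intro ρ γ
  exact hM (α ∘ ρ) (β ∘ γ)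
lemma MinZ.entry {a b : Type*} {M : Matrix a b S} (hM : MinZ 1 M) (i : a) (c : b) : M i c = 0 := by
  have := hM (fun _ => i) (fun _ => c)
  simpa using this
lemma MinZ.zero {a b : Type*} (k : ℕ) : MinZ (k+1) (0 : Matrix a b S) := by
  intro ρ γ
  exact Matrix.det_eq_zero_of_row_eq_zero 0 (fun _ => rfl)
end

section
variable {K : Type u} [Field K] {r m n : ℕ} {E F : Type} {s t : ℕ}

lemma ND_K (h : ∀ v, Ideal.Quotient.mk (JJ K r m n E F s t) (X v) = 0) : ND (AA K r m n E F s t) := by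
  have hK : ND K := ⟨inferInstance, inferInstance⟩
  have hg : Good s t (fun _ : Var r m n E F => (0 : K)) := by
    constructor
    · convert MinZ.zero (S := K) s using 1
      ext i c; rcases c with ⟨q, j⟩ | k <;> rfl
    · convert MinZ.zero (S := K) t using 1
      ext i c; rcases c with ⟨q, j⟩ | k <;> rfl
  refine hK.of_iso ((Ideal.Quotient.mk _).comp C) (AA_lift (RingHom.id K) (fun _ => 0) hg) ?_ ?_
  · apply AA_hom_ext
    · intro k
      rw [RingHom.comp_apply, AA_lift_C]; rfl
    · intro v
      rw [RingHom.comp_apply, AA_lift_X, map_zero, RingHom.id_apply, h]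
  · ext k
    rw [RingHom.comp_apply, RingHom.comp_apply, AA_lift_C]

lemma ND_swap (h : ND (AA K r n m F E t s)) : ND (AA K r m n E F s t) := by
  have g1 : Good s t (fun v => Ideal.Quotient.mk (JJ K r n m F E t s) (X (swp v))) := by
    have := good_mk (K := K) (r := r) (m := n) (n := m) (E := F) (F := E) (s := t) (t := s)
    refine ⟨?_, ?_⟩
    · have h2 := this.2
      rwa [Vm_swp] at h2
    · have h2 := this.1
      rwa [Hm_swp] at h2
  have g2 : Good t s (fun v => Ideal.Quotient.mk (JJ K r m n E F s t) (X (swp v))) := by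
    have := good_mk (K := K) (r := r) (m := m) (n := n) (E := E) (F := F) (s := s) (t := t)
    refine ⟨?_, ?_⟩
    · have h2 := this.2
      rwa [Vm_swp] at h2
    · have h2 := this.1
      rwa [Hm_swp] at h2
  refine h.of_iso (AA_lift ((Ideal.Quotient.mk _).comp C) _ g2) (AA_lift ((Ideal.Quotient.mk _).comp C) _ g1) ?_ ?_
  · apply AA_hom_ext
    · intro k
      rw [RingHom.comp_apply, AA_lift_C, RingHom.comp_apply, AA_lift_C]; rfl
    · intro v
      rw [RingHom.comp_apply, AA_lift_X, AA_lift_X]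
      rcases v with ⟨q, i, j⟩ | ⟨i, l⟩ | ⟨k, j⟩ <;> rfl
  · apply AA_hom_ext
    · intro k
      rw [RingHom.comp_apply, AA_lift_C, RingHom.comp_apply, AA_lift_C]; rfl
    · intro v
      rw [RingHom.comp_apply, AA_lift_X, AA_lift_X]
      rcases v with ⟨q, i, j⟩ | ⟨i, l⟩ | ⟨k, j⟩ <;> rfl

lemma G (t : ℕ) : ∀ (m n : ℕ) (E F : Type) [Fintype E] [Fintype F] [IsEmpty E] [IsEmpty F],
    ND (AA K (0+1) m n E F t t) := by
  induction t with
  | zero =>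
    intro m n E F _ _ _ _
    apply ND_K
    rintro (⟨q, i, j⟩ | ⟨i, l⟩ | ⟨k, j⟩)
    · exact good_mk.1.entry i (.inl (q, j))
    · exact isEmptyElim l
    · exact isEmptyElim k
  | succ t ih =>
    intro m n E F _ _ _ _
    rcases m with _ | m
    · apply ND_K
      rintro (⟨q, i, j⟩ | ⟨i, l⟩ | ⟨k, j⟩)
      · exact i.elim0
      · exact isEmptyElim l
      · exact isEmptyElim k
    rcases n with _ | n
    · apply ND_K
      rintro (⟨q, i, j⟩ | ⟨i, l⟩ | ⟨k, j⟩)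
      · exact j.elim0
      · exact isEmptyElim l
      · exact isEmptyElim k
    have := ih m n (E ⊕ Fin 0) (F ⊕ Fin 0)
    exact step this.1 this.2

lemma N0 [Fintype E] [Fintype F] (t : ℕ) : ND (AA K (r+1) m n E F 0 t) := by
  classical
  have hG := G (K := K) t (Fintype.card F) n Empty Empty
  let eq := Fintype.equivFin F
  let mC := Ideal.Quotient.mk (JJ K (0+1) (Fintype.card F) n Empty Empty t t)
  let mA := Ideal.Quotient.mk (JJ K (r+1) m n E F 0 t)
  let f : Var (r+1) m n E F → AA K (0+1) (Fintype.card F) n Empty Empty t t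
    | .inl _ => 0
    | .inr (.inl _) => 0
    | .inr (.inr (l, j)) => mC (X (.inl (0, eq l, j)))
  let g : Var (0+1) (Fintype.card F) n Empty Empty → AA K (r+1) m n E F 0 t
    | .inl (_, l, j) => mA (X (.inr (.inr (eq.symm l, j))))
    | .inr (.inl (_, k)) => k.elim
    | .inr (.inr (k, _)) => k.elim
  have gA : Good 0 t (fun v => mA (X v)) := good_mk
  have gC : Good t t (fun v => mC (X v)) := good_mk
  have hf : Good 0 t f := by
    constructor
    · convert MinZ.zero 0 using 1
      ext i c; rcases c with ⟨q, j⟩ | k <;> rfl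
    · refine gC.2.cols (fun c => match c with
        | .inl _ => 0
        | .inr l => Pi.single (.inl (0, eq l)) 1) ?_
      rintro j (⟨q, i⟩ | l)
      · simp [Vm, f]
      · simp [Vm, f, Matrix.col]
  have hg : Good t t g := by
    constructor
    · convert gA.2.tr (fun c : (Fin (0+1) × Fin n) ⊕ Empty => match c with
        | .inl (_, j) => j
        | .inr k => k.elim) (fun i => .inr (eq.symm i)) using 1
      ext i c; rcases c with ⟨q, j⟩ | k
      · rfl
      · exact k.elim
    · convert gA.2.sub id (fun c : (Fin (0+1) × Fin (Fintype.card F)) ⊕ Empty => match c with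
        | .inl (_, i) => .inr (eq.symm i)
        | .inr k => k.elim) using 1
      ext i c; rcases c with ⟨q, j⟩ | k
      · rfl
      · exact k.elim
  refine hG.of_iso (AA_lift (mA.comp C) g hg) (AA_lift (mC.comp C) f hf) ?_ ?_
  · apply AA_hom_ext
    · intro k
      rw [RingHom.comp_apply, AA_lift_C, RingHom.comp_apply, AA_lift_C]; rfl
    · intro v
      rw [RingHom.comp_apply, AA_lift_X]
      rcases v with ⟨q, i, j⟩ | ⟨i, k⟩ | ⟨l, j⟩
      · simp only [f, map_zero]
        exact (gA.1.entry i (.inl (q, j))).symm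
      · simp only [f, map_zero]
        exact (gA.1.entry i (.inr k)).symm
      · simp only [f]
        rw [AA_lift_X]
        simp only [g, Equiv.symm_apply_apply]
        rfl
  · apply AA_hom_ext
    · intro k
      rw [RingHom.comp_apply, AA_lift_C, RingHom.comp_apply, AA_lift_C]; rfl
    · intro v
      rw [RingHom.comp_apply, AA_lift_X]
      rcases v with ⟨q, i, j⟩ | ⟨i, k⟩ | ⟨l, j⟩
      · simp only [g]
        rw [AA_lift_X]
        obtain rfl : q = 0 := Fin.ext (by omega)
        simp only [f, Equiv.apply_symm_apply]
        rfl
      · exact k.elim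
      · exact l.elim

lemma NN (s : ℕ) : ∀ (t m n : ℕ) (E F : Type) [Fintype E] [Fintype F], s + 1 ≤ m → t + 1 ≤ n →
    ND (AA K (r+1) m n E F s t) := by
  induction s with
  | zero => intro t m n E F _ _ _ _; exact N0 t
  | succ s ih =>
    intro t m n E F _ _ hm hn
    rcases t with _ | t
    · exact ND_swap (N0 _)
    obtain ⟨m, rfl⟩ : ∃ m', m = m' + 1 := ⟨m - 1, by omega⟩
    obtain ⟨n, rfl⟩ : ∃ n', n = n' + 1 := ⟨n - 1, by omega⟩
    have := ih t m n (E ⊕ Fin r) (F ⊕ Fin r) (by omega) (by omega)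
    exact step this.1 this.2
end
end DD

namespace DD
open MvPolynomial
universe u

lemma minZ_of_sorted {S : Type*} [CommRing S] {k a b : ℕ} {M : Matrix (Fin a) (Fin b) S}
    (h : ∀ (rs : Fin k → Fin a) (cs : Fin k → Fin b), StrictMono rs → StrictMono cs →
      (M.submatrix rs cs).det = 0) : MinZ k M := by
  intro ρ γ
  by_cases hρ : Function.Injective ρ
  · by_cases hγ : Function.Injective γ
    · have h1 := h (ρ ∘ Tuple.sort ρ) (γ ∘ Tuple.sort γ)
        ((Tuple.monotone_sort ρ).strictMono_of_injective (hρ.comp (Tuple.sort ρ).injective))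
        ((Tuple.monotone_sort γ).strictMono_of_injective (hγ.comp (Tuple.sort γ).injective))
      have h2 : M.submatrix (ρ ∘ Tuple.sort ρ) (γ ∘ Tuple.sort γ) =
          ((M.submatrix ρ γ).submatrix (Tuple.sort ρ) id).submatrix id (Tuple.sort γ) := rfl
      rw [h2, Matrix.det_permute', Matrix.det_permute] at h1
      have hu : ∀ σ : Equiv.Perm (Fin k), IsUnit (((Equiv.Perm.sign σ : ℤ)) : S) := fun σ =>
        (Equiv.Perm.sign σ).isUnit.map (Int.castRingHom S)
      rwa [(hu _).mul_right_eq_zero, (hu _).mul_right_eq_zero] at h1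
    · simp only [Function.Injective, not_forall] at hγ
      obtain ⟨x, y, he, hne⟩ := hγ
      exact Matrix.det_zero_of_column_eq hne (fun i => by simp [he])
  · simp only [Function.Injective, not_forall] at hρ
    obtain ⟨x, y, he, hne⟩ := hρ
    refine Matrix.det_zero_of_row_eq hne ?_
    ext i; simp [he]

section
variable {K : Type u} [Field K] {r m n s t : ℕ} (hm : 0 < m) (hn : 0 < n)

lemma eH (q : Fin r) (i : Fin m) (j : Fin n) : varH r m n hn i (finProdFinEquiv (q, j)) = (q, i, j) := by
  have h1 : (j.val + n * q.val) / n = q.val := by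
    rw [Nat.add_mul_div_left _ _ hn, Nat.div_eq_of_lt j.2, zero_add]
  have h2 : (j.val + n * q.val) % n = j.val := by
    rw [Nat.add_mul_mod_self_left, Nat.mod_eq_of_lt j.2]
  simp only [varH, finProdFinEquiv_apply_val, h1, h2]

lemma eV (q : Fin r) (i : Fin m) (j : Fin n) : varV r m n hm (finProdFinEquiv (q, i)) j = (q, i, j) := by
  have h1 : (i.val + m * q.val) / m = q.val := by
    rw [Nat.add_mul_div_left _ _ hm, Nat.div_eq_of_lt i.2, zero_add]
  have h2 : (i.val + m * q.val) % m = i.val := by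
    rw [Nat.add_mul_mod_self_left, Nat.mod_eq_of_lt i.2]
  simp only [varV, finProdFinEquiv_apply_val, h1, h2]

abbrev fF (K : Type u) [Field K] (r m n s t : ℕ) (hm : 0 < m) (hn : 0 < n) : Var r m n Empty Empty →
    (MvPolynomial (Fin r × Fin m × Fin n) K ⧸ doubleDetIdeal K r m n s t hm hn) :=
  fun v => match v with
    | .inl v => Ideal.Quotient.mk _ (X v)
    | .inr _ => 0

lemma fF_good : Good s t (fF K r m n (s+1) (t+1) hm hn) := by
  have hH : MinZ (s+1) ((Hmat K r m n hn).map (Ideal.Quotient.mk (doubleDetIdeal K r m n (s+1) (t+1) hm hn))) := by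
    apply minZ_of_sorted
    intro rs cs h1 h2
    have : (Ideal.Quotient.mk (doubleDetIdeal K r m n (s+1) (t+1) hm hn))
        ((Hmat K r m n hn).submatrix rs cs).det = 0 :=
      Ideal.Quotient.eq_zero_iff_mem.2 (Ideal.subset_span (Or.inl ⟨rs, cs, h1, h2, rfl⟩))
    rw [RingHom.map_det] at this
    exact this
  have hV : MinZ (t+1) ((Vmat K r m n hm).map (Ideal.Quotient.mk (doubleDetIdeal K r m n (s+1) (t+1) hm hn))) := by
    apply minZ_of_sorted
    intro rs cs h1 h2
    have : (Ideal.Quotient.mk (doubleDetIdeal K r m n (s+1) (t+1) hm hn))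
        ((Vmat K r m n hm).submatrix rs cs).det = 0 :=
      Ideal.Quotient.eq_zero_iff_mem.2 (Ideal.subset_span (Or.inr ⟨rs, cs, h1, h2, rfl⟩))
    rw [RingHom.map_det] at this
    exact this
  constructor
  · have := hH.sub id (fun c : (Fin r × Fin n) ⊕ Empty => match c with
      | .inl (q, j) => finProdFinEquiv (q, j)
      | .inr e => e.elim)
    convert this using 1
    ext i c
    rcases c with ⟨q, j⟩ | k
    · show Ideal.Quotient.mk _ (X (q, i, j)) = Ideal.Quotient.mk _ (X (varH r m n hn i (finProdFinEquiv (q, j))))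
      rw [eH]
    · exact k.elim
  · have := hV.tr (fun c : (Fin r × Fin m) ⊕ Empty => match c with
      | .inl (q, i) => finProdFinEquiv (q, i)
      | .inr e => e.elim) id
    convert this using 1
    ext j c
    rcases c with ⟨q, i⟩ | k
    · show Ideal.Quotient.mk _ (X (q, i, j)) = Ideal.Quotient.mk _ (X (varV r m n hm (finProdFinEquiv (q, i)) j))
      rw [eV]
    · exact k.elim

noncomputable def gG (K : Type u) [Field K] (r m n s t : ℕ) : MvPolynomial (Fin r × Fin m × Fin n) K →+*
    AA K r m n Empty Empty s t :=
  eval₂Hom ((Ideal.Quotient.mk (JJ K r m n Empty Empty s t)).comp C)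
    (fun v => Ideal.Quotient.mk (JJ K r m n Empty Empty s t) (X (Sum.inl v)))

lemma gG_ker : doubleDetIdeal K r m n (s+1) (t+1) hm hn ≤ RingHom.ker (gG K r m n s t) := by
  have hg := good_mk (K := K) (r := r) (m := m) (n := n) (E := Empty) (F := Empty) (s := s) (t := t)
  have hX : ∀ v, gG K r m n s t (X v) = Ideal.Quotient.mk (JJ K r m n Empty Empty s t) (X (Sum.inl v)) :=
    fun v => eval₂Hom_X' _ _ v
  refine Ideal.span_le.2 ?_
  rintro d (⟨rs, cs, -, -, rfl⟩ | ⟨rs, cs, -, -, rfl⟩)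
  · show gG K r m n s t _ = 0
    rw [RingHom.map_det]
    refine Eq.trans ?_ (hg.1 rs (fun k => .inl ((varH r m n hn ⟨0, hm⟩ (cs k)).1, (varH r m n hn ⟨0, hm⟩ (cs k)).2.2)))
    congr 1
    ext a b
    exact hX _
  · show gG K r m n s t _ = 0
    rw [RingHom.map_det, ← Matrix.det_transpose]
    refine Eq.trans ?_ (hg.2 cs (fun k => .inl ((varV r m n hm (rs k) ⟨0, hn⟩).1, (varV r m n hm (rs k) ⟨0, hn⟩).2.1)))
    congr 1
    ext a b
    exact hX _

lemma final (h : ND (AA K r m n Empty Empty s t)) :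
    ND (MvPolynomial (Fin r × Fin m × Fin n) K ⧸ doubleDetIdeal K r m n (s+1) (t+1) hm hn) := by
  have hX : ∀ v, gG K r m n s t (X v) = Ideal.Quotient.mk (JJ K r m n Empty Empty s t) (X (Sum.inl v)) :=
    fun v => eval₂Hom_X' _ _ v
  have hC : ∀ k, gG K r m n s t (C k) = Ideal.Quotient.mk (JJ K r m n Empty Empty s t) (C k) :=
    fun v => eval₂Hom_C _ _ v
  refine h.of_iso (AA_lift ((Ideal.Quotient.mk _).comp C) _ (fF_good hm hn))
    (Ideal.Quotient.lift _ (gG K r m n s t) (fun a ha => RingHom.mem_ker.1 (gG_ker hm hn ha))) ?_ ?_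
  · apply Ideal.Quotient.ringHom_ext
    apply MvPolynomial.ringHom_ext
    · intro k
      rw [RingHom.comp_apply, RingHom.comp_apply, Ideal.Quotient.lift_mk, hC, AA_lift_C]; rfl
    · intro v
      rw [RingHom.comp_apply, RingHom.comp_apply, Ideal.Quotient.lift_mk, hX, AA_lift_X]; rfl
  · apply AA_hom_ext
    · intro k
      rw [RingHom.comp_apply, AA_lift_C, RingHom.comp_apply, Ideal.Quotient.lift_mk, hC]; rfl
    · intro v
      rw [RingHom.comp_apply, AA_lift_X]
      rcases v with v | ⟨_, k⟩ | ⟨k, _⟩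
      · show Ideal.Quotient.lift _ _ _ (Ideal.Quotient.mk _ (X v)) = _
        rw [Ideal.Quotient.lift_mk, hX]; rfl
      · exact k.elim
      · exact k.elim
end
end DD

theorem double_determinantal_normal_domain (K : Type*) [Field K] [PerfectField K]
    (r m n s t : ℕ) (hr : 1 ≤ r) (hm : 0 < m) (hn : 0 < n)
    (hs : 1 ≤ s) (hsm : s ≤ m) (ht : 1 ≤ t) (htn : t ≤ n) :
    IsDomain (MvPolynomial (Fin r × Fin m × Fin n) K ⧸ doubleDetIdeal K r m n s t hm hn) ∧
    IsIntegrallyClosed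
      (MvPolynomial (Fin r × Fin m × Fin n) K ⧸ doubleDetIdeal K r m n s t hm hn) := by
  obtain ⟨r, rfl⟩ : ∃ r', r = r' + 1 := ⟨r - 1, by omega⟩
  obtain ⟨s, rfl⟩ : ∃ s', s = s' + 1 := ⟨s - 1, by omega⟩
  obtain ⟨t, rfl⟩ : ∃ t', t = t' + 1 := ⟨t - 1, by omega⟩
  exact DD.final hm hn (DD.NN s t m n Empty Empty hsm htn)

end
end
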